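/- Let N > 2 and let a, c : ℝ^N → ℝ be locally Hölder continuous with some exponent α ∈ (0,1), with a(x) > 0 and c(x) > 0 for all x ∈ ℝ^N. Define φ(r) = max_{|x|=r} a(x) and assume ∫₀^∞ r·φ(r) dr < ∞. Then there exists a function u of class C^{2,α}_loc(ℝ^N) with u > 0 on ℝ^N, u(x) → 0 as |x| → ∞, and −Δu(x) + c(x)·u(x)^{−1}·|∇u(x)|² = a(x) for every x ∈ ℝ^N. -/

import Mathlib

open Set Filter MeasureTheory

/-- The Laplacian of `u : ℝ^N → ℝ`: the sum of its second partial derivatives. -/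
noncomputable def lap {N : ℕ} (u : EuclideanSpace ℝ (Fin N) → ℝ)
    (x : EuclideanSpace ℝ (Fin N)) : ℝ :=
  ∑ i : Fin N, fderiv ℝ (fun y => fderiv ℝ u y (EuclideanSpace.single i 1)) x
    (EuclideanSpace.single i 1)

/-- `f` is locally α-Hölder continuous on `ℝ^N`: Hölder continuous with exponent α on every
compact subset. -/
def LocHolder {N : ℕ} {F : Type*} [PseudoEMetricSpace F] (α : NNReal)
    (f : EuclideanSpace ℝ (Fin N) → F) : Prop :=
  ∀ K : Set (EuclideanSpace ℝ (Fin N)), IsCompact K → ∃ C : NNReal, HolderOnWith C α f K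

set_option linter.unusedSectionVars false
set_option linter.unusedVariables false
set_option linter.unusedSimpArgs false
set_option linter.style.setOption false

section PartA
variable {E : Type*} [NormedAddCommGroup E] [InnerProductSpace ℝ E] [FiniteDimensional ℝ E]

/-- The inner product as a bilinear map. -/
noncomputable def ip : E →L[ℝ] E →L[ℝ] ℝ := innerSL ℝ

theorem ip_apply (x y : E) : ip x y = inner ℝ x y := rfl

theorem norm_ip (x : E) : ‖ip x‖ = ‖x‖ := innerSL_apply_norm ℝ x

/-- Trace of a bilinear form with respect to an orthonormal basis. -/
noncomputable def btr (B : E →L[ℝ] E →L[ℝ] ℝ) : ℝ :=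
  ∑ i, B (stdOrthonormalBasis ℝ E i) (stdOrthonormalBasis ℝ E i)

/-- The Hessian as a continuous bilinear map. -/
noncomputable def hs (v : E → ℝ) (x : E) : E →L[ℝ] E →L[ℝ] ℝ := fderiv ℝ (fderiv ℝ v) x

theorem btr_aux {κ : Type*} [Fintype κ] (c : OrthonormalBasis κ ℝ E)
    (B : E →L[ℝ] E →L[ℝ] ℝ) :
      ∑ i, B (c i) (c i) = LinearMap.trace ℝ E
        (((InnerProductSpace.toDual ℝ E).symm.toLinearEquiv.toLinearMap).comp
          (B : E →ₗ[ℝ] (E →L[ℝ] ℝ))) := by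
  rw [LinearMap.trace_eq_sum_inner _ c]
  refine Finset.sum_congr rfl fun i _ => ?_
  rw [real_inner_comm]
  simp

theorem btr_eq_basis {ι : Type*} [Fintype ι] (b : OrthonormalBasis ι ℝ E)
    (B : E →L[ℝ] E →L[ℝ] ℝ) : btr B = ∑ i, B (b i) (b i) := by
  rw [btr_aux b, btr, btr_aux]

theorem btr_add (A B : E →L[ℝ] E →L[ℝ] ℝ) : btr (A + B) = btr A + btr B := by
  simp [btr, Finset.sum_add_distrib]

theorem btr_sub (A B : E →L[ℝ] E →L[ℝ] ℝ) : btr (A - B) = btr A - btr B := by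
  simp [btr, Finset.sum_sub_distrib]

theorem btr_smul (c : ℝ) (B : E →L[ℝ] E →L[ℝ] ℝ) : btr (c • B) = c * btr B := by
  simp [btr, Finset.mul_sum]

theorem btr_ip : btr (ip : E →L[ℝ] E →L[ℝ] ℝ) = Module.finrank ℝ E := by
  simp [btr, ip_apply]

theorem btr_smulRight (l m : E →L[ℝ] ℝ) :
    btr (l.smulRight m) = ∑ i, l (stdOrthonormalBasis ℝ E i) * m (stdOrthonormalBasis ℝ E i) := by
  simp [btr]

theorem sum_sq_eq_norm_sq (l : E →L[ℝ] ℝ) :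
    ∑ i, l (stdOrthonormalBasis ℝ E i) * l (stdOrthonormalBasis ℝ E i) = ‖l‖ ^ 2 := by
  have h := (stdOrthonormalBasis ℝ E).sum_sq_norm_inner_right ((InnerProductSpace.toDual ℝ E).symm l)
  rw [LinearIsometryEquiv.norm_map] at h
  rw [← h]
  refine Finset.sum_congr rfl fun i _ => ?_
  rw [real_inner_comm]
  simp [sq]

theorem second_deriv_test {f f' : ℝ → ℝ} {c : ℝ} (h1 : ∀ᶠ t in nhds 0, HasDerivAt f (f' t) t)
    (h2 : HasDerivAt f' c 0) (hm : IsLocalMax f 0) : c ≤ 0 := by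
  by_contra hc
  push Not at hc
  have hd : deriv f =ᶠ[nhds 0] f' := h1.mono fun t ht => ht.deriv
  have h0 : deriv f 0 = 0 := hm.deriv_eq_zero
  have h3 : deriv (deriv f) 0 = c := by rw [hd.deriv_eq, h2.deriv]
  have hmin := isLocalMin_of_deriv_deriv_pos (by rw [h3]; exact hc) h0 h1.self_of_nhds.continuousAt
  have hconst : f =ᶠ[nhds 0] fun _ => f 0 := by
    filter_upwards [hm, hmin] with t a b using le_antisymm a b
  have h4 : deriv f =ᶠ[nhds 0] fun _ => 0 := by
    filter_upwards [hconst.eventuallyEq_nhds] with t ht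
    rw [ht.deriv_eq]; simp
  have h5 : deriv (deriv f) 0 = 0 := by rw [h4.deriv_eq]; simp
  linarith

theorem line_deriv1 {v : E → ℝ} {x e : E} (hv : ContDiffAt ℝ 2 v x) :
    ∀ᶠ t : ℝ in nhds 0, HasDerivAt (fun t : ℝ => v (x + t • e)) (fderiv ℝ v (x + t • e) e) t := by
  have h1 : ∀ᶠ y in nhds x, DifferentiableAt ℝ v y := by
    have := hv.eventually (by simp)
    exact this.mono fun y hy => hy.differentiableAt (by simp)
  have h2 : Tendsto (fun t : ℝ => x + t • e) (nhds 0) (nhds x) := by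
    have : Continuous (fun t : ℝ => x + t • e) := by fun_prop
    simpa using this.tendsto 0
  filter_upwards [h2.eventually h1] with t ht
  have hl : HasDerivAt (fun t : ℝ => x + t • e) e t := by
    simpa using ((hasDerivAt_id t).smul_const e).const_add x
  exact ht.hasFDerivAt.comp_hasDerivAt t hl

theorem line_deriv2 {v : E → ℝ} {x e : E} (hv : ContDiffAt ℝ 2 v x) :
    HasDerivAt (fun t : ℝ => fderiv ℝ v (x + t • e) e) (hs v x e e) 0 := by
  have h1 : DifferentiableAt ℝ (fderiv ℝ v) x :=
    (hv.fderiv_right (m := 1) (by norm_num)).differentiableAt (by simp)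
  have hl : HasDerivAt (fun t : ℝ => x + t • e) e 0 := by
    simpa using ((hasDerivAt_id (0:ℝ)).smul_const e).const_add x
  have h2 : HasFDerivAt (fderiv ℝ v) (hs v x) (x + (0:ℝ) • e) := by
    simpa [hs] using h1.hasFDerivAt
  have h3 := h2.comp_hasDerivAt (0:ℝ) hl
  exact ((ContinuousLinearMap.apply ℝ ℝ e).hasFDerivAt.comp_hasDerivAt (0:ℝ) h3)

theorem hs_le_of_max {v : E → ℝ} {x : E} (hv : ContDiffAt ℝ 2 v x) (hm : IsLocalMax v x) (e : E) :
    hs v x e e ≤ 0 := by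
  refine second_deriv_test (line_deriv1 (e := e) hv) (line_deriv2 hv) ?_
  have h2 : Tendsto (fun t : ℝ => x + t • e) (nhds 0) (nhds x) := by
    have : Continuous (fun t : ℝ => x + t • e) := by fun_prop
    simpa using this.tendsto 0
  have := h2.eventually hm
  simpa [IsLocalMax, IsMaxFilter] using this

theorem btr_le_of_max {v : E → ℝ} {x : E} (hv : ContDiffAt ℝ 2 v x) (hm : IsLocalMax v x) :
    btr (hs v x) ≤ 0 :=
  Finset.sum_nonpos fun _ _ => hs_le_of_max hv hm _

theorem fderiv_diff {v : E → ℝ} {x : E} (hv : ContDiffAt ℝ 2 v x) :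
    DifferentiableAt ℝ (fderiv ℝ v) x :=
  (hv.fderiv_right (m := 1) (by norm_num)).differentiableAt (by simp)

theorem diff_ev {v : E → ℝ} {x : E} (hv : ContDiffAt ℝ 2 v x) :
    ∀ᶠ y in nhds x, DifferentiableAt ℝ v y :=
  (hv.eventually (by simp)).mono fun _ hy => hy.differentiableAt (by simp)

theorem hs_sub {v w : E → ℝ} {x : E} (hv : ContDiffAt ℝ 2 v x) (hw : ContDiffAt ℝ 2 w x) :
    hs (fun y => v y - w y) x = hs v x - hs w x := by
  have : fderiv ℝ (fun y => v y - w y) =ᶠ[nhds x] fun y => fderiv ℝ v y - fderiv ℝ w y := by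
    filter_upwards [diff_ev hv, diff_ev hw] with y h1 h2 using fderiv_fun_sub h1 h2
  rw [hs, this.fderiv_eq, fderiv_fun_sub (fderiv_diff hv) (fderiv_diff hw)]; rfl

theorem fderiv_normsq (x : E) : fderiv ℝ (fun y : E => ‖y‖ ^ 2) x = 2 • ip x :=
  (hasStrictFDerivAt_norm_sq x).hasFDerivAt.fderiv

theorem contDiff_const_mul_normsq (ε : ℝ) : ContDiff ℝ 2 (fun y : E => ε * ‖y‖ ^ 2) :=
  contDiff_const.mul (contDiff_norm_sq ℝ)

theorem fderiv_eps (ε : ℝ) (x : E) :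
    fderiv ℝ (fun y : E => ε * ‖y‖ ^ 2) x = (2 * ε) • ip x := by
  rw [fderiv_const_mul ((contDiff_norm_sq ℝ (n := 1)).differentiable (by simp) x), fderiv_normsq]
  ext y; simp [ip_apply]; ring

theorem hs_eps (ε : ℝ) (x : E) :
    hs (fun y : E => ε * ‖y‖ ^ 2) x = (2 * ε) • (ip : E →L[ℝ] E →L[ℝ] ℝ) := by
  have : fderiv ℝ (fun y : E => ε * ‖y‖ ^ 2) =
      ⇑((2 * ε) • (ip : E →L[ℝ] E →L[ℝ] ℝ) : E →L[ℝ] E →L[ℝ] ℝ) := by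
    ext1 y; rw [fderiv_eps]; rfl
  rw [hs, this]
  exact ContinuousLinearMap.fderiv _

theorem comparison {F : E → ℝ → (E →L[ℝ] ℝ) → ℝ} {L : ℝ} (hL : 0 ≤ L)
    (hmono : ∀ x s t q, s ≤ t → F x s q ≤ F x t q)
    (hlip : ∀ x s p q, |F x s p - F x s q| ≤ L * ‖p - q‖)
    {v w : E → ℝ} (hv : ContDiff ℝ 2 v) (hw : ContDiff ℝ 2 w) {M : ℝ}
    (hvM : ∀ x, |v x| ≤ M) (hwM : ∀ x, |w x| ≤ M) {lam η : ℝ} (hlam : 0 < lam) (hη : 0 ≤ η)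
    (heq : ∀ x, lam * v x - btr (hs v x) + F x (v x) (fderiv ℝ v x)
      ≤ lam * w x - btr (hs w x) + F x (w x) (fderiv ℝ w x) + η) (x : E) :
    v x - w x ≤ η / lam := by
  by_contra hcon
  push Not at hcon
  set γ := v x - w x - η / lam with hγ
  have hγ0 : 0 < γ := by linarith
  have hM : 0 ≤ M := (abs_nonneg _).trans (hvM x)
  have hlim : Tendsto (fun s : ℝ => lam * (s ^ 2 * ‖x‖ ^ 2) + 2 * s ^ 2 * Module.finrank ℝ E
      + L * (2 * (s * √(2 * M)))) (nhds 0) (nhds 0) := by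
    have : Continuous (fun s : ℝ => lam * (s ^ 2 * ‖x‖ ^ 2) + 2 * s ^ 2 * Module.finrank ℝ E
      + L * (2 * (s * √(2 * M)))) := by fun_prop
    simpa using this.tendsto 0
  have hlim' := (hlim.mono_left (nhdsWithin_le_nhds (s := Ioi 0))).eventually_lt_const
    (mul_pos hlam hγ0)
  obtain ⟨s, hs1, hs0⟩ := (hlim'.and self_mem_nhdsWithin).exists
  replace hs0 : 0 < s := hs0
  set ε := s ^ 2 with hε
  have hε0 : 0 < ε := by positivity
  set d : E → ℝ := fun y => (v y - w y) - ε * ‖y‖ ^ 2 with hd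
  have hdc : Continuous d := by
    have := hv.continuous; have := hw.continuous; fun_prop
  have hub : ∀ y, v y - w y ≤ 2 * M := fun y => by
    have a := abs_le.1 (hvM y); have b := abs_le.1 (hwM y); linarith
  have hbot : Tendsto d (cocompact E) atBot := by
    have h1 : Tendsto (fun y : E => ε * ‖y‖ ^ 2 - 2 * M) (cocompact E) atTop := by
      apply tendsto_atTop_add_const_right
      exact ((tendsto_pow_atTop (by norm_num)).comp (tendsto_norm_cocompact_atTop (E := E))).const_mul_atTop hε0
    have h2 := tendsto_neg_atTop_atBot.comp h1
    refine tendsto_atBot_mono (fun y => ?_) h2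
    simp only [Function.comp, hd]
    linarith [hub y]
  obtain ⟨z, hz⟩ := hdc.exists_forall_ge hbot
  have hzx := hz x
  have h0d : η / lam + γ - ε * ‖x‖ ^ 2 ≤ d z := by
    have : d x = η / lam + γ - ε * ‖x‖ ^ 2 := by simp only [hd, hγ]; ring
    linarith
  have hlz : IsLocalMax d z := Eventually.of_forall hz
  have hvw : ContDiff ℝ 2 (fun y => v y - w y) := hv.sub hw
  have hdC : ContDiff ℝ 2 d := hvw.sub (contDiff_const_mul_normsq ε)
  have hg := hlz.fderiv_eq_zero
  have hh := btr_le_of_max hdC.contDiffAt hlz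
  have e1 : hs d z = hs v z - hs w z - (2 * ε) • (ip : E →L[ℝ] E →L[ℝ] ℝ) := by
    rw [hd, hs_sub hvw.contDiffAt (contDiff_const_mul_normsq ε).contDiffAt,
      hs_sub hv.contDiffAt hw.contDiffAt, hs_eps]
  have e2 : fderiv ℝ v z - fderiv ℝ w z = (2 * ε) • ip z := by
    have : fderiv ℝ d z = fderiv ℝ v z - fderiv ℝ w z - (2 * ε) • ip z := by
      rw [hd, fderiv_fun_sub (hvw.differentiable (by simp) z)
        ((contDiff_const_mul_normsq ε).differentiable (by simp) z),
        fderiv_fun_sub (hv.differentiable (by simp) z) (hw.differentiable (by simp) z), fderiv_eps]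
    rw [this] at hg
    exact sub_eq_zero.1 hg
  rw [e1, btr_sub, btr_sub, btr_smul, btr_ip] at hh
  have hnorm : ‖fderiv ℝ v z - fderiv ℝ w z‖ ≤ 2 * (s * √(2 * M)) := by
    rw [e2, norm_smul, norm_ip, Real.norm_eq_abs, abs_of_pos (by positivity)]
    have hdz : ε * ‖z‖ ^ 2 ≤ 2 * M := by
      have h00 := hz 0
      have := hub z
      by_contra hcc
      push Not at hcc
      have : d z < 0 := by simp only [hd]; linarith
      have h3 : 0 ≤ lam * (η / lam + γ - ε * ‖x‖ ^ 2) := by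
        have : lam * (η / lam) = η := by field_simp
        have : 0 ≤ L * (2 * (s * √(2 * M))) := by positivity
        have : 0 ≤ 2 * ε * (Module.finrank ℝ E : ℝ) := by positivity
        nlinarith
      have h4 := nonneg_of_mul_nonneg_right h3 hlam
      linarith
    have : s * ‖z‖ ≤ √(2 * M) := by
      apply Real.le_sqrt_of_sq_le
      rw [mul_pow]; exact hdz
    have : s * (s * ‖z‖) ≤ s * √(2 * M) := mul_le_mul_of_nonneg_left this hs0.le
    rw [hε]; nlinarith
  have hvz : w z ≤ v z := by
    have h3 : 0 ≤ lam * (η / lam + γ - ε * ‖x‖ ^ 2) := by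
      have : lam * (η / lam) = η := by field_simp
      have : 0 ≤ L * (2 * (s * √(2 * M))) := by positivity
      have : 0 ≤ 2 * ε * (Module.finrank ℝ E : ℝ) := by positivity
      nlinarith
    have h4 := nonneg_of_mul_nonneg_right h3 hlam
    have : 0 ≤ ε * ‖z‖ ^ 2 := by positivity
    have : d z = v z - w z - ε * ‖z‖ ^ 2 := rfl
    linarith
  have hF1 := hmono z _ _ (fderiv ℝ v z) hvz
  have hF2 := (abs_le.1 (hlip z (w z) (fderiv ℝ v z) (fderiv ℝ w z))).1
  have hF3 := mul_le_mul_of_nonneg_left hnorm hL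
  have hq := heq z
  have hdz : d z ≤ v z - w z := by
    have : 0 ≤ ε * ‖z‖ ^ 2 := by positivity
    simp only [hd]; linarith
  have : lam * (η / lam) = η := by field_simp
  have h9 : lam * (η / lam + γ - ε * ‖x‖ ^ 2) ≤ lam * (v z - w z) :=
    mul_le_mul_of_nonneg_left (h0d.trans hdz) hlam.le
  nlinarith
end PartA

set_option linter.unusedSectionVars false

section PartB
variable {E : Type*} [NormedAddCommGroup E] [InnerProductSpace ℝ E] [FiniteDimensional ℝ E]

theorem right_deriv_nonpos {g : ℝ → ℝ} {c : ℝ} (hg : HasDerivAt g c 0)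
    (h : ∀ᶠ t in nhdsWithin (0:ℝ) (Ioi 0), g t ≤ g 0) : c ≤ 0 := by
  have h1 := hasDerivAt_iff_tendsto_slope.1 hg
  have h2 : Tendsto (slope g 0) (nhdsWithin 0 (Ioi 0)) (nhds c) :=
    h1.mono_left (nhdsWithin_mono _ (fun t ht => ne_of_gt ht))
  refine le_of_tendsto h2 ?_
  filter_upwards [h, self_mem_nhdsWithin] with t ht ht0
  rw [slope_def_field]
  have : (0:ℝ) < t := ht0
  apply div_nonpos_of_nonpos_of_nonneg <;> linarith

theorem opNorm_le_of_unit_le {l : E →L[ℝ] ℝ} {C : ℝ} (hC : 0 ≤ C) (h : ∀ e : E, ‖e‖ = 1 → l e ≤ C) :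
    ‖l‖ ≤ C := by
  refine ContinuousLinearMap.opNorm_le_of_unit_norm hC fun e he => ?_
  rw [Real.norm_eq_abs, abs_le]
  have h1 := h e he
  have h2 := h (-e) (by simpa using he)
  rw [map_neg] at h2
  constructor <;> linarith

theorem normsq_line (z e : E) (t : ℝ) (he : ‖e‖ = 1) :
    ‖z + t • e‖ ^ 2 = ‖z‖ ^ 2 + 2 * t * inner ℝ z e + t ^ 2 := by
  rw [norm_add_sq_real, inner_smul_right, norm_smul, he]
  simp; ring

theorem ishii_lions_aux {v : E → ℝ} (hv : ContDiff ℝ 2 v) {x y x0 : E} {C : ℝ} (hC : 0 ≤ C)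
    (hxy : x ≠ y) {Φ Φ' : ℝ → ℝ} {Φ'' : ℝ}
    (hmono : ∀ s t, 0 ≤ s → s ≤ t → Φ s ≤ Φ t)
    (h1 : ∀ᶠ t in nhds ‖x - y‖, HasDerivAt Φ (Φ' t) t)
    (h2 : HasDerivAt Φ' Φ'' ‖x - y‖) (hΦ' : 0 ≤ Φ' ‖x - y‖)
    (hmax : ∀ᶠ p : E × E in nhds (x, y), v p.1 - v p.2 - Φ ‖p.1 - p.2‖ - C * ‖p.1 - x0‖ ^ 2
      ≤ v x - v y - Φ ‖x - y‖ - C * ‖x - x0‖ ^ 2) :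
    btr (hs v x) - btr (hs v y) ≤ 4 * Φ'' + 2 * C * Module.finrank ℝ E ∧
    ‖fderiv ℝ v x‖ ≤ Φ' ‖x - y‖ + 2 * C * ‖x - x0‖ ∧ ‖fderiv ℝ v y‖ ≤ Φ' ‖x - y‖ := by
  set r := ‖x - y‖ with hr
  have hr0 : 0 < r := norm_pos_iff.2 (sub_ne_zero.2 hxy)
  -- general second order inequality in a direction
  have hsec : ∀ e : E, ‖e‖ = 1 → hs v x e e - hs v y e e ≤ 2 * C := by
    intro e he
    have hlim : Tendsto (fun t : ℝ => (x + t • e, y + t • e)) (nhds 0) (nhds (x, y)) := by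
      have : Continuous (fun t : ℝ => (x + t • e, y + t • e)) := by fun_prop
      simpa using this.tendsto 0
    have key := second_deriv_test
      (f := fun t => v (x + t • e) - v (y + t • e)
        - C * (‖x - x0‖ ^ 2 + 2 * t * inner ℝ (x - x0) e + t ^ 2))
      (f' := fun t => fderiv ℝ v (x + t • e) e - fderiv ℝ v (y + t • e) e
        - C * (2 * inner ℝ (x - x0) e + 2 * t)) (c := hs v x e e - hs v y e e - C * 2) ?_ ?_ ?_
    · linarith
    · filter_upwards [line_deriv1 (x := x) (e := e) hv.contDiffAt, line_deriv1 (x := y) (e := e) hv.contDiffAt] with t a b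
      refine (a.sub b).sub (HasDerivAt.const_mul C ?_)
      have := ((((hasDerivAt_id t).const_mul 2).mul_const (inner ℝ (x - x0) e)).const_add
        (‖x - x0‖ ^ 2)).add ((hasDerivAt_id t).pow 2)
      refine this.congr_deriv ?_
      simp
    · refine ((line_deriv2 hv.contDiffAt).sub (line_deriv2 hv.contDiffAt)).sub
        (HasDerivAt.const_mul C ?_)
      simpa using ((hasDerivAt_id (0:ℝ)).const_mul 2).const_add (2 * inner ℝ (x - x0) e)
    · filter_upwards [hlim.eventually hmax] with t ht
      simp only [zero_smul, add_zero]
      have e1 : x + t • e - (y + t • e) = x - y := by abel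
      have e2 : x + t • e - x0 = (x - x0) + t • e := by abel
      simp only [e1, e2, normsq_line _ _ _ he] at ht
      simp only [mul_zero, zero_mul, ne_eq, OfNat.ofNat_ne_zero, not_false_eq_true, zero_pow, add_zero]
      linarith
  have hsec2 : ∀ e : E, e = r⁻¹ • (x - y) → hs v x e e - hs v y e e ≤ 2 * C + 4 * Φ'' := by
    intro e hedef
    have he : ‖e‖ = 1 := by
      rw [hedef, norm_smul, ← hr, Real.norm_eq_abs, abs_of_pos (inv_pos.2 hr0)]
      field_simp
    have hxe : x - y = r • e := by rw [hedef, smul_smul]; field_simp; simp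
    have hlim : Tendsto (fun t : ℝ => (x + t • e, y + t • (-e))) (nhds 0) (nhds (x, y)) := by
      have : Continuous (fun t : ℝ => (x + t • e, y + t • (-e))) := by fun_prop
      simpa using this.tendsto 0
    have hlim2 : Tendsto (fun t : ℝ => r + 2 * t) (nhds 0) (nhds r) := by
      have : Continuous (fun t : ℝ => r + 2 * t) := by fun_prop
      simpa using this.tendsto 0
    have hl : ∀ t : ℝ, HasDerivAt (fun t : ℝ => r + 2 * t) 2 t := fun t => by
      simpa using ((hasDerivAt_id t).const_mul 2).const_add r
    have key := second_deriv_test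
      (f := fun t => v (x + t • e) - v (y + t • (-e)) - Φ (r + 2 * t)
        - C * (‖x - x0‖ ^ 2 + 2 * t * inner ℝ (x - x0) e + t ^ 2))
      (f' := fun t => fderiv ℝ v (x + t • e) e - fderiv ℝ v (y + t • (-e)) (-e) - Φ' (r + 2 * t) * 2
        - C * (2 * inner ℝ (x - x0) e + 2 * t))
        (c := hs v x e e - hs v y (-e) (-e) - Φ'' * 2 * 2 - C * 2) ?_ ?_ ?_
    · simp only [map_neg, neg_apply, neg_neg] at key
      linarith
    · filter_upwards [line_deriv1 (x := x) (e := e) hv.contDiffAt,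
        line_deriv1 (x := y) (e := -e) hv.contDiffAt, hlim2.eventually h1] with t a b c
      refine ((a.sub b).sub (c.comp t (hl t))).sub (HasDerivAt.const_mul C ?_)
      have := ((((hasDerivAt_id t).const_mul 2).mul_const (inner ℝ (x - x0) e)).const_add
        (‖x - x0‖ ^ 2)).add ((hasDerivAt_id t).pow 2)
      refine this.congr_deriv ?_
      simp
    · have h2' : HasDerivAt Φ' Φ'' (r + 2 * 0) := by simpa using h2
      refine (((line_deriv2 hv.contDiffAt).sub (line_deriv2 hv.contDiffAt)).sub
        ((h2'.comp (0:ℝ) (hl 0)).mul_const 2)).sub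
        (HasDerivAt.const_mul C ?_)
      simpa using ((hasDerivAt_id (0:ℝ)).const_mul 2).const_add (2 * inner ℝ (x - x0) e)
    · filter_upwards [hlim.eventually hmax, hlim2.eventually (lt_mem_nhds hr0)] with t ht ht2
      simp only [zero_smul, add_zero]
      have e1 : ‖x + t • e - (y + t • (-e))‖ = r + 2 * t := by
        have : x + t • e - (y + t • (-e)) = (r + 2 * t) • e := by
          have : x + t • e - (y + t • (-e)) = (x - y) + (2 * t) • e := by
            rw [two_mul, add_smul, smul_neg]; abel
          rw [this, hxe, add_smul]
        rw [this, norm_smul, he, Real.norm_eq_abs, abs_of_pos ht2, mul_one]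
      have e2 : x + t • e - x0 = (x - x0) + t • e := by abel
      simp only [e1, e2, normsq_line _ _ _ he] at ht
      simp only [mul_zero, zero_mul, ne_eq, OfNat.ofNat_ne_zero, not_false_eq_true, zero_pow, add_zero]
      linarith
  have hΦr : HasDerivAt Φ (Φ' r) r := h1.self_of_nhds
  have hΦr0 : HasDerivAt (fun t : ℝ => Φ (r + t)) (Φ' r) 0 := by
    have : HasDerivAt (fun t : ℝ => r + t) 1 0 := by simpa using (hasDerivAt_id (0:ℝ)).const_add r
    have h3 : HasDerivAt Φ (Φ' r) (r + 0) := by simpa using hΦr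
    have h4 := h3.comp (0:ℝ) this
    rw [mul_one] at h4
    exact h4
  refine ⟨?_, ?_, ?_⟩
  · set e := r⁻¹ • (x - y) with hedef
    have he : ‖e‖ = 1 := by
      rw [hedef, norm_smul, ← hr, Real.norm_eq_abs, abs_of_pos (inv_pos.2 hr0)]
      field_simp
    have hon : Orthonormal ℝ ((↑) : ({e} : Set E) → E) := by
      constructor
      · rintro ⟨z, hz⟩; simp only [mem_singleton_iff] at hz; simpa [hz] using he
      · rintro ⟨z, hz⟩ ⟨z', hz'⟩ hne
        simp only [mem_singleton_iff] at hz hz'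
        exact absurd (Subtype.ext (hz.trans hz'.symm)) hne
    obtain ⟨u, b, hub, hb⟩ := hon.exists_orthonormalBasis_extension
    have heu : e ∈ u := hub rfl
    classical
    rw [btr_eq_basis b, btr_eq_basis b, ← Finset.sum_sub_distrib]
    have hbound : ∀ i ∈ Finset.univ, hs v x (b i) (b i) - hs v y (b i) (b i)
        ≤ 2 * C + (if i = ⟨e, heu⟩ then 4 * Φ'' else 0) := by
      intro i _
      by_cases hi : i = ⟨e, heu⟩
      · rw [if_pos hi]
        exact hsec2 _ (by rw [hi, hb])
      · rw [if_neg hi, add_zero]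
        exact hsec _ (b.norm_eq_one i)
    refine (Finset.sum_le_sum hbound).trans ?_
    rw [Finset.sum_add_distrib, Finset.sum_ite_eq' Finset.univ]
    simp only [Finset.sum_const, Finset.mem_univ, if_true, nsmul_eq_mul, Finset.card_univ]
    rw [Module.finrank_eq_card_basis b.toBasis]
    linarith
  · refine opNorm_le_of_unit_le (by positivity) fun e he => ?_
    have hlim : Tendsto (fun t : ℝ => (x + t • e, y)) (nhds 0) (nhds (x, y)) := by
      have : Continuous (fun t : ℝ => (x + t • e, y)) := by fun_prop
      simpa using this.tendsto 0
    have key := right_deriv_nonpos (g := fun t => v (x + t • e) - Φ (r + t)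
        - C * (‖x - x0‖ ^ 2 + 2 * t * inner ℝ (x - x0) e + t ^ 2))
        (c := fderiv ℝ v x e - Φ' r - C * (2 * inner ℝ (x - x0) e)) ?_ ?_
    · have := real_inner_le_norm (x - x0) e
      rw [he, mul_one] at this
      nlinarith
    · have a := (line_deriv1 (x := x) (e := e) hv.contDiffAt).self_of_nhds
      simp only [zero_smul, add_zero] at a
      refine (a.sub hΦr0).sub (HasDerivAt.const_mul C ?_)
      have := ((((hasDerivAt_id (0:ℝ)).const_mul 2).mul_const (inner ℝ (x - x0) e)).const_add
        (‖x - x0‖ ^ 2)).add ((hasDerivAt_id (0:ℝ)).pow 2)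
      refine this.congr_deriv ?_
      simp
    · filter_upwards [nhdsWithin_le_nhds (hlim.eventually hmax), self_mem_nhdsWithin] with t ht ht0
      have e2 : x + t • e - x0 = (x - x0) + t • e := by abel
      have e3 : ‖x + t • e - y‖ ≤ r + t := by
        have : x + t • e - y = (x - y) + t • e := by abel
        rw [this]
        refine (norm_add_le _ _).trans ?_
        rw [norm_smul, he, Real.norm_eq_abs, abs_of_pos ht0, mul_one]
      have := hmono _ _ (norm_nonneg _) e3
      simp only [e2, normsq_line _ _ _ he] at ht
      simp only [zero_smul, add_zero, mul_zero, zero_mul, ne_eq, OfNat.ofNat_ne_zero, not_false_eq_true, zero_pow]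
      linarith
  · refine opNorm_le_of_unit_le hΦ' fun e he => ?_
    have hlim : Tendsto (fun t : ℝ => (x, y + t • (-e))) (nhds 0) (nhds (x, y)) := by
      have : Continuous (fun t : ℝ => (x, y + t • (-e))) := by fun_prop
      simpa using this.tendsto 0
    have key := right_deriv_nonpos (g := fun t => - v (y + t • (-e)) - Φ (r + t))
        (c := - fderiv ℝ v y (-e) - Φ' r) ?_ ?_
    · rw [map_neg] at key
      linarith
    · have a := (line_deriv1 (x := y) (e := -e) hv.contDiffAt).self_of_nhds
      simp only [zero_smul, add_zero] at a
      exact a.neg.sub hΦr0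
    · filter_upwards [nhdsWithin_le_nhds (hlim.eventually hmax), self_mem_nhdsWithin] with t ht ht0
      have e3 : ‖x - (y + t • (-e))‖ ≤ r + t := by
        have : x - (y + t • (-e)) = (x - y) + t • e := by rw [smul_neg]; abel
        rw [this]
        refine (norm_add_le _ _).trans ?_
        rw [norm_smul, he, Real.norm_eq_abs, abs_of_pos ht0, mul_one]
      have := hmono _ _ (norm_nonneg _) e3
      simp only [zero_smul, add_zero]
      linarith

set_option maxHeartbeats 1000000 in
theorem grad_bound (K M ρ : ℝ) (hK : 0 < K) (hM : 0 < M) (hρ : 0 < ρ) :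
    ∃ G : ℝ, 0 ≤ G ∧ ∀ (v : E → ℝ) (x0 : E), ContDiff ℝ 2 v →
      (∀ x ∈ Metric.closedBall x0 (2 * ρ), |v x| ≤ M) →
      (∀ x ∈ Metric.closedBall x0 (2 * ρ), |btr (hs v x)| ≤ K * (1 + ‖fderiv ℝ v x‖ ^ 2)) →
      ‖fderiv ℝ v x0‖ ≤ G := by
  set C := 2 * M / ρ ^ 2 with hCdef
  have hC : 0 < C := by positivity
  set D := 2 * K + 8 * K * C ^ 2 * ρ ^ 2 + 2 * C * Module.finrank ℝ E with hD
  have hD0 : 0 < D := by positivity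
  -- small radius
  obtain ⟨ρ', hρ'0, hρ'ρ, hρ'D⟩ : ∃ ρ' : ℝ, 0 < ρ' ∧ ρ' ≤ ρ ∧ 4 * K * ρ' ^ 2 * D < 1 := by
    have hlim : Tendsto (fun s : ℝ => 4 * K * s ^ 2 * D) (nhdsWithin 0 (Ioi 0)) (nhds 0) := by
      have : Continuous (fun s : ℝ => 4 * K * s ^ 2 * D) := by fun_prop
      simpa using (this.tendsto 0).mono_left nhdsWithin_le_nhds
    obtain ⟨s, h1, h2, h3⟩ := ((hlim.eventually_lt_const one_pos).and
      ((eventually_mem_nhdsWithin).and (nhdsWithin_le_nhds (eventually_le_nhds hρ)))).exists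
    exact ⟨s, h2, h3, h1⟩
  set L := Real.exp (2 * M * K) / ρ' with hL
  have hL0 : 0 < L := by positivity
  have hLρ : 1 ≤ L * ρ' := by
    rw [hL, div_mul_cancel₀ _ hρ'0.ne']
    exact Real.one_le_exp (by positivity)
  refine ⟨L / K, by positivity, fun v x0 hv hvM hvK => ?_⟩
  set Φ : ℝ → ℝ := fun r => Real.log (1 + L * r) / K with hΦ
  set Φ' : ℝ → ℝ := fun r => L / (1 + L * r) / K with hΦ'
  have hder : ∀ r : ℝ, 0 ≤ r → HasDerivAt Φ (Φ' r) r := by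
    intro r hr
    have h1 : HasDerivAt (fun r : ℝ => 1 + L * r) L r := by
      simpa using ((hasDerivAt_id r).const_mul L).const_add 1
    exact (h1.log (by positivity)).div_const K
  have hder2 : ∀ r : ℝ, 0 ≤ r → HasDerivAt Φ' (-K * (Φ' r) ^ 2) r := by
    intro r hr
    have h1 : HasDerivAt (fun r : ℝ => 1 + L * r) L r := by
      simpa using ((hasDerivAt_id r).const_mul L).const_add 1
    have hne : 1 + L * r ≠ 0 := by positivity
    have := ((hasDerivAt_const r L).div h1 hne).div_const K
    refine this.congr_deriv ?_
    simp only [hΦ']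
    field_simp
    ring
  have hmono : ∀ s t, 0 ≤ s → s ≤ t → Φ s ≤ Φ t := by
    intro s t hs hst
    simp only [hΦ]
    gcongr
  have hΦle : ∀ r, 0 ≤ r → Φ r ≤ L / K * r := by
    intro r hr
    have : Real.log (1 + L * r) ≤ L * r := by
      have := Real.log_le_sub_one_of_pos (x := 1 + L * r) (by positivity)
      linarith
    simp only [hΦ]
    have e : L / K * r = L * r / K := by ring
    rw [e]
    exact div_le_div_of_nonneg_right this hK.le
  have hΦ0 : ∀ r, 0 ≤ r → 0 ≤ Φ r := by
    intro r hr
    have := hmono 0 r le_rfl hr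
    simpa [hΦ] using this
  have hΦρ : 2 * M ≤ Φ ρ' := by
    simp only [hΦ]
    rw [le_div_iff₀ hK]
    apply (Real.le_log_iff_exp_le (by positivity)).2
    rw [hL, div_mul_cancel₀ _ hρ'0.ne']
    linarith
  have hΦcont : Continuous fun p : E × E => Φ ‖p.1 - p.2‖ := by
    simp only [hΦ]
    refine Continuous.div_const (Continuous.log (by fun_prop) fun p => ?_) K
    have : 0 ≤ L * ‖p.1 - p.2‖ := by positivity
    positivity
  set Ψ : E × E → ℝ := fun p => v p.1 - v p.2 - Φ ‖p.1 - p.2‖ - C * ‖p.1 - x0‖ ^ 2 with hΨ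
  have hvc := hv.continuous
  have hΨc : Continuous Ψ := by
    have q1 : Continuous fun p : E × E => v p.1 - v p.2 := by fun_prop
    have q2 : Continuous fun p : E × E => C * ‖p.1 - x0‖ ^ 2 := by fun_prop
    exact (q1.sub hΦcont).sub q2
  set S : Set (E × E) := {p | ‖p.1 - x0‖ ≤ ρ ∧ ‖p.1 - p.2‖ ≤ ρ'} with hS
  have hScl : IsClosed S := by
    have q1 : IsClosed {p : E × E | ‖p.1 - x0‖ ≤ ρ} := isClosed_le (by fun_prop) (by fun_prop)
    have q2 : IsClosed {p : E × E | ‖p.1 - p.2‖ ≤ ρ'} := isClosed_le (by fun_prop) (by fun_prop)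
    exact q1.inter q2
  have hSb1 : ∀ p ∈ S, p.1 ∈ Metric.closedBall x0 (2 * ρ) := by
    rintro p ⟨h1, h2⟩; rw [mem_closedBall_iff_norm]; linarith
  have hSb2 : ∀ p ∈ S, p.2 ∈ Metric.closedBall x0 (2 * ρ) := by
    rintro p ⟨h1, h2⟩; rw [mem_closedBall_iff_norm]
    have : p.2 - x0 = (p.1 - x0) - (p.1 - p.2) := by abel
    rw [this]
    have := norm_sub_le (p.1 - x0) (p.1 - p.2)
    linarith
  have hScomp : IsCompact S :=
    ((isCompact_closedBall x0 (2 * ρ)).prod (isCompact_closedBall x0 (2 * ρ))).of_isClosed_subset hScl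
      fun p hp => ⟨hSb1 p hp, hSb2 p hp⟩
  have hSne : S.Nonempty := ⟨(x0, x0), by simp [hS, hρ.le, hρ'0.le]⟩
  obtain ⟨⟨x, y⟩, hpS, hpmax⟩ := hScomp.exists_isMaxOn hSne hΨc.continuousOn
  have hle : Ψ (x, y) ≤ 0 := by
    by_contra hpos
    push Not at hpos
    have hosc : v x - v y ≤ 2 * M := by
      have h1 := abs_le.1 (hvM x (hSb1 _ hpS)); have h2 := abs_le.1 (hvM y (hSb2 _ hpS)); linarith
    obtain ⟨hp1, hp2⟩ := hpS
    simp only at hp1 hp2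
    simp only [hΨ] at hpos
    have hpen : 0 ≤ C * ‖x - x0‖ ^ 2 := by positivity
    have hxy : x ≠ y := by
      rintro rfl
      have := hΦ0 ‖x - x‖ (norm_nonneg _)
      linarith
    have hi1 : ‖x - x0‖ < ρ := by
      refine lt_of_le_of_ne hp1 fun h => ?_
      rw [h] at hpos
      have : C * ρ ^ 2 = 2 * M := by rw [hCdef]; field_simp
      have := hΦ0 ‖x - y‖ (norm_nonneg _)
      linarith
    have hi2 : ‖x - y‖ < ρ' := by
      refine lt_of_le_of_ne hp2 fun h => ?_
      rw [h] at hpos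
      linarith
    have hnb : ∀ᶠ p : E × E in nhds (x, y), p ∈ S := by
      have a1 : ∀ᶠ p : E × E in nhds (x, y), ‖p.1 - x0‖ < ρ :=
        (isOpen_lt (by fun_prop) (by fun_prop)).mem_nhds hi1
      have a2 : ∀ᶠ p : E × E in nhds (x, y), ‖p.1 - p.2‖ < ρ' :=
        (isOpen_lt (by fun_prop) (by fun_prop)).mem_nhds hi2
      filter_upwards [a1, a2] with p h1 h2 using ⟨h1.le, h2.le⟩
    have hr0 : 0 < ‖x - y‖ := norm_pos_iff.2 (sub_ne_zero.2 hxy)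
    have hΦ'nn : 0 ≤ Φ' ‖x - y‖ := by simp only [hΦ']; positivity
    obtain ⟨c1, c2, c3⟩ := ishii_lions_aux hv (x0 := x0) hC.le hxy hmono
      ((lt_mem_nhds hr0).mono fun t ht => hder t (le_of_lt ht)) (hder2 _ hr0.le) hΦ'nn
      (hnb.mono fun p hp => hpmax hp)
    have hSxy : (x, y) ∈ S := ⟨hp1, hp2⟩
    have k1 := (abs_le.1 (hvK x (hSb1 _ hSxy))).1
    have k2 := (abs_le.1 (hvK y (hSb2 _ hSxy))).2
    set P := Φ' ‖x - y‖ with hP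
    have hPlow : 1 ≤ 2 * K * ρ' * P := by
      simp only [hP, hΦ']
      have h5 : 1 + L * ‖x - y‖ ≤ 2 * (L * ρ') := by nlinarith
      have h6 : 0 < 1 + L * ‖x - y‖ := by positivity
      have : 2 * K * ρ' * (L / (1 + L * ‖x - y‖) / K) = 2 * (L * ρ') / (1 + L * ‖x - y‖) := by
        field_simp
      rw [this, le_div_iff₀ h6]; linarith
    have g1 : ‖fderiv ℝ v x‖ ^ 2 ≤ 2 * P ^ 2 + 8 * C ^ 2 * ρ ^ 2 := by
      have : ‖fderiv ℝ v x‖ ≤ P + 2 * C * ρ := by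
        refine c2.trans ?_
        gcongr
      have h7 : ‖fderiv ℝ v x‖ ^ 2 ≤ (P + 2 * C * ρ) ^ 2 := by gcongr
      nlinarith [sq_nonneg (P - 2 * C * ρ)]
    have g2 : ‖fderiv ℝ v y‖ ^ 2 ≤ P ^ 2 := by gcongr
    have m1 := mul_le_mul_of_nonneg_left g1 hK.le
    have m2 := mul_le_mul_of_nonneg_left g2 hK.le
    have fin1 : K * P ^ 2 ≤ D := by rw [hD]; nlinarith
    have fin2 : 1 ≤ (2 * K * ρ' * P) ^ 2 := one_le_pow₀ hPlow
    have fin3 : 4 * K * ρ' ^ 2 * (K * P ^ 2) ≤ 4 * K * ρ' ^ 2 * D := by gcongr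
    have fin4 : (2 * K * ρ' * P) ^ 2 = 4 * K * ρ' ^ 2 * (K * P ^ 2) := by ring
    linarith
  have hfinal : ∀ y ∈ Metric.closedBall x0 ρ', v x0 - v y ≤ L / K * ‖x0 - y‖ := by
    intro z hz
    have hzS : (x0, z) ∈ S := by
      refine ⟨by simp [hρ.le], ?_⟩
      rw [mem_closedBall_iff_norm'] at hz
      exact hz
    have h1 : Ψ (x0, z) ≤ 0 := (hpmax hzS).trans hle
    simp only [hΨ, sub_self, norm_zero] at h1
    have := hΦle ‖x0 - z‖ (norm_nonneg _)
    linarith [h1, this, show C * (0:ℝ) ^ 2 = 0 by simp]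
  refine opNorm_le_of_unit_le (by positivity) fun e he => ?_
  have key := right_deriv_nonpos (g := fun t => - v (x0 + t • (-e)) - L / K * t)
      (c := - fderiv ℝ v x0 (-e) - L / K) ?_ ?_
  · rw [map_neg] at key
    linarith
  · have a := (line_deriv1 (x := x0) (e := -e) hv.contDiffAt).self_of_nhds
    simp only [zero_smul, add_zero] at a
    refine a.neg.sub ?_
    simpa using (hasDerivAt_id (0:ℝ)).const_mul (L / K)
  · filter_upwards [self_mem_nhdsWithin, nhdsWithin_le_nhds (gt_mem_nhds hρ'0)] with t ht0 ht
    have ht0' : (0:ℝ) < t := ht0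
    have hn : ‖x0 - (x0 + t • (-e))‖ = t := by
      simp [norm_smul, he, abs_of_pos ht0']
    have := hfinal (x0 + t • (-e)) (by rw [mem_closedBall_iff_norm', hn]; exact le_of_lt ht)
    rw [hn] at this
    simp only [zero_smul, add_zero]
    linarith
end PartB

set_option linter.unusedSectionVars false

section PartC
variable {E : Type*} [NormedAddCommGroup E] [InnerProductSpace ℝ E] [FiniteDimensional ℝ E]

theorem poly_gauss_bdd (k : ℕ) : ∃ C : ℝ, ∀ r : ℝ, 0 ≤ r →
    (1 + r) ^ k * Real.exp (-(1/4) * r ^ 2) ≤ C := by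
  refine ⟨(k.factorial : ℝ) * Real.exp 2, fun r hr => ?_⟩
  have h1 : (1 + r) ^ k / k.factorial ≤ Real.exp (1 + r) :=
    Real.pow_div_factorial_le_exp _ (by linarith) _
  have h2 : (1 + r) ^ k ≤ k.factorial * Real.exp (1 + r) := by
    rw [div_le_iff₀ (by positivity)] at h1; linarith
  calc (1 + r) ^ k * Real.exp (-(1/4) * r ^ 2)
      ≤ (k.factorial * Real.exp (1 + r)) * Real.exp (-(1/4) * r ^ 2) := by gcongr
    _ = k.factorial * Real.exp (1 + r + -(1/4) * r ^ 2) := by rw [mul_assoc, ← Real.exp_add]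
    _ ≤ k.factorial * Real.exp 2 := by
        gcongr
        nlinarith [sq_nonneg (r - 2)]

theorem gauss_decay (k n : ℕ) : ∃ C : ℝ, ∀ x : E,
    ‖x‖ ^ k * ‖iteratedFDeriv ℝ n (Real.exp ∘ fun x : E => -(1/4) * ‖x‖ ^ 2) x‖ ≤ C := by
  have ht : (fun x : E => -(1/4) * ‖x‖ ^ 2).HasTemperateGrowth := by fun_prop
  obtain ⟨m, C, hC, hb⟩ := ht.norm_iteratedFDeriv_le_uniform n
  obtain ⟨P, hP⟩ := poly_gauss_bdd (k + m * n)
  refine ⟨n.factorial * (max 1 C) ^ n * P, fun x => ?_⟩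
  have h1 := norm_iteratedFDeriv_comp_le (n := n) (N := ⊤) (g := Real.exp)
    (f := fun x : E => -(1/4) * ‖x‖ ^ 2) Real.contDiff_exp
    (contDiff_const.mul (contDiff_norm_sq ℝ)) le_top x
    (C := Real.exp (-(1/4) * ‖x‖ ^ 2)) (D := max 1 C * (1 + ‖x‖) ^ m)
    (fun i _ => by
      rw [norm_iteratedFDeriv_eq_norm_iteratedDeriv, iteratedDeriv_eq_iterate, Real.iter_deriv_exp]
      simp)
    (fun i hi hi' => by
      refine (hb i hi' x).trans ?_
      have h2 : C * (1 + ‖x‖) ^ m ≤ max 1 C * (1 + ‖x‖) ^ m := by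
        gcongr; exact le_max_right _ _
      refine h2.trans (le_self_pow₀ ?_ (by omega))
      exact one_le_mul_of_one_le_of_one_le (le_max_left _ _)
        (one_le_pow₀ (by linarith [norm_nonneg x])))
  have hx := norm_nonneg x
  calc _ ≤ (1 + ‖x‖) ^ k * (n.factorial * Real.exp (-(1/4) * ‖x‖ ^ 2) * (max 1 C * (1 + ‖x‖) ^ m) ^ n) := by
        gcongr; linarith
    _ = n.factorial * (max 1 C) ^ n * ((1 + ‖x‖) ^ (k + m * n) * Real.exp (-(1/4) * ‖x‖ ^ 2)) := by
        rw [mul_pow, ← pow_mul, pow_add]; ring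
    _ ≤ _ := by gcongr; exact hP _ hx

/-- unnormalized Gaussian as a Schwartz map -/
noncomputable def gau0 (E : Type*) [NormedAddCommGroup E] [InnerProductSpace ℝ E]
    [FiniteDimensional ℝ E] : SchwartzMap E ℝ where
  toFun := Real.exp ∘ fun x : E => -(1/4) * ‖x‖ ^ 2
  smooth' := Real.contDiff_exp.comp (contDiff_const.mul (contDiff_norm_sq ℝ))
  decay' := gauss_decay

theorem gau0_apply (x : E) : gau0 E x = Real.exp (-(1/4) * ‖x‖ ^ 2) := rfl

variable [MeasurableSpace E] [BorelSpace E]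

theorem gau0_int_pos : 0 < ∫ x, gau0 E x := by
  have hnn : ∀ x, 0 ≤ gau0 E x := fun x => (Real.exp_pos _).le
  rw [integral_pos_iff_support_of_nonneg hnn (gau0 E).integrable]
  have : Function.support (gau0 E) = univ := by
    ext x; simp [gau0_apply, Real.exp_ne_zero]
  rw [this]; exact Measure.measure_univ_pos.2 (NeZero.ne _)

/-- the normalized Gaussian -/
noncomputable def gau (E : Type*) [NormedAddCommGroup E] [InnerProductSpace ℝ E]
    [FiniteDimensional ℝ E] [MeasurableSpace E] [BorelSpace E] : SchwartzMap E ℝ :=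
  (∫ x, gau0 E x)⁻¹ • gau0 E

theorem gau_apply (x : E) : gau E x = (∫ x, gau0 E x)⁻¹ * Real.exp (-(1/4) * ‖x‖ ^ 2) := rfl

theorem gau_nonneg (x : E) : 0 ≤ gau E x := by
  rw [gau_apply]; have := gau0_int_pos (E := E); positivity

theorem gau_int : ∫ x, gau E x = 1 := by
  have : ∀ x, gau E x = (∫ x, gau0 E x)⁻¹ * gau0 E x := fun x => rfl
  simp_rw [this]
  rw [integral_const_mul, inv_mul_cancel₀ gau0_int_pos.ne']

theorem gau_fderiv (x : E) : fderiv ℝ (gau E) x = (-(1/2) * gau E x) • ip x := by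
  have h : HasFDerivAt (fun x : E => (∫ x, gau0 E x)⁻¹ * Real.exp (-(1/4) * ‖x‖ ^ 2))
      ((-(1/2) * gau E x) • ip x) x := by
    have h1 := (((hasStrictFDerivAt_norm_sq x).hasFDerivAt.const_mul (-(1/4) : ℝ)).exp).const_mul
      ((∫ x, gau0 E x)⁻¹)
    refine h1.congr_fderiv ?_
    ext y
    simp [gau_apply, ip_apply]
    ring
  exact h.fderiv

theorem gau_hs (x : E) : hs (gau E) x =
    (gau E x) • ((1/4 : ℝ) • (ip x).smulRight (ip x) - (1/2 : ℝ) • ip) := by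
  have h0 : fderiv ℝ (gau E) = fun x => (-(1/2) * gau E x) • ip x := funext gau_fderiv
  rw [hs, h0]
  have h1 := ((gau E).hasFDerivAt x).const_mul (-(1/2) : ℝ)
  have h2 : HasFDerivAt (fun x : E => ip x) (ip (E := E)) x := (ip (E := E)).hasFDerivAt
  have h3 : HasFDerivAt (fun x : E => (-(1/2) * gau E x) • ip x) _ x := h1.smul h2
  rw [h3.fderiv, gau_fderiv]
  ext y z
  simp [ip_apply]
  ring

theorem gau_lap (x : E) : btr (hs (gau E) x) =
    (gau E x) * (‖x‖ ^ 2 / 4 - Module.finrank ℝ E / 2) := by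
  rw [gau_hs, btr_smul, btr_sub, btr_smul, btr_smul, btr_ip]
  have : btr ((ip x).smulRight (ip x)) = ‖x‖ ^ 2 := by
    rw [btr_smulRight, ← norm_ip x, ← sum_sq_eq_norm_sq]
  rw [this]; ring

end PartC

set_option linter.unusedSectionVars false

section PartD
variable {E : Type*} [NormedAddCommGroup E] [InnerProductSpace ℝ E] [FiniteDimensional ℝ E]
variable [MeasurableSpace E] [BorelSpace E]
variable {V : Type*} [NormedAddCommGroup V] [NormedSpace ℝ V]

/-- scaled convolution -/
noncomputable def cv (κ : E → V) (s : ℝ) (f : E → ℝ) (x : E) : V := ∫ z, f (x - s • z) • κ z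

/-- scaled convolution, kernel side -/
noncomputable def cw (κ : E → V) (f : E → ℝ) (p : ℝ × E) : V :=
  ∫ y, f y • (p.1 ^ Module.finrank ℝ E • κ (p.1 • (p.2 - y)))

theorem cv_eq_cw (κ : E → V) (f : E → ℝ) {s : ℝ} (hs : 0 < s) (x : E) :
    cv κ s f x = cw κ f (s⁻¹, x) := by
  unfold cv cw
  have h1 := integral_sub_left_eq_self
    (fun y => f y • ((s⁻¹) ^ Module.finrank ℝ E • κ (s⁻¹ • (x - y)))) (volume : Measure E) x
  simp only at h1 ⊢
  rw [← h1]
  have h2 := Measure.integral_comp_smul (volume : Measure E)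
    (fun w => f (x - s • w) • κ w) s⁻¹
  have h3 : ∀ w : E, f (x - w) • ((s⁻¹) ^ Module.finrank ℝ E • κ (s⁻¹ • (x - (x - w))))
     = (s⁻¹) ^ Module.finrank ℝ E • (f (x - s • (s⁻¹ • w)) • κ (s⁻¹ • w)) := by
    intro w
    rw [smul_inv_smul₀ hs.ne', sub_sub_cancel, smul_comm]
  simp_rw [h3]
  rw [integral_smul, h2, smul_smul, abs_of_pos (by positivity), mul_inv_cancel₀ (by positivity),
    one_smul]

theorem schwartz_decay (κ : SchwartzMap E V) (m : ℕ) : ∃ A : ℝ, 0 ≤ A ∧ ∀ z,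
    ‖κ z‖ * (1 + ‖z‖) ^ m ≤ A ∧ ‖fderiv ℝ κ z‖ * (1 + ‖z‖) ^ m ≤ A := by
  have h1 := fun z => SchwartzMap.one_add_le_sup_seminorm_apply (𝕜 := ℝ) (m := (m, 1)) (k := m) (n := 0)
    le_rfl (by simp) κ z
  have h2 := fun z => SchwartzMap.one_add_le_sup_seminorm_apply (𝕜 := ℝ) (m := (m, 1)) (k := m) (n := 1)
    le_rfl (by simp) κ z
  set A : ℝ := 2 ^ (m, 1).1 * ((Finset.Iic (m, 1)).sup fun m => SchwartzMap.seminorm ℝ m.1 m.2) κ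
  refine ⟨A, ?_, fun z => ⟨?_, ?_⟩⟩
  · exact le_trans (by positivity) (h1 0)
  · have := h1 z; rw [norm_iteratedFDeriv_zero, mul_comm] at this; exact this
  · have := h2 z
    rw [← norm_fderiv_iteratedFDeriv, mul_comm] at this
    have e : ‖fderiv ℝ (iteratedFDeriv ℝ 0 ⇑κ) z‖ = ‖fderiv ℝ κ z‖ := by
      rw [norm_fderiv_iteratedFDeriv, norm_iteratedFDeriv_one]
    rwa [e] at this

/-- continuous linear maps, with instances found through the norm -/
abbrev CL (X V : Type*) [NormedAddCommGroup X] [NormedSpace ℝ X] [NormedAddCommGroup V]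
    [NormedSpace ℝ V] := X →L[ℝ] V

/-- the derivative of the kernel in both variables -/
noncomputable def dker (κ : E → V) (p : ℝ × E) (y : E) : CL (ℝ × E) V :=
  p.1 ^ Module.finrank ℝ E • ((fderiv ℝ κ (p.1 • (p.2 - y))).comp
    (p.1 • ContinuousLinearMap.snd ℝ ℝ E + (ContinuousLinearMap.fst ℝ ℝ E).smulRight (p.2 - y)))
  + ((Module.finrank ℝ E * p.1 ^ (Module.finrank ℝ E - 1)) • ContinuousLinearMap.fst ℝ ℝ E).smulRight
    (κ (p.1 • (p.2 - y)))

theorem hasFDerivAt_ker (κ : SchwartzMap E V) (p : ℝ × E) (y : E) :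
    HasFDerivAt (fun p : ℝ × E => p.1 ^ Module.finrank ℝ E • κ (p.1 • (p.2 - y))) (dker κ p y) p := by
  have h1 : HasFDerivAt (fun p : ℝ × E => p.1) (ContinuousLinearMap.fst ℝ ℝ E) p := hasFDerivAt_fst
  have h2 : HasFDerivAt (fun p : ℝ × E => p.2 - y) (ContinuousLinearMap.snd ℝ ℝ E) p :=
    hasFDerivAt_snd.sub_const y
  have h3 : HasFDerivAt (fun p : ℝ × E => p.1 • (p.2 - y)) _ p := h1.smul h2
  have h4 := (κ.hasFDerivAt (p.1 • (p.2 - y))).comp p h3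
  have h5 := h1.pow (Module.finrank ℝ E)
  have h6 := h5.smul h4
  refine h6.congr_fderiv ?_
  simp [dker]

theorem dker_bound (κ : SchwartzMap E V) {p0 : ℝ × E} (hp0 : 0 < p0.1) :
    ∃ C : ℝ, 0 ≤ C ∧ ∃ r > 0, ∀ p ∈ Metric.ball p0 r, 0 < p.1 ∧ ∀ y,
      ‖dker κ p y‖ ≤ C * (1 + ‖p0.2 - y‖) ^ (-((Module.finrank ℝ E + 1 : ℕ) : ℝ)) ∧
      ‖p.1 ^ Module.finrank ℝ E • κ (p.1 • (p.2 - y))‖ ≤ C * (1 + ‖p0.2 - y‖) ^ (-((Module.finrank ℝ E + 1 : ℕ) : ℝ)) := by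
  set d := Module.finrank ℝ E with hd
  obtain ⟨A, hA, hk⟩ := schwartz_decay κ (d + 2)
  obtain ⟨σ, x0⟩ := p0
  simp only at hp0
  set S := 2 * σ with hS
  set c := 2 + 2 / σ with hc
  have hc0 : 0 < c := by positivity
  refine ⟨(S ^ d * A * (S + 2 / σ) + d * S ^ (d - 1) * A + S ^ d * A) * c ^ (d + 1), by positivity,
    min (σ / 2) 1, by positivity, ?_⟩
  rintro ⟨τ, x⟩ hp
  rw [Metric.mem_ball, Prod.dist_eq, max_lt_iff, lt_min_iff, lt_min_iff] at hp
  obtain ⟨⟨h1, -⟩, -, h2⟩ := hp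
  rw [Real.dist_eq, abs_lt] at h1
  rw [dist_eq_norm] at h2
  simp only at h1 h2 ⊢
  have hτ : σ / 2 < τ := by linarith [h1.1]
  have hτ0 : 0 < τ := by linarith
  have hτS : τ ≤ S := by linarith [h1.2]
  refine ⟨hτ0, fun y => ?_⟩
  set z := τ • (x - y) with hz
  have hzn : ‖z‖ = τ * ‖x - y‖ := by rw [hz, norm_smul, Real.norm_eq_abs, abs_of_pos hτ0]
  have hxy : ‖x - y‖ ≤ 2 / σ * ‖z‖ := by
    rw [hzn, div_mul_eq_mul_div, le_div_iff₀ hp0]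
    nlinarith [norm_nonneg (x - y)]
  have hx0y : ‖x0 - y‖ ≤ 1 + ‖x - y‖ := by
    have : x0 - y = -(x - x0) + (x - y) := by abel
    rw [this]; refine (norm_add_le _ _).trans ?_
    rw [norm_neg]; linarith
  have hz1 : 0 < 1 + ‖z‖ := by positivity
  have hcmp : 1 + ‖x0 - y‖ ≤ c * (1 + ‖z‖) := by
    rw [hc]; have : 0 ≤ 2 / σ := by positivity
    nlinarith [norm_nonneg z]
  have hy1 : 0 < 1 + ‖x0 - y‖ := by positivity
  rw [Real.rpow_neg hy1.le, Real.rpow_natCast]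
  have hinv : ((1 + ‖z‖) ^ (d + 1))⁻¹ ≤ c ^ (d + 1) * ((1 + ‖x0 - y‖) ^ (d + 1))⁻¹ := by
    rw [← div_eq_mul_inv, le_div_iff₀ (by positivity), inv_mul_le_iff₀ (by positivity), ← mul_pow]
    rw [mul_comm (1 + ‖z‖)]; gcongr
  set I := ((1 + ‖z‖) ^ (d + 1))⁻¹ with hI
  have hI0 : 0 ≤ I := by positivity
  have hk1 : ‖κ z‖ ≤ A * I := by
    rw [hI, ← div_eq_mul_inv, le_div_iff₀ (by positivity)]
    refine le_trans ?_ (hk z).1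
    gcongr
    · linarith [norm_nonneg z]
    · omega
  have hk2 : ‖fderiv ℝ κ z‖ * (1 + ‖z‖) ≤ A * I := by
    rw [hI, ← div_eq_mul_inv, le_div_iff₀ (by positivity), mul_assoc, ← pow_succ']
    exact (hk z).2
  have hcomp : ‖(τ • ContinuousLinearMap.snd ℝ ℝ E + (ContinuousLinearMap.fst ℝ ℝ E).smulRight (x - y) : CL (ℝ × E) E)‖
      ≤ (S + 2 / σ) * (1 + ‖z‖) := by
    refine (norm_add_le (E := CL (ℝ × E) E) _ _).trans ?_
    rw [norm_smul (β := CL (ℝ × E) E), ContinuousLinearMap.norm_smulRight_apply, Real.norm_eq_abs, abs_of_pos hτ0]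
    have e1 := ContinuousLinearMap.norm_snd_le (𝕜 := ℝ) ℝ E
    have e2 := ContinuousLinearMap.norm_fst_le (𝕜 := ℝ) ℝ E
    have : 0 ≤ 2 / σ := by positivity
    calc _ ≤ S * 1 + 1 * (2 / σ * ‖z‖) := by gcongr
      _ ≤ _ := by nlinarith [norm_nonneg z]
  have hbd1 : ‖dker κ (τ, x) y‖ ≤ (S ^ d * A * (S + 2 / σ) + d * S ^ (d - 1) * A) * I := by
    unfold dker
    refine (norm_add_le (E := CL (ℝ × E) V) _ _).trans ?_
    rw [norm_smul (β := CL (ℝ × E) V), ContinuousLinearMap.norm_smulRight_apply, norm_smul (β := CL (ℝ × E) ℝ)]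
    simp only [← hd, ← hz]
    rw [Real.norm_eq_abs, abs_of_pos (by positivity), Real.norm_eq_abs,
      abs_of_nonneg (by positivity)]
    have e2 := ContinuousLinearMap.norm_fst_le (𝕜 := ℝ) ℝ E
    calc _ ≤ S ^ d * (‖fderiv ℝ κ z‖ * ((S + 2 / σ) * (1 + ‖z‖))) + d * S ^ (d - 1) * 1 * (A * I) := by
          gcongr
          exact (ContinuousLinearMap.opNorm_comp_le _ _).trans (by gcongr)
      _ = S ^ d * (S + 2 / σ) * (‖fderiv ℝ κ z‖ * (1 + ‖z‖)) + d * S ^ (d - 1) * (A * I) := by ring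
      _ ≤ S ^ d * (S + 2 / σ) * (A * I) + d * S ^ (d - 1) * (A * I) := by gcongr
      _ = _ := by ring
  have hbd2 : ‖τ ^ d • κ z‖ ≤ (S ^ d * A) * I := by
    rw [norm_smul, Real.norm_eq_abs, abs_of_pos (by positivity)]
    calc _ ≤ S ^ d * (A * I) := by gcongr
      _ = _ := by ring
  constructor
  · refine hbd1.trans ?_
    rw [mul_assoc (_ + S ^ d * A)]
    refine mul_le_mul ?_ hinv hI0 (by positivity)
    linarith [show 0 ≤ S ^ d * A by positivity]
  · refine hbd2.trans ?_
    rw [mul_assoc (_ + S ^ d * A)]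
    refine mul_le_mul ?_ hinv hI0 (by positivity)
    linarith [show 0 ≤ S ^ d * A * (S + 2 / σ) + d * S ^ (d - 1) * A by positivity]

theorem int_bound (x0 : E) :
    Integrable (fun y : E => (1 + ‖x0 - y‖) ^ (-((Module.finrank ℝ E + 1 : ℕ) : ℝ))) := by
  have h := integrable_one_add_norm (E := E) (μ := volume) (r := ((Module.finrank ℝ E + 1 : ℕ) : ℝ))
    (by push_cast; linarith)
  exact h.comp_sub_left x0

theorem dker_cont (κ : SchwartzMap E V) (p : ℝ × E) : Continuous (dker κ p) := by
  have h1 : Continuous (fderiv ℝ κ) := ((κ.smooth 1).continuous_fderiv (by norm_num))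
  have h2 := κ.continuous
  have hL : Continuous fun y => fderiv ℝ κ (p.1 • (p.2 - y)) := h1.comp (by fun_prop)
  have hM : Continuous fun y => (p.1 • ContinuousLinearMap.snd ℝ ℝ E +
      (ContinuousLinearMap.fst ℝ ℝ E).smulRight (p.2 - y) : CL (ℝ × E) E) := by
    refine continuous_const.add ?_
    exact ((ContinuousLinearMap.smulRightL ℝ (ℝ × E) E (ContinuousLinearMap.fst ℝ ℝ E)).continuous).comp
      (by fun_prop : Continuous fun y => p.2 - y)
  have hN : Continuous fun y => (((Module.finrank ℝ E * p.1 ^ (Module.finrank ℝ E - 1)) •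
      ContinuousLinearMap.fst ℝ ℝ E).smulRight (κ (p.1 • (p.2 - y))) : CL (ℝ × E) V) :=
    ((ContinuousLinearMap.smulRightL ℝ (ℝ × E) V _).continuous).comp
      (h2.comp (by fun_prop : Continuous fun y => p.1 • (p.2 - y)))
  exact ((hL.clm_comp hM).const_smul (p.1 ^ Module.finrank ℝ E)).add hN

theorem cw_hasFDerivAt (κ : SchwartzMap E V) {f : E → ℝ} (hf : Continuous f) {M : ℝ}
    (hM : ∀ x, |f x| ≤ M) {p : ℝ × E} (hp : 0 < p.1) :
    Integrable (fun y => f y • dker κ p y) ∧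
    HasFDerivAt (cw κ f) (∫ y, f y • dker κ p y) p := by
  obtain ⟨C, hC, r, hr, hb⟩ := dker_bound κ hp
  have hM0 : 0 ≤ M := (abs_nonneg _).trans (hM 0)
  have hbi := (int_bound p.2).const_mul (M * C)
  have hcont : ∀ p : ℝ × E, Continuous fun y => f y • (p.1 ^ Module.finrank ℝ E • κ (p.1 • (p.2 - y))) := by
    intro p; have := κ.continuous; fun_prop
  have hd : Continuous fun y => f y • dker κ p y := hf.smul (dker_cont κ p)
  have hpm := Metric.mem_ball_self (x := p) hr
  have hb' : ∀ p' ∈ Metric.ball p r, ∀ y, ‖f y • dker κ p' y‖ ≤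
      M * C * (1 + ‖p.2 - y‖) ^ (-((Module.finrank ℝ E + 1 : ℕ) : ℝ)) := by
    intro p' hp' y
    rw [norm_smul, mul_assoc]
    exact mul_le_mul (hM y) (((hb p' hp').2 y).1) (norm_nonneg _) hM0
  constructor
  · exact hbi.mono' hd.aestronglyMeasurable (Eventually.of_forall (hb' p hpm))
  · refine hasFDerivAt_integral_of_dominated_of_fderiv_le (bound := fun y => M * C * (1 + ‖p.2 - y‖) ^ (-((Module.finrank ℝ E + 1 : ℕ) : ℝ)))
      (Metric.ball_mem_nhds p hr) (Eventually.of_forall fun q => (hcont q).aestronglyMeasurable)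
      ?_ hd.aestronglyMeasurable (Eventually.of_forall fun y q hq => hb' q hq y) hbi
      (Eventually.of_forall fun y q hq => (hasFDerivAt_ker κ q y).const_smul (f y))
    refine hbi.mono' (hcont p).aestronglyMeasurable (Eventually.of_forall fun y => ?_)
    rw [norm_smul, mul_assoc]
    exact mul_le_mul (hM y) (((hb p hpm).2 y).2) (norm_nonneg _) hM0

end PartD

set_option linter.unusedSectionVars false

section PartE
variable {E : Type*} [NormedAddCommGroup E] [InnerProductSpace ℝ E] [FiniteDimensional ℝ E]
variable [MeasurableSpace E] [BorelSpace E]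
variable {V : Type*} [NormedAddCommGroup V] [NormedSpace ℝ V] [CompleteSpace V]

theorem cv_hasFDerivAt (κ : SchwartzMap E V) {f : E → ℝ} (hf : Continuous f) {M : ℝ}
    (hM : ∀ x, |f x| ≤ M) {s : ℝ} (hs : 0 < s) (x : E) :
    HasFDerivAt (cv κ s f) (s⁻¹ • cv (fderiv ℝ κ) s f x) x := by
  obtain ⟨hi, hd⟩ := cw_hasFDerivAt κ hf hM (p := (s⁻¹, x)) (inv_pos.2 hs)
  have e : cv κ s f = (cw κ f) ∘ (fun x => (s⁻¹, x)) := by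
    ext y; exact cv_eq_cw _ _ hs _
  have h2 : HasFDerivAt (fun x : E => (s⁻¹, x)) (ContinuousLinearMap.inr ℝ ℝ E) x :=
    hasFDerivAt_prodMk_right _ _
  rw [e]
  refine (hd.comp x h2).congr_fderiv ?_
  rw [cv_eq_cw _ _ hs]
  have h3 := ContinuousLinearMap.integral_comp_comm
    ((ContinuousLinearMap.compL ℝ E (ℝ × E) V).flip (ContinuousLinearMap.inr ℝ ℝ E)) hi
  simp only [ContinuousLinearMap.flip_apply, ContinuousLinearMap.compL_apply] at h3
  rw [← h3]
  unfold cw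
  rw [← integral_smul]
  congr 1
  ext y h
  simp [dker]
  rw [smul_comm (s⁻¹) (f y), smul_comm (s⁻¹) ((s ^ Module.finrank ℝ E)⁻¹)]

theorem cv_hasDerivAt (κ : SchwartzMap E V) {f : E → ℝ} (hf : Continuous f) {M : ℝ}
    (hM : ∀ x, |f x| ≤ M) {s : ℝ} (hs : 0 < s) (x : E) :
    HasDerivAt (fun s => cv κ s f x)
      (-s⁻¹ • cv (fun z => (Module.finrank ℝ E : ℝ) • κ z + fderiv ℝ κ z z) s f x) s := by
  obtain ⟨hi, hd⟩ := cw_hasFDerivAt κ hf hM (p := (s⁻¹, x)) (inv_pos.2 hs)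
  have h2 : HasDerivAt (fun s : ℝ => (s⁻¹, x)) (-(s ^ 2)⁻¹, 0) s :=
    (hasDerivAt_inv hs.ne').prodMk (hasDerivAt_const _ _)
  have h3 := hd.comp_hasDerivAt s h2
  have h4 : HasDerivAt (fun s => cv κ s f x) ((∫ y, f y • dker κ (s⁻¹, x) y) (-(s ^ 2)⁻¹, 0)) s := by
    refine h3.congr_of_eventuallyEq ?_
    filter_upwards [lt_mem_nhds hs] with t ht
    exact cv_eq_cw _ _ ht _
  convert h4 using 1
  rw [ContinuousLinearMap.integral_apply hi, cv_eq_cw _ _ hs]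
  unfold cw
  rw [← integral_smul]
  congr 1
  ext y
  have hd0 : (Module.finrank ℝ E : ℝ) * s⁻¹ ^ (Module.finrank ℝ E - 1) * s⁻¹
      = Module.finrank ℝ E * s⁻¹ ^ Module.finrank ℝ E := by
    rcases Nat.eq_zero_or_pos (Module.finrank ℝ E) with h | h
    · rw [h]; simp
    · rw [mul_assoc, ← pow_succ, Nat.sub_add_cancel h]
  set d := Module.finrank ℝ E with hdd
  have e1 : dker κ (s⁻¹, x) y (-(s ^ 2)⁻¹, 0) =
      (-s⁻¹) • (s⁻¹ ^ d • ((d : ℝ) • κ (s⁻¹ • (x - y)) + fderiv ℝ κ (s⁻¹ • (x - y)) (s⁻¹ • (x - y)))) := by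
    simp only [dker, ← hdd, ContinuousLinearMap.add_apply, ContinuousLinearMap.smul_apply,
      ContinuousLinearMap.comp_apply, ContinuousLinearMap.smulRight_apply,
      ContinuousLinearMap.coe_fst', ContinuousLinearMap.coe_snd', smul_zero, zero_add, map_smul,
      smul_add, smul_smul, smul_eq_mul]
    rw [add_comm]
    congr 1
    · congr 1
      rw [show -s⁻¹ * (s⁻¹ ^ d * (d:ℝ)) = -s⁻¹ * (d * s⁻¹ ^ d) by ring, ← hd0]
      field_simp
    · congr 1
      field_simp
  rw [ContinuousLinearMap.smul_apply, e1, smul_comm]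

theorem cv_continuousOn (κ : SchwartzMap E V) {f : E → ℝ} (hf : Continuous f) {M : ℝ}
    (hM : ∀ x, |f x| ≤ M) (x : E) : ContinuousOn (fun s => cv κ s f x) (Ioi 0) :=
  fun s hs => ((cv_hasDerivAt κ hf hM hs x).continuousAt).continuousWithinAt

theorem norm_cv_le (κ : SchwartzMap E V) {f : E → ℝ} {M : ℝ}
    (hM : ∀ x, |f x| ≤ M) (s : ℝ) (x : E) : ‖cv κ s f x‖ ≤ M * ∫ z, ‖κ z‖ := by
  unfold cv
  rw [← integral_const_mul]
  refine norm_integral_le_of_norm_le (κ.integrable.norm.const_mul M) (Eventually.of_forall fun z => ?_)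
  rw [norm_smul]
  exact mul_le_mul_of_nonneg_right (hM _) (norm_nonneg _)

theorem cv_sub_const (κ : SchwartzMap E V) (h0 : ∫ z, κ z = 0) {f : E → ℝ} (hf : Continuous f) {M : ℝ}
    (hM : ∀ x, |f x| ≤ M) (s : ℝ) (x : E) (c : ℝ) : cv κ s f x = ∫ z, (f (x - s • z) - c) • κ z := by
  unfold cv
  simp_rw [sub_smul]
  rw [integral_sub, integral_smul, h0, smul_zero, sub_zero]
  · refine (κ.integrable.norm.const_mul M).mono' ?_ (Eventually.of_forall fun z => ?_)
    · have := κ.continuous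
      exact Continuous.aestronglyMeasurable (by fun_prop)
    · rw [norm_smul]
      exact mul_le_mul_of_nonneg_right (hM _) (norm_nonneg _)
  · exact κ.integrable.smul c

theorem integrable_rpow_mul (κ : SchwartzMap E V) {α : ℝ} (h0 : 0 < α) (h1 : α < 1) :
    Integrable (fun z => ‖z‖ ^ α * ‖κ z‖) := by
  have hi := κ.integrable.norm.add (κ.integrable_pow_mul volume 1)
  refine hi.mono' ?_ (Eventually.of_forall fun z => ?_)
  · have := κ.continuous
    have h2 : Continuous fun z : E => ‖z‖ ^ α := continuous_norm.rpow_const (fun _ => Or.inr h0.le)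
    exact Continuous.aestronglyMeasurable (by fun_prop)
  · have hz := norm_nonneg z
    have : ‖z‖ ^ α ≤ 1 + ‖z‖ := by
      rcases le_total ‖z‖ 1 with h | h
      · linarith [Real.rpow_le_one hz h h0.le]
      · have := Real.rpow_le_rpow_of_exponent_le h h1.le
        rw [Real.rpow_one] at this; linarith
    rw [Real.norm_eq_abs, abs_of_nonneg (by positivity)]
    simp only [Pi.add_apply, pow_one]
    nlinarith [norm_nonneg (κ z)]

theorem norm_cv_le_holder (κ : SchwartzMap E V) (h0 : ∫ z, κ z = 0) {f : E → ℝ} (hf : Continuous f) {M : ℝ}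
    (hM : ∀ x, |f x| ≤ M) {α H : ℝ} (hα0 : 0 < α) (hα1 : α < 1)
    (hH : ∀ x y, |f x - f y| ≤ H * ‖x - y‖ ^ α) {s : ℝ} (hs : 0 < s) (x : E) :
    ‖cv κ s f x‖ ≤ H * s ^ α * ∫ z, ‖z‖ ^ α * ‖κ z‖ := by
  rw [cv_sub_const κ h0 hf hM s x (f x), ← integral_const_mul]
  refine norm_integral_le_of_norm_le ((integrable_rpow_mul κ hα0 hα1).const_mul _)
    (Eventually.of_forall fun z => ?_)
  rw [norm_smul, Real.norm_eq_abs]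
  have := hH (x - s • z) x
  rw [sub_sub_cancel_left, norm_neg, norm_smul, Real.norm_eq_abs, abs_of_pos hs,
    Real.mul_rpow hs.le (norm_nonneg _)] at this
  calc _ ≤ H * (s ^ α * ‖z‖ ^ α) * ‖κ z‖ := by gcongr
    _ = _ := by ring

theorem integral_fderiv_zero (κ : SchwartzMap E V) : ∫ z, fderiv ℝ κ z = 0 := by
  have h1 := cv_hasFDerivAt κ (f := fun _ => 1) continuous_const (M := 1) (by simp) one_pos 0
  have h2 : cv κ 1 (fun _ => 1) = fun _ : E => ∫ z, κ z := by
    ext x; simp [cv]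
  rw [h2] at h1
  have h3 := h1.unique (hasFDerivAt_const _ _)
  simpa [cv] using h3

theorem cv_lip (κ : SchwartzMap E V) {f : E → ℝ} (hf : Continuous f) {M : ℝ}
    (hM : ∀ x, |f x| ≤ M) {s : ℝ} (hs : 0 < s) {B : ℝ} (hB : ∀ x, ‖cv (fderiv ℝ κ) s f x‖ ≤ B)
    (x y : E) : ‖cv κ s f x - cv κ s f y‖ ≤ s⁻¹ * B * ‖x - y‖ := by
  refine convex_univ.norm_image_sub_le_of_norm_hasFDerivWithin_le
    (fun z _ => (cv_hasFDerivAt κ hf hM hs z).hasFDerivWithinAt) (fun z _ => ?_) (mem_univ y) (mem_univ x)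
  rw [norm_smul, Real.norm_eq_abs, abs_of_pos (inv_pos.2 hs)]
  exact mul_le_mul_of_nonneg_left (hB z) (inv_pos.2 hs).le

end PartE

set_option linter.unusedSectionVars false

section PartF
variable {E : Type*} [NormedAddCommGroup E] [InnerProductSpace ℝ E] [FiniteDimensional ℝ E]
variable [MeasurableSpace E] [BorelSpace E]
variable {V : Type*} [NormedAddCommGroup V] [NormedSpace ℝ V] [CompleteSpace V]

/-- Gaussian weight -/
noncomputable def gw (lam p s : ℝ) : ℝ := s ^ p * Real.exp (-lam * s ^ 2)
/-- its integral -/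
noncomputable def gI (lam p : ℝ) : ℝ := ∫ s in Ioi 0, gw lam p s

theorem gw_int {lam p : ℝ} (hl : 0 < lam) (hp : -1 < p) : IntegrableOn (gw lam p) (Ioi 0) :=
  integrableOn_rpow_mul_exp_neg_mul_sq hl hp

theorem gw_nonneg (lam p : ℝ) {s : ℝ} (hs : 0 < s) : 0 ≤ gw lam p s := by
  unfold gw; positivity

theorem gw_mul_rpow (lam p q : ℝ) {s : ℝ} (hs : 0 < s) : gw lam p s * s ^ q = gw lam (p + q) s := by
  unfold gw; rw [Real.rpow_add hs]; ring

theorem gw_cont (lam p : ℝ) : ContinuousOn (gw lam p) (Ioi 0) := by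
  unfold gw
  intro s hs
  refine ContinuousAt.continuousWithinAt ?_
  exact (Real.continuousAt_rpow_const _ _ (Or.inl (ne_of_gt hs))).mul (by fun_prop)

theorem gI_nonneg (lam p : ℝ) : 0 ≤ gI lam p :=
  setIntegral_nonneg measurableSet_Ioi fun _ hs => gw_nonneg _ _ hs

theorem gI_tendsto {p : ℝ} (hp : -1 < p) : Tendsto (fun lam => gI lam p) atTop (nhds 0) := by
  have h : ∀ᶠ lam in atTop, lam ^ (-((p + 1) / 2)) * ((1 / 2) * Real.Gamma ((p + 1) / 2)) = gI lam p := by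
    filter_upwards [eventually_gt_atTop 0] with lam hl
    have := integral_rpow_mul_exp_neg_mul_rpow (p := 2) two_pos hp hl
    unfold gI gw
    simp_rw [Real.rpow_two] at this
    rw [this]; ring_nf
  refine Tendsto.congr' h ?_
  have := (tendsto_rpow_neg_atTop (y := (p + 1) / 2) (by linarith)).mul_const ((1 / 2) * Real.Gamma ((p + 1) / 2))
  simpa using this

/-- time integral of the scaled convolutions -/
noncomputable def J (κ : E → V) (lam p : ℝ) (f : E → ℝ) (x : E) : V :=
  ∫ s in Ioi 0, gw lam p s • cv κ s f x

theorem J_meas (κ : SchwartzMap E V) (lam p : ℝ) {f : E → ℝ} (hf : Continuous f) {M : ℝ}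
    (hM : ∀ x, |f x| ≤ M) (x : E) :
    AEStronglyMeasurable (fun s => gw lam p s • cv κ s f x) (volume.restrict (Ioi 0)) :=
  ((gw_cont lam p).smul (cv_continuousOn κ hf hM x)).aestronglyMeasurable measurableSet_Ioi

theorem J_pt {κ : E → V} {lam p β B s : ℝ} {f : E → ℝ} {x : E} (hs : 0 < s)
    (h : ‖cv κ s f x‖ ≤ B * s ^ β) : ‖gw lam p s • cv κ s f x‖ ≤ B * gw lam (p + β) s := by
  rw [norm_smul, Real.norm_eq_abs, abs_of_nonneg (gw_nonneg _ _ hs), ← gw_mul_rpow _ _ _ hs]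
  have := mul_le_mul_of_nonneg_left h (gw_nonneg lam p hs)
  linarith

theorem J_int (κ : SchwartzMap E V) {lam p β B : ℝ} (hl : 0 < lam) (hp : -1 < p + β) {f : E → ℝ}
    (hf : Continuous f) {M : ℝ} (hM : ∀ x, |f x| ≤ M) {x : E}
    (hB : ∀ s, 0 < s → ‖cv κ s f x‖ ≤ B * s ^ β) :
    IntegrableOn (fun s => gw lam p s • cv κ s f x) (Ioi 0) ∧ ‖J κ lam p f x‖ ≤ B * gI lam (p + β) := by
  have hae : ∀ᵐ s ∂(volume.restrict (Ioi (0:ℝ))), ‖gw lam p s • cv κ s f x‖ ≤ B * gw lam (p + β) s :=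
    (ae_restrict_mem measurableSet_Ioi).mono fun s hs => J_pt hs (hB s hs)
  refine ⟨((gw_int hl hp).const_mul B).mono' (J_meas κ lam p hf hM x) hae, ?_⟩
  unfold J gI
  rw [← integral_const_mul]
  exact norm_integral_le_of_norm_le ((gw_int hl hp).const_mul B) hae

theorem J_deriv (κ : SchwartzMap E V) {lam p β B β' B' : ℝ} (hl : 0 < lam) (hp : -1 < p + β)
    (hp' : -1 < p - 1 + β') {f : E → ℝ} (hf : Continuous f) {M : ℝ} (hM : ∀ x, |f x| ≤ M)
    (hB : ∀ s, 0 < s → ∀ x, ‖cv κ s f x‖ ≤ B * s ^ β)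
    (hB' : ∀ s, 0 < s → ∀ x, ‖cv (fderiv ℝ κ) s f x‖ ≤ B' * s ^ β') (x : E) :
    HasFDerivAt (J κ lam p f) (J (fderiv ℝ κ) lam (p - 1) f x) x := by
  have hk : (fderiv ℝ κ : E → E →L[ℝ] V) = SchwartzMap.fderivCLM ℝ E V κ := rfl
  refine hasFDerivAt_integral_of_dominated_of_fderiv_le (μ := volume.restrict (Ioi 0))
    (F := fun x s => gw lam p s • cv κ s f x)
    (F' := fun x s => gw lam (p - 1) s • cv (fderiv ℝ κ) s f x)
    (bound := fun s => B' * gw lam (p - 1 + β') s) univ_mem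
    (Eventually.of_forall fun y => J_meas κ lam p hf hM y)
    (J_int κ hl hp hf hM fun s hs => hB s hs x).1 ?_ ?_ ((gw_int hl hp').const_mul B') ?_
  · rw [hk]; exact J_meas _ lam (p - 1) hf hM x
  · exact (ae_restrict_mem measurableSet_Ioi).mono fun s hs y _ => J_pt hs (hB' s hs y)
  · refine (ae_restrict_mem measurableSet_Ioi).mono fun s hs y _ => ?_
    have h := (cv_hasFDerivAt κ hf hM hs y).const_smul (gw lam p s)
    refine h.congr_fderiv ?_
    rw [smul_smul]
    congr 1
    rw [← Real.rpow_neg_one, gw_mul_rpow _ _ _ hs]; rfl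

theorem J_holder1 (κ : SchwartzMap E V) {lam α B B' : ℝ} (hl : 0 < lam) (hα0 : 0 < α) (hα1 : α < 1)
    {f : E → ℝ} (hf : Continuous f) {M : ℝ} (hM : ∀ x, |f x| ≤ M)
    (hB : ∀ s, 0 < s → ∀ x, ‖cv κ s f x‖ ≤ B)
    (hB' : ∀ s, 0 < s → ∀ x, ‖cv (fderiv ℝ κ) s f x‖ ≤ B') (x y : E) :
    ‖J κ lam 0 f x - J κ lam 0 f y‖ ≤ (2 * B + B') * gI lam (-α) * ‖x - y‖ ^ α := by
  have hi := fun x => (J_int κ (p := 0) (β := 0) (B := B) hl (by norm_num) hf hM (x := x)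
    (fun s hs => by simpa using hB s hs x)).1
  have hB0 : 0 ≤ B := (norm_nonneg _).trans (hB 1 one_pos 0)
  have hB'0 : 0 ≤ B' := (norm_nonneg _).trans (hB' 1 one_pos 0)
  unfold J gI
  rw [← integral_sub (hi x) (hi y)]
  rw [show (2 * B + B') * (∫ s in Ioi 0, gw lam (-α) s) * ‖x - y‖ ^ α =
    ∫ s in Ioi 0, ((2 * B + B') * ‖x - y‖ ^ α) * gw lam (-α) s by rw [integral_const_mul]; ring]
  refine norm_integral_le_of_norm_le ((gw_int hl (by linarith)).const_mul _) ?_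
  refine (ae_restrict_mem measurableSet_Ioi).mono fun s hs => ?_
  have hs : 0 < s := hs
  rw [← smul_sub, norm_smul, Real.norm_eq_abs, abs_of_nonneg (gw_nonneg _ _ hs)]
  have key : ‖cv κ s f x - cv κ s f y‖ ≤ (2 * B + B') * (‖x - y‖ ^ α * s ^ (-α)) := by
    have e : ‖x - y‖ ^ α * s ^ (-α) = (‖x - y‖ / s) ^ α := by
      rw [Real.div_rpow (norm_nonneg _) hs.le, Real.rpow_neg hs.le, div_eq_mul_inv]
    rw [e]
    have hq : 0 ≤ ‖x - y‖ / s := by positivity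
    rcases le_total (‖x - y‖ / s) 1 with h | h
    · have h1 := cv_lip κ hf hM hs (hB' s hs) x y
      have h2 : ‖x - y‖ / s ≤ (‖x - y‖ / s) ^ α := by
        rcases hq.eq_or_lt with h0 | h0
        · rw [← h0]; positivity
        · have := Real.rpow_le_rpow_of_exponent_ge h0 h hα1.le
          rwa [Real.rpow_one] at this
      calc _ ≤ s⁻¹ * B' * ‖x - y‖ := h1
        _ = B' * (‖x - y‖ / s) := by rw [div_eq_mul_inv]; ring
        _ ≤ B' * (‖x - y‖ / s) ^ α := by gcongr
        _ ≤ _ := by gcongr; linarith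
    · have h1 : 1 ≤ (‖x - y‖ / s) ^ α := Real.one_le_rpow h hα0.le
      calc _ ≤ B + B := (norm_sub_le _ _).trans (add_le_add (hB s hs x) (hB s hs y))
        _ ≤ (2 * B + B') * 1 := by linarith
        _ ≤ _ := by gcongr
  calc _ ≤ gw lam 0 s * ((2 * B + B') * (‖x - y‖ ^ α * s ^ (-α))) :=
        mul_le_mul_of_nonneg_left key (gw_nonneg _ _ hs)
    _ = (2 * B + B') * ‖x - y‖ ^ α * (gw lam 0 s * s ^ (-α)) := by ring
    _ = _ := by rw [gw_mul_rpow _ _ _ hs, zero_add]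

theorem J_holder2 (κ : SchwartzMap E V) {lam α B B' : ℝ} (hl : 0 < lam) (hα0 : 0 < α) (hα1 : α < 1)
    {f : E → ℝ} (hf : Continuous f) {M : ℝ} (hM : ∀ x, |f x| ≤ M)
    (hB : ∀ s, 0 < s → ∀ x, ‖cv κ s f x‖ ≤ B * s ^ α)
    (hB' : ∀ s, 0 < s → ∀ x, ‖cv (fderiv ℝ κ) s f x‖ ≤ B' * s ^ α) (x y : E) :
    ‖J κ lam (-1) f x - J κ lam (-1) f y‖ ≤ (2 * B / α + B' / (1 - α)) * ‖x - y‖ ^ α := by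
  have hi := fun x => (J_int κ (p := -1) (β := α) (B := B) hl (by linarith) hf hM (x := x)
    (fun s hs => hB s hs x)).1
  rcases eq_or_ne x y with rfl | hxy
  · simp [Real.zero_rpow hα0.ne']
  have hh : 0 < ‖x - y‖ := norm_pos_iff.2 (sub_ne_zero.2 hxy)
  set h := ‖x - y‖ with hhd
  unfold J
  rw [← integral_sub (hi x) (hi y)]
  have hii : IntegrableOn (fun s => gw lam (-1) s • cv κ s f x - gw lam (-1) s • cv κ s f y) (Ioi 0) :=
    (hi x).sub (hi y)
  rw [← Ioc_union_Ioi_eq_Ioi hh.le, setIntegral_union (Ioc_disjoint_Ioi le_rfl) measurableSet_Ioi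
    (hii.mono_set Ioc_subset_Ioi_self) (hii.mono_set (Ioi_subset_Ioi hh.le))]
  refine (norm_add_le _ _).trans ?_
  rw [add_mul]
  have hexp : ∀ s : ℝ, Real.exp (-lam * s ^ 2) ≤ 1 := fun s => by
    rw [Real.exp_le_one_iff]; nlinarith [sq_nonneg s]
  have hg : ∀ s, 0 < s → gw lam (-1) s ≤ s ^ (-1 : ℝ) := fun s hs =>
    mul_le_of_le_one_right (by positivity) (hexp s)
  refine add_le_add ?_ ?_
  · have e : 2 * B / α * h ^ α = ∫ s in Ioc 0 h, (2 * B) * s ^ (α - 1) := by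
      rw [integral_const_mul, ← intervalIntegral.integral_of_le hh.le,
        integral_rpow (Or.inl (by linarith)), sub_add_cancel, Real.zero_rpow hα0.ne']; ring
    rw [e]
    refine norm_integral_le_of_norm_le ?_ ?_
    · have := (intervalIntegral.intervalIntegrable_rpow' (a := 0) (b := h) (r := α - 1) (by linarith)).const_mul (2 * B)
      exact (intervalIntegrable_iff_integrableOn_Ioc_of_le hh.le).1 this
    · refine (ae_restrict_mem measurableSet_Ioc).mono fun s hs => ?_
      have hs0 : 0 < s := hs.1
      rw [← smul_sub, norm_smul, Real.norm_eq_abs, abs_of_nonneg (gw_nonneg _ _ hs0)]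
      calc _ ≤ s ^ (-1 : ℝ) * (B * s ^ α + B * s ^ α) :=
            mul_le_mul (hg s hs0) ((norm_sub_le _ _).trans (add_le_add (hB s hs0 x) (hB s hs0 y)))
              (norm_nonneg _) (by positivity)
        _ = (2 * B) * (s ^ α * s ^ (-1 : ℝ)) := by ring
        _ = _ := by rw [← Real.rpow_add hs0]; rfl
  · have e : B' / (1 - α) * h ^ α = ∫ s in Ioi h, (B' * h) * s ^ (α - 2) := by
      rw [integral_const_mul, integral_Ioi_rpow_of_lt (by linarith) hh]
      have : h ^ α = h * h ^ (α - 2 + 1) := by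
        nth_rw 2 [← Real.rpow_one h]; rw [← Real.rpow_add hh]; congr 1; ring
      rw [this, show α - 2 + 1 = -(1 - α) by ring]
      have : 1 - α ≠ 0 := by linarith
      field_simp
    rw [e]
    refine norm_integral_le_of_norm_le ((integrableOn_Ioi_rpow_of_lt (by linarith) hh).const_mul _) ?_
    refine (ae_restrict_mem measurableSet_Ioi).mono fun s hs => ?_
    have hs0 : 0 < s := hh.trans hs
    rw [← smul_sub, norm_smul, Real.norm_eq_abs, abs_of_nonneg (gw_nonneg _ _ hs0)]
    calc _ ≤ s ^ (-1 : ℝ) * (s⁻¹ * (B' * s ^ α) * h) :=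
          mul_le_mul (hg s hs0) (cv_lip κ hf hM hs0 (hB' s hs0) x y) (norm_nonneg _) (by positivity)
      _ = (B' * h) * (s ^ α * s ^ (-1 : ℝ) * s ^ (-1 : ℝ)) := by rw [Real.rpow_neg_one]; ring
      _ = _ := by rw [← Real.rpow_add hs0, ← Real.rpow_add hs0]; congr 2; ring

end PartF

set_option linter.unusedSectionVars false
set_option maxSynthPendingDepth 6

section PartG
variable {E : Type*} [NormedAddCommGroup E] [InnerProductSpace ℝ E] [FiniteDimensional ℝ E]
variable [MeasurableSpace E] [BorelSpace E]

/-- first derivative of the Gaussian -/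
noncomputable def gau1 (E : Type*) [NormedAddCommGroup E] [InnerProductSpace ℝ E]
    [FiniteDimensional ℝ E] [MeasurableSpace E] [BorelSpace E] : SchwartzMap E (E →L[ℝ] ℝ) :=
  SchwartzMap.fderivCLM ℝ E ℝ (gau E)
/-- second derivative of the Gaussian -/
noncomputable def gau2 (E : Type*) [NormedAddCommGroup E] [InnerProductSpace ℝ E]
    [FiniteDimensional ℝ E] [MeasurableSpace E] [BorelSpace E] :
    SchwartzMap E (E →L[ℝ] E →L[ℝ] ℝ) :=
  SchwartzMap.fderivCLM ℝ E _ (gau1 E)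
/-- third derivative of the Gaussian -/
noncomputable def gau3 (E : Type*) [NormedAddCommGroup E] [InnerProductSpace ℝ E]
    [FiniteDimensional ℝ E] [MeasurableSpace E] [BorelSpace E] :
    SchwartzMap E (E →L[ℝ] E →L[ℝ] E →L[ℝ] ℝ) :=
  SchwartzMap.fderivCLM ℝ E _ (gau2 E)

theorem gau1_eq : (gau1 E : E → E →L[ℝ] ℝ) = fderiv ℝ (gau E) := rfl
theorem gau2_eq : (gau2 E : E → _) = fderiv ℝ (gau1 E) := rfl
theorem gau3_eq : (gau3 E : E → _) = fderiv ℝ (gau2 E) := rfl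
theorem gau2_apply (x : E) : gau2 E x = hs (gau E) x := rfl

theorem gau2_int : ∫ z, gau2 E z = 0 := by
  rw [gau2_eq]; exact integral_fderiv_zero _
theorem gau3_int : ∫ z, gau3 E z = 0 := by
  rw [gau3_eq]; exact integral_fderiv_zero _

/-- resolvent of the Laplacian -/
noncomputable def Rs (lam : ℝ) (f : E → ℝ) (x : E) : ℝ := 2 * J (gau E) lam 1 f x
/-- gradient of the resolvent -/
noncomputable def Rs1 (lam : ℝ) (f : E → ℝ) (x : E) : E →L[ℝ] ℝ := (2:ℝ) • J (gau1 E) lam 0 f x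
/-- Hessian of the resolvent -/
noncomputable def Rs2 (lam : ℝ) (f : E → ℝ) (x : E) : E →L[ℝ] E →L[ℝ] ℝ := (2:ℝ) • J (gau2 E) lam (-1) f x

/-- constants -/
noncomputable def r0 (E : Type*) [NormedAddCommGroup E] [InnerProductSpace ℝ E]
    [FiniteDimensional ℝ E] [MeasurableSpace E] [BorelSpace E] (lam : ℝ) : ℝ :=
  2 * ((∫ z, ‖gau E z‖) * gI lam 1)
/-- constants -/
noncomputable def r1 (E : Type*) [NormedAddCommGroup E] [InnerProductSpace ℝ E]
    [FiniteDimensional ℝ E] [MeasurableSpace E] [BorelSpace E] (lam : ℝ) : ℝ :=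
  2 * ((∫ z, ‖gau1 E z‖) * gI lam 0)

theorem r0_nonneg (lam : ℝ) : 0 ≤ r0 E lam := by
  unfold r0; have := gI_nonneg lam 1; positivity
theorem r1_nonneg (lam : ℝ) : 0 ≤ r1 E lam := by
  unfold r1; have := gI_nonneg lam 0; positivity
theorem r0_tendsto : Tendsto (r0 E) atTop (nhds 0) := by
  have := ((gI_tendsto (p := 1) (by norm_num)).const_mul (∫ z, ‖gau E z‖)).const_mul 2
  rw [mul_zero, mul_zero] at this
  exact this
theorem r1_tendsto : Tendsto (r1 E) atTop (nhds 0) := by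
  have := ((gI_tendsto (p := 0) (by norm_num)).const_mul (∫ z, ‖gau1 E z‖)).const_mul 2
  rw [mul_zero, mul_zero] at this
  exact this

variable {lam : ℝ} (hl : 0 < lam) {f : E → ℝ} (hf : Continuous f) {M : ℝ} (hM : ∀ x, |f x| ≤ M)
include hl hf hM

theorem J0_int (x : E) :
    IntegrableOn (fun s => gw lam 1 s • cv (gau E) s f x) (Ioi 0) ∧
      ‖J (gau E) lam 1 f x‖ ≤ M * (∫ z, ‖gau E z‖) * gI lam (1 + 0) :=
  J_int (gau E) (β := 0) (B := M * ∫ z, ‖gau E z‖) hl (by norm_num) hf hM (fun s _ => by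
    rw [Real.rpow_zero, mul_one]; exact norm_cv_le (gau E) hM s x)

theorem J1_int (x : E) :
    IntegrableOn (fun s => gw lam 0 s • cv (gau1 E) s f x) (Ioi 0) ∧
      ‖J (gau1 E) lam 0 f x‖ ≤ M * (∫ z, ‖gau1 E z‖) * gI lam (0 + 0) :=
  J_int (gau1 E) (β := 0) (B := M * ∫ z, ‖gau1 E z‖) hl (by norm_num) hf hM (fun s _ => by
    rw [Real.rpow_zero, mul_one]; exact norm_cv_le (gau1 E) hM s x)

theorem Rs_bound (x : E) : |Rs lam f x| ≤ M * r0 E lam := by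
  have := (J0_int hl hf hM x).2
  rw [Real.norm_eq_abs, add_zero] at this
  unfold Rs r0; rw [abs_mul, abs_two]; linarith

theorem Rs1_bound (x : E) : ‖Rs1 lam f x‖ ≤ M * r1 E lam := by
  have := (J1_int hl hf hM x).2
  rw [add_zero] at this
  unfold Rs1 r1; rw [norm_smul, Real.norm_eq_abs, abs_two]; linarith

theorem Rs_hasFDerivAt (x : E) : HasFDerivAt (Rs lam f) (Rs1 lam f x) x := by
  have h := J_deriv (gau E) (p := 1) (β := 0) (β' := 0) (B := M * ∫ z, ‖gau E z‖) (B' := M * ∫ z, ‖gau1 E z‖)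
    hl (by norm_num) (by norm_num) hf hM
    (fun s _ x => by
      rw [Real.rpow_zero, mul_one]; exact norm_cv_le (gau E) hM s x)
    (fun s _ x => by
      rw [Real.rpow_zero, mul_one]; exact norm_cv_le (gau1 E) hM s x) x
  rw [sub_self] at h
  exact h.const_mul 2

theorem Rs1_holder {α : ℝ} (hα0 : 0 < α) (hα1 : α < 1) (x y : E) :
    ‖Rs1 lam f x - Rs1 lam f y‖ ≤
      M * (2 * ((2 * (∫ z, ‖gau1 E z‖) + ∫ z, ‖gau2 E z‖) * gI lam (-α))) * ‖x - y‖ ^ α := by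
  have h := J_holder1 (gau1 E) hl hα0 hα1 hf hM (fun s _ x => norm_cv_le (gau1 E) hM s x)
    (fun s _ x => norm_cv_le (gau2 E) hM s x) x y
  unfold Rs1
  rw [← smul_sub, norm_smul, Real.norm_eq_abs, abs_two]
  linarith

omit hl hf hM in
theorem cv_sub {V' : Type*} [NormedAddCommGroup V'] [NormedSpace ℝ V'] (κ : SchwartzMap E V') {f g : E → ℝ} (hf : Continuous f) (hg : Continuous g)
    {M : ℝ} (hM : ∀ x, |f x| ≤ M) (hM' : ∀ x, |g x| ≤ M) (s : ℝ) (x : E) :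
    cv κ s (fun x => f x - g x) x = cv κ s f x - cv κ s g x := by
  have hi : ∀ f : E → ℝ, Continuous f → (∀ x, |f x| ≤ M) → Integrable (fun z => f (x - s • z) • κ z) := by
    intro f hf hM
    refine (κ.integrable.norm.const_mul M).mono' ?_ (Eventually.of_forall fun z => ?_)
    · have := κ.continuous
      exact Continuous.aestronglyMeasurable (by fun_prop)
    · rw [norm_smul]
      exact mul_le_mul_of_nonneg_right (hM _) (norm_nonneg _)
  unfold cv
  simp_rw [sub_smul]
  exact integral_sub (hi f hf hM) (hi g hg hM')

theorem Rs_sub {g : E → ℝ} (hg : Continuous g) (hM' : ∀ x, |g x| ≤ M) (x : E) :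
    Rs lam (fun x => f x - g x) x = Rs lam f x - Rs lam g x := by
  unfold Rs J
  simp_rw [cv_sub (gau E) hf hg hM hM', smul_sub]
  rw [integral_sub (J0_int hl hf hM x).1 (J0_int hl hg hM' x).1, mul_sub]

theorem Rs1_sub {g : E → ℝ} (hg : Continuous g) (hM' : ∀ x, |g x| ≤ M) (x : E) :
    Rs1 lam (fun x => f x - g x) x = Rs1 lam f x - Rs1 lam g x := by
  unfold Rs1 J
  simp_rw [cv_sub (gau1 E) hf hg hM hM', smul_sub]
  rw [integral_sub (J1_int hl hf hM x).1 (J1_int hl hg hM' x).1, smul_sub]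

variable {α H : ℝ} (hα0 : 0 < α) (hα1 : α < 1) (hH : ∀ x y, |f x - f y| ≤ H * ‖x - y‖ ^ α)
include hα0 hα1 hH

theorem Rs1_hasFDerivAt (x : E) : HasFDerivAt (Rs1 lam f) (Rs2 lam f x) x := by
  have h := J_deriv (gau1 E) (p := 0) (β := 0) (β' := α) (B := M * ∫ z, ‖gau1 E z‖)
    (B' := H * ∫ z, ‖z‖ ^ α * ‖gau2 E z‖)
    hl (by norm_num) (by linarith) hf hM
    (fun s _ x => by
      rw [Real.rpow_zero, mul_one]; exact norm_cv_le (gau1 E) hM s x)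
    (fun s hs x => by
      have := norm_cv_le_holder (gau2 E) gau2_int hf hM hα0 hα1 hH hs x
      rw [gau2_eq] at this ⊢; linarith) x
  rw [zero_sub] at h
  exact h.const_smul (2:ℝ)

theorem Rs2_holder (x y : E) :
    ‖Rs2 lam f x - Rs2 lam f y‖ ≤
      H * (2 * (2 * (∫ z, ‖z‖ ^ α * ‖gau2 E z‖) / α + (∫ z, ‖z‖ ^ α * ‖gau3 E z‖) / (1 - α))) * ‖x - y‖ ^ α := by
  have h := J_holder2 (gau2 E) (B := H * ∫ z, ‖z‖ ^ α * ‖gau2 E z‖) (B' := H * ∫ z, ‖z‖ ^ α * ‖gau3 E z‖)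
    hl hα0 hα1 hf hM
    (fun s hs x => by
      have := norm_cv_le_holder (gau2 E) gau2_int hf hM hα0 hα1 hH hs x
      linarith)
    (fun s hs x => by
      have := norm_cv_le_holder (gau3 E) gau3_int hf hM hα0 hα1 hH hs x
      rw [gau3_eq] at this ⊢; linarith) x y
  unfold Rs2
  rw [← smul_sub, norm_smul, Real.norm_eq_abs, abs_two]
  calc _ ≤ 2 * ((2 * (H * ∫ z, ‖z‖ ^ α * ‖gau2 E z‖) / α + (H * ∫ z, ‖z‖ ^ α * ‖gau3 E z‖) / (1 - α)) * ‖x - y‖ ^ α) := by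
        gcongr
    _ = _ := by ring

theorem Rs_fderiv : fderiv ℝ (Rs lam f) = Rs1 lam f := funext fun x => (Rs_hasFDerivAt hl hf hM x).fderiv

theorem Rs_hs (x : E) : hs (Rs lam f) x = Rs2 lam f x := by
  unfold hs
  rw [Rs_fderiv hl hf hM hα0 hα1 hH]
  exact (Rs1_hasFDerivAt hl hf hM hα0 hα1 hH x).fderiv

theorem Rs_contDiff : ContDiff ℝ 2 (Rs lam f) := by
  have hc2 : Continuous (Rs2 lam f) := by
    refine continuous_iff_continuousAt.2 fun x => ?_
    rw [ContinuousAt, tendsto_iff_norm_sub_tendsto_zero]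
    refine squeeze_zero (fun _ => norm_nonneg _) (fun y => Rs2_holder hl hf hM hα0 hα1 hH y x) ?_
    have : Tendsto (fun y => ‖y - x‖ ^ α) (nhds x) (nhds (‖x - x‖ ^ α)) :=
      (Continuous.rpow_const (by fun_prop) (fun _ => Or.inr hα0.le)).continuousAt
    have h2 := this.const_mul (H * (2 * (2 * (∫ z, ‖z‖ ^ α * ‖gau2 E z‖) / α + (∫ z, ‖z‖ ^ α * ‖gau3 E z‖) / (1 - α))))
    rwa [sub_self, norm_zero, Real.zero_rpow hα0.ne', mul_zero] at h2
  have h1 : ContDiff ℝ 1 (Rs1 lam f) := by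
    rw [contDiff_one_iff_fderiv]
    refine ⟨fun x => (Rs1_hasFDerivAt hl hf hM hα0 hα1 hH x).differentiableAt, ?_⟩
    rw [show fderiv ℝ (Rs1 lam f) = Rs2 lam f from
      funext fun x => (Rs1_hasFDerivAt hl hf hM hα0 hα1 hH x).fderiv]
    exact hc2
  rw [show (2 : WithTop ℕ∞) = 1 + 1 by norm_num, contDiff_succ_iff_fderiv]
  refine ⟨fun x => (Rs_hasFDerivAt hl hf hM x).differentiableAt, by simp, ?_⟩
  rw [Rs_fderiv hl hf hM hα0 hα1 hH]
  exact h1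

end PartG

set_option linter.unusedSectionVars false
set_option maxSynthPendingDepth 6

section PartH
variable {E : Type*} [NormedAddCommGroup E] [InnerProductSpace ℝ E] [FiniteDimensional ℝ E]
variable [MeasurableSpace E] [BorelSpace E]

/-- trace as a continuous linear map -/
noncomputable def btrL : (E →L[ℝ] E →L[ℝ] ℝ) →L[ℝ] ℝ :=
  LinearMap.toContinuousLinearMap
    { toFun := btr
      map_add' := btr_add
      map_smul' := fun c B => btr_smul c B }

theorem btrL_apply (B : E →L[ℝ] E →L[ℝ] ℝ) : btrL B = btr B := rfl

theorem cv_integrable {V' : Type*} [NormedAddCommGroup V'] [NormedSpace ℝ V'] (κ : SchwartzMap E V')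
    {f : E → ℝ} (hf : Continuous f) {M : ℝ} (hM : ∀ x, |f x| ≤ M) (s : ℝ) (x : E) :
    Integrable (fun z => f (x - s • z) • κ z) := by
  refine (κ.integrable.norm.const_mul M).mono' ?_ (Eventually.of_forall fun z => ?_)
  · have := κ.continuous
    exact Continuous.aestronglyMeasurable (by fun_prop)
  · rw [norm_smul]
    exact mul_le_mul_of_nonneg_right (hM _) (norm_nonneg _)

variable {lam : ℝ} (hl : 0 < lam) {f : E → ℝ} (hf : Continuous f) {M : ℝ} (hM : ∀ x, |f x| ≤ M)
include hf hM

theorem btr_cv (s : ℝ) (x : E) :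
    btr (cv (gau2 E) s f x) = ∫ z, f (x - s • z) * (gau E z * (‖z‖^2/4 - Module.finrank ℝ E/2)) := by
  have h := ContinuousLinearMap.integral_comp_comm btrL (cv_integrable (gau2 E) hf hM s x)
  rw [← btrL_apply]
  unfold cv
  rw [← h]
  congr 1
  ext z
  rw [map_smul, btrL_apply, gau2_apply, gau_lap, smul_eq_mul]

theorem cv_gau_deriv {s : ℝ} (hs : 0 < s) (x : E) :
    HasDerivAt (fun s => cv (gau E) s f x) (2 * s⁻¹ * btr (cv (gau2 E) s f x)) s := by
  have h := cv_hasDerivAt (gau E) hf hM hs x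
  refine h.congr_deriv ?_
  symm
  rw [btr_cv hf hM]
  unfold cv
  rw [smul_eq_mul, mul_assoc, mul_left_comm, ← integral_const_mul, ← integral_const_mul, neg_mul, ← integral_const_mul, ← integral_neg]
  congr 1
  ext z
  beta_reduce
  rw [gau_fderiv]
  simp only [smul_eq_mul, smul_apply, ip_apply, real_inner_self_eq_norm_sq]
  ring

theorem cv_gau_cont (x : E) : Continuous (fun s => cv (gau E) s f x) := by
  unfold cv
  have hk := (gau E).continuous
  refine continuous_of_dominated (bound := fun z => M * ‖gau E z‖) (fun s => ?_) (fun s => ?_)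
    ((gau E).integrable.norm.const_mul M) ?_
  · exact Continuous.aestronglyMeasurable (by fun_prop)
  · refine Eventually.of_forall fun z => ?_
    rw [norm_smul]
    exact mul_le_mul_of_nonneg_right (hM _) (norm_nonneg _)
  · exact Eventually.of_forall fun z => by fun_prop

theorem cv_gau_zero (x : E) : cv (gau E) 0 f x = f x := by
  unfold cv
  simp [integral_const_mul, gau_int]

variable {α H : ℝ} (hα0 : 0 < α) (hα1 : α < 1) (hH : ∀ x y, |f x - f y| ≤ H * ‖x - y‖ ^ α)
include hl hα0 hα1 hH

theorem Rs_eq (x : E) : lam * Rs lam f x - btr (hs (Rs lam f) x) = f x := by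
  have hi2 := (J_int (gau2 E) (lam := lam) (p := -1) (β := α) (B := H * ∫ z, ‖z‖ ^ α * ‖gau2 E z‖) hl (by linarith) hf hM (x := x)
    (fun s hs => by
      have := norm_cv_le_holder (gau2 E) gau2_int hf hM hα0 hα1 hH hs x
      linarith)).1
  have hi0 := (J0_int hl hf hM x).1
  have hb := ContinuousLinearMap.integral_comp_comm btrL hi2
  have hib := btrL.integrable_comp hi2
  have hd : ∀ s ∈ Ioi (0:ℝ), HasDerivAt (fun s => Real.exp (-lam * s^2) * cv (gau E) s f x)
      ((-2*lam) * (gw lam 1 s • cv (gau E) s f x) + 2 * btrL (gw lam (-1) s • cv (gau2 E) s f x)) s := by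
    intro s hs
    have h1 : HasDerivAt (fun s : ℝ => Real.exp (-lam * s^2)) (Real.exp (-lam*s^2) * (-lam * (2 * s))) s := by
      have := ((hasDerivAt_pow 2 s).const_mul (-lam)).exp
      simpa using this
    refine (h1.mul (cv_gau_deriv hf hM hs x)).congr_deriv ?_
    symm
    rw [map_smul, btrL_apply]
    unfold gw
    rw [Real.rpow_one, Real.rpow_neg_one]
    simp only [smul_eq_mul]
    ring
  have hint : IntegrableOn (fun s => (-2*lam) * (gw lam 1 s • cv (gau E) s f x) + 2 * btrL (gw lam (-1) s • cv (gau2 E) s f x)) (Ioi 0) :=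
    (hi0.const_mul (-2*lam)).add (hib.const_mul 2)
  have hlim : Tendsto (fun s => Real.exp (-lam * s^2) * cv (gau E) s f x) atTop (nhds 0) := by
    have h0 : Tendsto (fun s : ℝ => Real.exp (-lam * s^2)) atTop (nhds 0) := by
      refine Real.tendsto_exp_atBot.comp ?_
      exact (tendsto_pow_atTop two_ne_zero).const_mul_atTop_of_neg (by linarith)
    have h1 := h0.mul_const (M * ∫ z, ‖gau E z‖)
    rw [zero_mul] at h1
    refine squeeze_zero_norm (fun s => ?_) h1
    rw [norm_mul, Real.norm_eq_abs, abs_of_pos (Real.exp_pos _)]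
    exact mul_le_mul_of_nonneg_left (norm_cv_le (gau E) hM s x) (Real.exp_pos _).le
  have hc : ContinuousWithinAt (fun s => Real.exp (-lam * s^2) * cv (gau E) s f x) (Ici 0) 0 := by
    have := cv_gau_cont hf hM x
    exact Continuous.continuousWithinAt (by fun_prop)
  have key := integral_Ioi_of_hasDerivAt_of_tendsto hc hd hint hlim
  simp only [cv_gau_zero hf hM] at key
  have e1 : ∫ s in Ioi (0:ℝ), ((-2*lam) * (gw lam 1 s • cv (gau E) s f x) + 2 * btrL (gw lam (-1) s • cv (gau2 E) s f x))
      = (-2*lam) * J (gau E) lam 1 f x + 2 * btrL (J (gau2 E) lam (-1) f x) := by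
    rw [integral_add (hi0.const_mul (-2*lam)) (hib.const_mul 2), integral_const_mul, integral_const_mul, hb]
    rfl
  rw [e1] at key
  rw [Rs_hs hl hf hM hα0 hα1 hH]
  unfold Rs Rs2
  rw [← btrL_apply, map_smul]
  simp at key ⊢
  linarith

omit hf hM hl hα0 hα1 hH in
theorem rs_unique {u w : E → ℝ} (hl : 0 < lam) (hu : ContDiff ℝ 2 u) (hw : ContDiff ℝ 2 w) {A B : ℝ}
    (hA : ∀ x, |u x| ≤ A) (hB : ∀ x, |w x| ≤ B)
    (h : ∀ x, lam * u x - btr (hs u x) = lam * w x - btr (hs w x)) : u = w := by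
  have hA' : ∀ x, |u x| ≤ max A B := fun x => (hA x).trans (le_max_left _ _)
  have hB' : ∀ x, |w x| ≤ max A B := fun x => (hB x).trans (le_max_right _ _)
  ext x
  have h1 := comparison (F := fun _ _ _ => 0) (L := 0) le_rfl (fun _ _ _ _ _ => le_rfl) (by simp) hu hw hA' hB' hl
    (le_refl (0:ℝ)) (fun x => by linarith [h x]) x
  have h2 := comparison (F := fun _ _ _ => 0) (L := 0) le_rfl (fun _ _ _ _ _ => le_rfl) (by simp) hw hu hB' hA' hl
    (le_refl (0:ℝ)) (fun x => by linarith [h x]) x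
  rw [zero_div] at h1 h2
  linarith

/-- representation -/
theorem rs_repr (hl : 0 < lam) {u : E → ℝ} (hu : ContDiff ℝ 2 u) {A : ℝ} (hA : ∀ x, |u x| ≤ A)
    (h : ∀ x, lam * u x - btr (hs u x) = f x) : u = Rs lam f :=
  rs_unique hl hu (Rs_contDiff hl hf hM hα0 hα1 hH) hA (Rs_bound hl hf hM) fun x => by
    rw [h, Rs_eq hl hf hM hα0 hα1 hH]
end PartH

set_option linter.unusedSectionVars false
set_option maxSynthPendingDepth 6

section PartI
variable {E : Type*} [NormedAddCommGroup E] [InnerProductSpace ℝ E] [FiniteDimensional ℝ E]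
variable [MeasurableSpace E] [BorelSpace E]

theorem continuous_of_holder {V : Type*} [NormedAddCommGroup V] {f : E → V} {H α : ℝ} (hα : 0 < α)
    (h : ∀ x y, ‖f x - f y‖ ≤ H * ‖x - y‖ ^ α) : Continuous f := by
  refine continuous_iff_continuousAt.2 fun x => ?_
  rw [ContinuousAt, tendsto_iff_norm_sub_tendsto_zero]
  refine squeeze_zero (fun _ => norm_nonneg _) (fun y => h y x) ?_
  have : Tendsto (fun y => ‖y - x‖ ^ α) (nhds x) (nhds (‖x - x‖ ^ α)) :=
    (Continuous.rpow_const (by fun_prop) (fun _ => Or.inr hα.le)).continuousAt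
  have h2 := this.const_mul H
  rwa [sub_self, norm_zero, Real.zero_rpow hα.ne', mul_zero] at h2

theorem holder_of_lip {V : Type*} [NormedAddCommGroup V] {v : E → V} {A B α : ℝ} (hα0 : 0 < α) (hα1 : α < 1) (hA : ∀ x, ‖v x‖ ≤ A)
    (hB0 : 0 ≤ B) (hB : ∀ x y, ‖v x - v y‖ ≤ B * ‖x - y‖) (x y : E) :
    ‖v x - v y‖ ≤ (2 * A + B) * ‖x - y‖ ^ α := by
  have hA0 : 0 ≤ A := (norm_nonneg _).trans (hA x)
  rcases le_total ‖x - y‖ 1 with h | h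
  · have : ‖x - y‖ ≤ ‖x - y‖ ^ α := by
      rcases (norm_nonneg (x - y)).eq_or_lt with h0 | h0
      · rw [← h0, Real.zero_rpow hα0.ne']
      · simpa using Real.rpow_le_rpow_of_exponent_ge h0 h hα1.le
    have h2 : 0 ≤ ‖x - y‖ ^ α := by positivity
    calc _ ≤ B * ‖x - y‖ := hB x y
      _ ≤ B * ‖x - y‖ ^ α := by gcongr
      _ ≤ _ := by gcongr; linarith
  · have h2 : 1 ≤ ‖x - y‖ ^ α := Real.one_le_rpow h hα0.le
    calc _ ≤ ‖v x‖ + ‖v y‖ := norm_sub_le _ _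
      _ ≤ (2 * A + B) * 1 := by linarith [hA x, hA y]
      _ ≤ _ := by gcongr

/-- bounded functions -/
abbrev XB (E : Type*) [NormedAddCommGroup E] := BoundedContinuousFunction E ℝ
/-- bounded covector fields -/
abbrev PB (E : Type*) [NormedAddCommGroup E] [InnerProductSpace ℝ E] := BoundedContinuousFunction E (E →L[ℝ] ℝ)

theorem xb_bd (f : XB E) (x : E) : |f x| ≤ ‖f‖ := f.norm_coe_le_norm x

theorem Rs1_cont {lam : ℝ} (hl : 0 < lam) (f : XB E) : Continuous (Rs1 lam f) :=
  continuous_of_holder (α := 1/2) (by norm_num)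
    (Rs1_holder hl f.continuous (xb_bd f) (by norm_num) (by norm_num))

theorem Rs_cont {lam : ℝ} (hl : 0 < lam) (f : XB E) : Continuous (Rs lam f) :=
  continuous_iff_continuousAt.2 fun x => (Rs_hasFDerivAt hl f.continuous (xb_bd f) x).continuousAt

/-- bundled resolvent -/
noncomputable def RsB {lam : ℝ} (hl : 0 < lam) (f : XB E) : XB E × PB E :=
  (BoundedContinuousFunction.ofNormedAddCommGroup (Rs lam f) (Rs_cont hl f) _
    (Rs_bound hl f.continuous (xb_bd f)),
   BoundedContinuousFunction.ofNormedAddCommGroup (Rs1 lam f) (Rs1_cont hl f) _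
    (Rs1_bound hl f.continuous (xb_bd f)))

theorem RsB_lip {lam : ℝ} (hl : 0 < lam) (f g : XB E) :
    dist (RsB hl f) (RsB hl g) ≤ max (r0 E lam) (r1 E lam) * dist f g := by
  have hf : ∀ x, |f x| ≤ max ‖f‖ ‖g‖ := fun x => (xb_bd f x).trans (le_max_left _ _)
  have hg : ∀ x, |g x| ≤ max ‖f‖ ‖g‖ := fun x => (xb_bd g x).trans (le_max_right _ _)
  have hfg : ∀ x, |f x - g x| ≤ dist f g := fun x => by
    rw [← Real.dist_eq]; exact BoundedContinuousFunction.dist_coe_le_dist x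
  have hr0 := r0_nonneg (E := E) lam
  have hc : Continuous fun x => f x - g x := f.continuous.sub g.continuous
  have hn : 0 ≤ max (r0 E lam) (r1 E lam) * dist f g := mul_nonneg (hr0.trans (le_max_left _ _)) dist_nonneg
  rw [Prod.dist_eq]
  refine max_le ?_ ?_
  · rw [BoundedContinuousFunction.dist_le hn]
    intro x
    change dist (Rs lam f x) (Rs lam g x) ≤ _
    rw [Real.dist_eq, ← Rs_sub hl f.continuous hf g.continuous hg]
    refine (Rs_bound hl hc hfg x).trans ?_
    rw [mul_comm]
    gcongr; exact le_max_left _ _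
  · rw [BoundedContinuousFunction.dist_le hn]
    intro x
    change dist (Rs1 lam f x) (Rs1 lam g x) ≤ _
    rw [dist_eq_norm, ← Rs1_sub hl f.continuous hf g.continuous hg]
    refine (Rs1_bound hl hc hfg x).trans ?_
    rw [mul_comm]
    gcongr; exact le_max_right _ _

variable {F : E → ℝ → (E →L[ℝ] ℝ) → ℝ} {K L : ℝ}
  (hFc : Continuous fun z : E × ℝ × (E →L[ℝ] ℝ) => F z.1 z.2.1 z.2.2)
  (hFK : ∀ x s p, |F x s p| ≤ K)

/-- Nemytskii operator -/
noncomputable def NB (vp : XB E × PB E) : XB E :=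
  BoundedContinuousFunction.ofNormedAddCommGroup (fun x => F x (vp.1 x) (vp.2 x))
    (hFc.comp (continuous_id.prodMk (vp.1.continuous.prodMk vp.2.continuous))) K
    (fun x => hFK _ _ _)

variable (hL : 0 ≤ L) (hlip : ∀ x s t p q, |F x s p - F x t q| ≤ L * (|s - t| + ‖p - q‖))
include hL hlip

theorem NB_lip (vp wq : XB E × PB E) : dist (NB hFc hFK vp) (NB hFc hFK wq) ≤ 2 * L * dist vp wq := by
  rw [BoundedContinuousFunction.dist_le (by positivity)]
  intro x
  change dist (F x (vp.1 x) (vp.2 x)) (F x (wq.1 x) (wq.2 x)) ≤ _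
  rw [Real.dist_eq]
  refine (hlip _ _ _ _ _).trans ?_
  have h1 : |vp.1 x - wq.1 x| ≤ dist vp wq := by
    rw [← Real.dist_eq]
    exact (BoundedContinuousFunction.dist_coe_le_dist x).trans (le_max_left _ _)
  have h2 : ‖vp.2 x - wq.2 x‖ ≤ dist vp wq := by
    rw [← dist_eq_norm]
    exact (BoundedContinuousFunction.dist_coe_le_dist x).trans (le_max_right _ _)
  calc _ ≤ L * (dist vp wq + dist vp wq) := by gcongr
    _ = _ := by ring

theorem sol_exists {lam : ℝ} (hl : 0 < lam) (hsmall : max (r0 E lam) (r1 E lam) * (2 * L) ≤ 1/2) :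
    ∃ Sol : XB E → XB E × PB E, Continuous Sol ∧ ∀ h, Sol h = RsB hl (h - NB hFc hFK (Sol h)) := by
  set ρ := max (r0 E lam) (r1 E lam) with hρ
  have hρ0 : 0 ≤ ρ := (r0_nonneg (E := E) lam).trans (le_max_left _ _)
  have key : ∀ h h' : XB E, ∀ vp wq : XB E × PB E, dist (RsB hl (h - NB hFc hFK vp)) (RsB hl (h' - NB hFc hFK wq))
      ≤ ρ * dist h h' + 1/2 * dist vp wq := by
    intro h h' vp wq
    have h1 := RsB_lip hl (h - NB hFc hFK vp) (h' - NB hFc hFK wq)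
    have h2 := dist_sub_sub_le h (NB hFc hFK vp) h' (NB hFc hFK wq)
    have h3 := NB_lip hFc hFK hL hlip vp wq
    have h4 : 0 ≤ dist vp wq := dist_nonneg
    calc _ ≤ ρ * dist (h - NB hFc hFK vp) (h' - NB hFc hFK wq) := h1
      _ ≤ ρ * (dist h h' + 2 * L * dist vp wq) := by gcongr; linarith
      _ = ρ * dist h h' + (ρ * (2 * L)) * dist vp wq := by ring
      _ ≤ _ := by gcongr
  have hcon : ∀ h : XB E, ContractingWith (1/2 : NNReal) (fun vp => RsB hl (h - NB hFc hFK vp)) := by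
    intro h
    refine ⟨by
      rw [← NNReal.coe_lt_coe]; norm_num, LipschitzWith.of_dist_le_mul fun vp wq => ?_⟩
    have := key h h vp wq
    rw [dist_self, mul_zero, zero_add] at this
    simpa using this
  refine ⟨fun h => (hcon h).fixedPoint, ?_, fun h => ((hcon h).fixedPoint_isFixedPt).symm⟩
  have : LipschitzWith (Real.toNNReal (2 * ρ)) (fun h : XB E => (hcon h).fixedPoint) := by
    refine LipschitzWith.of_dist_le_mul fun h h' => ?_
    have k := key h h' (hcon h).fixedPoint (hcon h').fixedPoint
    rw [show RsB hl (h - NB hFc hFK (hcon h).fixedPoint) = (hcon h).fixedPoint from (hcon h).fixedPoint_isFixedPt,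
      show RsB hl (h' - NB hFc hFK (hcon h').fixedPoint) = (hcon h').fixedPoint from (hcon h').fixedPoint_isFixedPt] at k
    rw [Real.coe_toNNReal _ (by positivity)]
    linarith
  exact this.continuous

variable {α HF : ℝ} (hα0 : 0 < α) (hα1 : α < 1) (hhol : ∀ x y s p, |F x s p - F y s p| ≤ HF * ‖x - y‖ ^ α)
include hα0 hα1 hhol

/-- regularity of fixed points -/
theorem fp_reg {lam : ℝ} (hl : 0 < lam) {h : XB E} {vp : XB E × PB E}
    (hfp : vp = RsB hl (h - NB hFc hFK vp)) :
    (∃ H, ∀ x y, |vp.1 x - vp.1 y| ≤ H * ‖x - y‖ ^ α) ∧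
    ((∃ H, ∀ x y, |h x - h y| ≤ H * ‖x - y‖ ^ α) → ContDiff ℝ 2 vp.1 ∧
      ∀ x, lam * vp.1 x - btr (hs vp.1 x) + F x (vp.1 x) (fderiv ℝ vp.1 x) = h x) := by
  set f : XB E := h - NB hFc hFK vp with hf
  have e1 : (vp.1 : E → ℝ) = Rs lam f := by rw [hfp]; rfl
  have e2 : (vp.2 : E → E →L[ℝ] ℝ) = Rs1 lam f := by rw [hfp]; rfl
  have hd := Rs_hasFDerivAt hl f.continuous (xb_bd f)
  have hb1 := Rs1_bound hl f.continuous (xb_bd f)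
  have hb0 := Rs_bound hl f.continuous (xb_bd f)
  have hlipR : ∀ x y, ‖Rs lam f x - Rs lam f y‖ ≤ (‖f‖ * r1 E lam) * ‖x - y‖ := fun x y =>
    Convex.norm_image_sub_le_of_norm_hasFDerivWithin_le (s := univ) (fun x _ => (hd x).hasFDerivWithinAt)
      (fun x _ => hb1 x) convex_univ (mem_univ _) (mem_univ _)
  have hv := holder_of_lip hα0 hα1 hb0 (mul_nonneg (norm_nonneg _) (r1_nonneg _)) hlipR
  refine ⟨⟨_, fun x y => by rw [e1]; exact hv x y⟩, ?_⟩
  rintro ⟨H, hH⟩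
  have hp := Rs1_holder hl f.continuous (xb_bd f) hα0 hα1
  obtain ⟨H1, hH1⟩ : ∃ H1, ∀ x y, ‖Rs lam f x - Rs lam f y‖ ≤ H1 * ‖x - y‖ ^ α := ⟨_, hv⟩
  obtain ⟨H2, hH2⟩ : ∃ H2, ∀ x y, ‖Rs1 lam f x - Rs1 lam f y‖ ≤ H2 * ‖x - y‖ ^ α := ⟨_, hp⟩
  have hfH : ∀ x y, |f x - f y| ≤ (H + (HF + L * (H1 + H2))) * ‖x - y‖ ^ α := by
    intro x y
    have e : f x - f y = (h x - h y) - ((F x (vp.1 x) (vp.2 x) - F y (vp.1 x) (vp.2 x)) +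
        (F y (vp.1 x) (vp.2 x) - F y (vp.1 y) (vp.2 y))) := by
      change (h x - F x (vp.1 x) (vp.2 x)) - (h y - F y (vp.1 y) (vp.2 y)) = _
      ring
    rw [e]
    refine (abs_sub _ _).trans ?_
    have h3 := hlip y (vp.1 x) (vp.1 y) (vp.2 x) (vp.2 y)
    rw [e1, e2] at h3
    have h5 : |F y (vp.1 x) (vp.2 x) - F y (vp.1 y) (vp.2 y)| ≤ L * (H1 * ‖x - y‖ ^ α + H2 * ‖x - y‖ ^ α) := by
      rw [e1, e2]
      exact h3.trans (mul_le_mul_of_nonneg_left (add_le_add (hH1 x y) (hH2 x y)) hL)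
    have h4 := abs_add_le (F x (vp.1 x) (vp.2 x) - F y (vp.1 x) (vp.2 x)) (F y (vp.1 x) (vp.2 x) - F y (vp.1 y) (vp.2 y))
    have := hH x y
    have := hhol x y (vp.1 x) (vp.2 x)
    linarith
  rw [e1]
  refine ⟨Rs_contDiff hl f.continuous (xb_bd f) hα0 hα1 hfH, fun x => ?_⟩
  rw [Rs_eq hl f.continuous (xb_bd f) hα0 hα1 hfH, (hd x).fderiv]
  have : f x = h x - F x (Rs lam f x) (Rs1 lam f x) := by
    rw [← e1, ← e2]; rfl
  rw [this]; ring

include hFc hFK in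
theorem exists_sol (hmono : ∀ x s t q, s ≤ t → F x s q ≤ F x t q) {mu : ℝ} (hmu : 0 < mu) :
    ∃ v : E → ℝ, ContDiff ℝ 2 v ∧ (∃ A, ∀ x, |v x| ≤ A) ∧
      ∀ x, mu * v x - btr (hs v x) + F x (v x) (fderiv ℝ v x) = 0 := by
  have ht : Tendsto (fun lam => max (r0 E lam) (r1 E lam) * (2 * L)) atTop (nhds 0) := by
    have := ((r0_tendsto (E := E)).max (r1_tendsto (E := E))).mul_const (2 * L)
    simpa using this
  obtain ⟨lam, hsmall, hlm⟩ := ((ht.eventually (ge_mem_nhds (show (0:ℝ) < 1/2 by norm_num))).and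
    (eventually_gt_atTop mu)).exists
  have hl : 0 < lam := hmu.trans hlm
  obtain ⟨Sol, hSc, hSol⟩ := sol_exists hFc hFK hL hlip hl hsmall
  set Φ : XB E → XB E := fun v => (Sol ((lam - mu) • v)).1 with hΦ
  have hΦc : Continuous Φ := by fun_prop
  set θ := (lam - mu) / lam with hθ
  have hθ1 : θ < 1 := by rw [hθ, div_lt_one hl]; linarith
  have hθ0 : 0 ≤ θ := div_nonneg (by linarith) hl.le
  have hsm : ∀ v : XB E, (∃ H, ∀ x y, |v x - v y| ≤ H * ‖x - y‖ ^ α) →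
      (∃ H, ∀ x y, |((lam - mu) • v : XB E) x - ((lam - mu) • v : XB E) y| ≤ H * ‖x - y‖ ^ α) := by
    rintro v ⟨H, hH⟩
    refine ⟨(lam - mu) * H, fun x y => ?_⟩
    simp only [BoundedContinuousFunction.coe_smul, smul_eq_mul, ← mul_sub, abs_mul, abs_of_pos (sub_pos.2 hlm), mul_assoc]
    exact mul_le_mul_of_nonneg_left (hH x y) (sub_pos.2 hlm).le
  have hreg : ∀ v : XB E, ∃ H, ∀ x y, |Φ v x - Φ v y| ≤ H * ‖x - y‖ ^ α := fun v =>
    (fp_reg hFc hFK hL hlip hα0 hα1 hhol hl (hSol ((lam - mu) • v))).1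
  have hC2 : ∀ v : XB E, (∃ H, ∀ x y, |v x - v y| ≤ H * ‖x - y‖ ^ α) → ContDiff ℝ 2 (Φ v) ∧
      ∀ x, lam * Φ v x - btr (hs (Φ v) x) + F x (Φ v x) (fderiv ℝ (Φ v) x) = (lam - mu) * v x := fun v hv =>
    (fp_reg hFc hFK hL hlip hα0 hα1 hhol hl (hSol ((lam - mu) • v))).2 (hsm v hv)
  have hlip' : ∀ x s p q, |F x s p - F x s q| ≤ L * ‖p - q‖ := fun x s p q => by
    simpa using hlip x s s p q
  have hone : ∀ v w : XB E, (∃ H, ∀ x y, |v x - v y| ≤ H * ‖x - y‖ ^ α) → (∃ H, ∀ x y, |w x - w y| ≤ H * ‖x - y‖ ^ α) →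
      ∀ x, Φ v x - Φ w x ≤ θ * dist v w := by
    intro v w hv hw x
    obtain ⟨a1, a2⟩ := hC2 v hv
    obtain ⟨b1, b2⟩ := hC2 w hw
    have hM1 : ∀ x, |Φ v x| ≤ max ‖Φ v‖ ‖Φ w‖ := fun x => (xb_bd _ x).trans (le_max_left _ _)
    have hM2 : ∀ x, |Φ w x| ≤ max ‖Φ v‖ ‖Φ w‖ := fun x => (xb_bd _ x).trans (le_max_right _ _)
    have h := comparison hL hmono hlip' a1 b1 hM1 hM2 hl (η := (lam - mu) * dist v w)
      (mul_nonneg (sub_pos.2 hlm).le dist_nonneg) (fun x => by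
        rw [a2, b2]
        have : v x - w x ≤ dist v w := (le_abs_self _).trans (by
          rw [← Real.dist_eq]; exact BoundedContinuousFunction.dist_coe_le_dist x)
        nlinarith [sub_pos.2 hlm]) x
    calc _ ≤ _ := h
      _ = _ := by rw [hθ]; ring
  have hcontr : ∀ v w : XB E, (∃ H, ∀ x y, |v x - v y| ≤ H * ‖x - y‖ ^ α) → (∃ H, ∀ x y, |w x - w y| ≤ H * ‖x - y‖ ^ α) →
      dist (Φ v) (Φ w) ≤ θ * dist v w := by
    intro v w hv hw
    rw [BoundedContinuousFunction.dist_le (mul_nonneg hθ0 dist_nonneg)]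
    intro x
    rw [Real.dist_eq, abs_le]
    have h1 := hone v w hv hw x
    have h2 := hone w v hw hv x
    rw [dist_comm w v] at h2
    constructor <;> linarith
  set u : ℕ → XB E := fun n => Φ^[n] 0 with hu
  have hus : ∀ n, u (n + 1) = Φ (u n) := fun n => Function.iterate_succ_apply' _ _ _
  have huh : ∀ n, ∃ H, ∀ x y, |u n x - u n y| ≤ H * ‖x - y‖ ^ α := by
    intro n
    cases n with
    | zero => exact ⟨0, fun x y => by simp [hu]⟩
    | succ n => rw [hus]; exact hreg _
  have hgeo : ∀ n, dist (u n) (u (n+1)) ≤ dist (u 0) (u 1) * θ ^ n := by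
    intro n
    induction n with
    | zero => simp
    | succ n ih =>
      rw [hus (n+1), hus n]
      refine (hcontr _ _ (huh n) ?_).trans ?_
      · rw [← hus]; exact huh _
      rw [← hus n]
      calc θ * dist (u n) (u (n+1)) ≤ θ * (dist (u 0) (u 1) * θ ^ n) := by gcongr
        _ = _ := by ring
  obtain ⟨v, hv⟩ := cauchySeq_tendsto_of_complete (cauchySeq_of_le_geometric θ _ hθ1 hgeo)
  have hfix : Φ v = v := by
    refine tendsto_nhds_unique ((hΦc.tendsto v).comp hv) ?_
    have := hv.comp (tendsto_add_atTop_nat 1)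
    refine this.congr fun n => ?_
    simp [hus]
  have hvh : ∃ H, ∀ x y, |v x - v y| ≤ H * ‖x - y‖ ^ α := by rw [← hfix]; exact hreg v
  obtain ⟨c1, c2⟩ := hC2 v hvh
  rw [hfix] at c1 c2
  exact ⟨v, c1, ⟨‖v‖, xb_bd v⟩, fun x => by linarith [c2 x]⟩

end PartI

set_option linter.unusedSectionVars false
set_option maxSynthPendingDepth 6

section PartJ
variable {E : Type*} [NormedAddCommGroup E] [InnerProductSpace ℝ E] [FiniteDimensional ℝ E]
variable [MeasurableSpace E] [BorelSpace E]
variable {V : Type*} [NormedAddCommGroup V]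

/-- local Hölder continuity, on balls -/
def LH (α : ℝ) (f : E → V) : Prop :=
  ∀ R : ℝ, ∃ C : ℝ, ∀ x ∈ Metric.closedBall (0:E) R, ∀ y ∈ Metric.closedBall (0:E) R,
    ‖f x - f y‖ ≤ C * ‖x - y‖ ^ α

theorem LH.continuous {α : ℝ} (hα : 0 < α) {f : E → V} (h : LH α f) : Continuous f := by
  refine continuous_iff_continuousAt.2 fun x => ?_
  obtain ⟨C, hC⟩ := h (‖x‖ + 1)
  rw [ContinuousAt, tendsto_iff_norm_sub_tendsto_zero]
  have : Tendsto (fun y => ‖y - x‖ ^ α) (nhds x) (nhds (‖x - x‖ ^ α)) :=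
    (Continuous.rpow_const (by fun_prop) (fun _ => Or.inr hα.le)).continuousAt
  have h2 := this.const_mul C
  rw [sub_self, norm_zero, Real.zero_rpow hα.ne', mul_zero] at h2
  refine squeeze_zero' (Eventually.of_forall fun _ => norm_nonneg _) ?_ h2
  filter_upwards [Metric.closedBall_mem_nhds x one_pos] with y hy
  refine hC y ?_ x ?_
  · rw [mem_closedBall_zero_iff]
    rw [mem_closedBall_iff_norm] at hy
    have := norm_sub_norm_le y x
    linarith
  · rw [mem_closedBall_zero_iff]; linarith

theorem cont_bdd {f : E → V} (h : Continuous f) (R : ℝ) :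
    ∃ A, 0 ≤ A ∧ ∀ x ∈ Metric.closedBall (0:E) R, ‖f x‖ ≤ A := by
  obtain ⟨A, hA⟩ := (isCompact_closedBall (0:E) R).exists_bound_of_continuousOn h.continuousOn
  exact ⟨max A 0, le_max_right _ _, fun x hx => (hA x hx).trans (le_max_left _ _)⟩

theorem LH.add {α : ℝ} {f g : E → V} (hf : LH α f) (hg : LH α g) : LH α (fun x => f x + g x) := by
  intro R
  obtain ⟨C, hC⟩ := hf R
  obtain ⟨D, hD⟩ := hg R
  refine ⟨C + D, fun x hx y hy => ?_⟩
  rw [add_sub_add_comm, add_mul]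
  exact (norm_add_le _ _).trans (add_le_add (hC x hx y hy) (hD x hx y hy))

theorem LH.sub {α : ℝ} {f g : E → V} (hf : LH α f) (hg : LH α g) : LH α (fun x => f x - g x) := by
  intro R
  obtain ⟨C, hC⟩ := hf R
  obtain ⟨D, hD⟩ := hg R
  refine ⟨C + D, fun x hx y hy => ?_⟩
  rw [sub_sub_sub_comm, add_mul]
  exact (norm_sub_le _ _).trans (add_le_add (hC x hx y hy) (hD x hx y hy))

theorem LH.const {α : ℝ} (c : V) : LH α (fun _ : E => c) := fun R => ⟨0, fun x _ y _ => by simp⟩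

theorem LH.norm {α : ℝ} {f : E → V} (hf : LH α f) : LH α (fun x => ‖f x‖) := by
  intro R
  obtain ⟨C, hC⟩ := hf R
  exact ⟨C, fun x hx y hy => (abs_norm_sub_norm_le _ _).trans (hC x hx y hy)⟩

theorem LH.min_const {α : ℝ} {f : E → ℝ} (hf : LH α f) (k : ℝ) : LH α (fun x => min (f x) k) := by
  intro R
  obtain ⟨C, hC⟩ := hf R
  refine ⟨C, fun x hx y hy => le_trans ?_ (hC x hx y hy)⟩
  have := abs_min_sub_min_le_max (f x) k (f y) k
  simpa using this

theorem LH.mul {α : ℝ} (hα : 0 < α) {f g : E → ℝ} (hf : LH α f) (hg : LH α g) : LH α (fun x => f x * g x) := by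
  intro R
  obtain ⟨C, hC⟩ := hf R
  obtain ⟨D, hD⟩ := hg R
  obtain ⟨A, hA0, hA⟩ := cont_bdd (hf.continuous hα) R
  obtain ⟨B, hB0, hB⟩ := cont_bdd (hg.continuous hα) R
  refine ⟨A * D + B * C, fun x hx y hy => ?_⟩
  have e : f x * g x - f y * g y = f x * (g x - g y) + g y * (f x - f y) := by ring
  rw [e, add_mul]
  refine (norm_add_le _ _).trans (add_le_add ?_ ?_)
  · rw [norm_mul, mul_assoc]
    exact mul_le_mul (hA x hx) (hD x hx y hy) (norm_nonneg _) hA0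
  · rw [norm_mul, mul_assoc]
    exact mul_le_mul (hB y hy) (hC x hx y hy) (norm_nonneg _) hB0

theorem LH.of_C1 [NormedSpace ℝ V] {α : ℝ} (hα0 : 0 < α) (hα1 : α < 1) {f : E → V} (hf : ContDiff ℝ 1 f) : LH α f := by
  intro R
  obtain ⟨B, hB0, hB⟩ := cont_bdd (hf.continuous_fderiv (by norm_num)) R
  obtain ⟨A, hA0, hA⟩ := cont_bdd hf.continuous R
  refine ⟨2 * A + B, fun x hx y hy => ?_⟩
  have hl : ‖f x - f y‖ ≤ B * ‖x - y‖ :=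
    Convex.norm_image_sub_le_of_norm_fderiv_le (fun x _ => (hf.differentiable (by norm_num)) x) hB
      (convex_closedBall _ _) hy hx
  rcases le_total ‖x - y‖ 1 with h | h
  · have : ‖x - y‖ ≤ ‖x - y‖ ^ α := by
      rcases (norm_nonneg (x - y)).eq_or_lt with h0 | h0
      · rw [← h0, Real.zero_rpow hα0.ne']
      · simpa using Real.rpow_le_rpow_of_exponent_ge h0 h hα1.le
    have h2 : 0 ≤ ‖x - y‖ ^ α := by positivity
    calc _ ≤ B * ‖x - y‖ := hl
      _ ≤ B * ‖x - y‖ ^ α := by gcongr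
      _ ≤ _ := by gcongr; linarith
  · have h2 : 1 ≤ ‖x - y‖ ^ α := Real.one_le_rpow h hα0.le
    calc _ ≤ ‖f x‖ + ‖f y‖ := norm_sub_le _ _
      _ ≤ (2 * A + B) * 1 := by linarith [hA x hx, hA y hy]
      _ ≤ _ := by gcongr

theorem LH.compact {α : ℝ} (hα : 0 < α) {f : E → ℝ} (hf : LH α f) {R : ℝ} (hs : ∀ x, R < ‖x‖ → f x = 0) :
    ∃ M H, (∀ x, |f x| ≤ M) ∧ ∀ x y, |f x - f y| ≤ H * ‖x - y‖ ^ α := by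
  obtain ⟨C, hC⟩ := hf (R + 1)
  obtain ⟨A, hA0, hA⟩ := cont_bdd (hf.continuous hα) R
  have hM : ∀ x, |f x| ≤ A := by
    intro x
    rcases le_or_gt ‖x‖ R with h | h
    · exact hA x (mem_closedBall_zero_iff.2 h)
    · rw [hs x h]; simpa using hA0
  refine ⟨A, max C A, hM, ?_⟩
  have far : ∀ x y, ‖x‖ ≤ R → R + 1 < ‖y‖ → |f x - f y| ≤ max C A * ‖x - y‖ ^ α := by
    intro x y hx hy
    rw [hs y (by linarith), sub_zero]
    have h1 : 1 ≤ ‖x - y‖ := by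
      have := norm_sub_norm_le y x
      rw [norm_sub_rev] at this; linarith
    have h2 : 1 ≤ ‖x - y‖ ^ α := Real.one_le_rpow h1 hα.le
    calc |f x| ≤ A := hM x
      _ ≤ max C A * 1 := by rw [mul_one]; exact le_max_right _ _
      _ ≤ _ := by
        gcongr
  intro x y
  have h0 : 0 ≤ ‖x - y‖ ^ α := by positivity
  rcases le_or_gt ‖x‖ (R + 1) with hx | hx <;> rcases le_or_gt ‖y‖ (R + 1) with hy | hy
  · refine (hC x (mem_closedBall_zero_iff.2 hx) y (mem_closedBall_zero_iff.2 hy)).trans ?_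
    gcongr; exact le_max_left _ _
  · rcases le_or_gt ‖x‖ R with hx' | hx'
    · exact far x y hx' hy
    · rw [hs x hx', hs y (by linarith)]
      simp; exact mul_nonneg (hA0.trans (le_max_right _ _)) h0
  · rcases le_or_gt ‖y‖ R with hx' | hx'
    · rw [abs_sub_comm, norm_sub_rev]
      exact far y x hx' hx
    · rw [hs y hx', hs x (by linarith)]
      simp; exact mul_nonneg (hA0.trans (le_max_right _ _)) h0
  · rw [hs x (by linarith), hs y (by linarith)]
    simp; exact mul_nonneg (hA0.trans (le_max_right _ _)) h0

/-- cutoffs -/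
theorem exists_cutoff (E : Type*) [NormedAddCommGroup E] [InnerProductSpace ℝ E] [FiniteDimensional ℝ E] {R : ℝ} (hR : 0 < R) :
    ∃ χ : E → ℝ, ContDiff ℝ 3 χ ∧ (∀ x, 0 ≤ χ x) ∧ (∀ x, χ x ≤ 1) ∧
    (∀ x, ‖x‖ ≤ R → χ x = 1) ∧ (∀ x, R + 1 ≤ ‖x‖ → χ x = 0) := by
  let b : ContDiffBump (0:E) := ⟨R, R + 1, hR, by linarith⟩
  refine ⟨b, b.contDiff, fun x => b.nonneg, fun x => b.le_one, fun x hx => ?_, fun x hx => ?_⟩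
  · exact b.one_of_mem_closedBall (mem_closedBall_zero_iff.2 hx)
  · exact b.zero_of_le_dist (by simpa using hx)

/-- product rule -/
theorem fderiv_mul2 {χ v : E → ℝ} (hχ : ContDiff ℝ 2 χ) (hv : ContDiff ℝ 2 v) :
    fderiv ℝ (fun x => χ x * v x) = fun x => χ x • fderiv ℝ v x + v x • fderiv ℝ χ x := by
  ext1 x
  exact ((hχ.differentiable (by norm_num) x).hasFDerivAt.mul (hv.differentiable (by norm_num) x).hasFDerivAt).fderiv

theorem btr_hs_mul {χ v : E → ℝ} (hχ : ContDiff ℝ 2 χ) (hv : ContDiff ℝ 2 v) (x : E) :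
    btr (hs (fun x => χ x * v x) x) = χ x * btr (hs v x) + v x * btr (hs χ x)
      + 2 * ∑ i, fderiv ℝ χ x (stdOrthonormalBasis ℝ E i) * fderiv ℝ v x (stdOrthonormalBasis ℝ E i) := by
  have h1 : HasFDerivAt χ (fderiv ℝ χ x) x := (hχ.differentiable (by norm_num) x).hasFDerivAt
  have h2 : HasFDerivAt v (fderiv ℝ v x) x := (hv.differentiable (by norm_num) x).hasFDerivAt
  have h3 : HasFDerivAt (fderiv ℝ χ) (hs χ x) x := (fderiv_diff hχ.contDiffAt).hasFDerivAt
  have h4 : HasFDerivAt (fderiv ℝ v) (hs v x) x := (fderiv_diff hv.contDiffAt).hasFDerivAt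
  have h5 : HasFDerivAt (fun x => χ x • fderiv ℝ v x + v x • fderiv ℝ χ x) _ x := (h1.smul h4).add (h2.smul h3)
  have e : hs (fun x => χ x * v x) x = (χ x • hs v x + (fderiv ℝ χ x).smulRight (fderiv ℝ v x)) +
      (v x • hs χ x + (fderiv ℝ v x).smulRight (fderiv ℝ χ x)) := by
    unfold hs
    rw [fderiv_mul2 hχ hv]
    exact h5.fderiv
  rw [e, btr_add, btr_add, btr_add, btr_smul, btr_smul, btr_smulRight, btr_smulRight]
  have : ∑ i, fderiv ℝ v x (stdOrthonormalBasis ℝ E i) * fderiv ℝ χ x (stdOrthonormalBasis ℝ E i) =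
    ∑ i, fderiv ℝ χ x (stdOrthonormalBasis ℝ E i) * fderiv ℝ v x (stdOrthonormalBasis ℝ E i) :=
    Finset.sum_congr rfl fun i _ => mul_comm _ _
  rw [this]; ring

/-- right hand side for the cut off function: data `h = Δv`, `p = Dv` -/
noncomputable def cutf (χ v h : E → ℝ) (p : E → E →L[ℝ] ℝ) (x : E) : ℝ :=
  χ x * v x - (χ x * h x + v x * btr (hs χ x)
      + 2 * ∑ i, fderiv ℝ χ x (stdOrthonormalBasis ℝ E i) * p x (stdOrthonormalBasis ℝ E i))

theorem fderiv_zero_of_zero {χ : E → ℝ} {R : ℝ} (h : ∀ x, R ≤ ‖x‖ → χ x = 0) (x : E) (hx : R < ‖x‖) :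
    fderiv ℝ χ x = 0 ∧ hs χ x = 0 := by
  have hU : ∀ y : E, R < ‖y‖ → fderiv ℝ χ y = 0 := by
    intro y hy
    have : χ =ᶠ[nhds y] fun _ => 0 := by
      filter_upwards [(isOpen_lt continuous_const continuous_norm).mem_nhds hy] with z hz
      exact h z (le_of_lt hz)
    rw [this.fderiv_eq]; simp
  refine ⟨hU x hx, ?_⟩
  have : fderiv ℝ χ =ᶠ[nhds x] fun _ => 0 := by
    filter_upwards [(isOpen_lt continuous_const continuous_norm).mem_nhds hx] with z hz
    exact hU z hz
  unfold hs
  rw [this.fderiv_eq]; simp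

theorem cutf_supp {χ : E → ℝ} {R : ℝ} (h : ∀ x, R ≤ ‖x‖ → χ x = 0) (v h' : E → ℝ) (p : E → E →L[ℝ] ℝ)
    (x : E) (hx : R < ‖x‖) : cutf χ v h' p x = 0 := by
  obtain ⟨h1, h2⟩ := fderiv_zero_of_zero h x hx
  unfold cutf
  rw [h1, h2, h x hx.le]
  simp [btr]

theorem LH.ev {α : ℝ} {p : E → E →L[ℝ] ℝ} (hp : LH α p) (e : E) : LH α (fun x => p x e) := by
  intro R
  obtain ⟨C, hC⟩ := hp R
  refine ⟨C * ‖e‖, fun x hx y hy => ?_⟩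
  rw [← sub_apply]
  refine ((p x - p y).le_opNorm e).trans ?_
  have := mul_le_mul_of_nonneg_right (hC x hx y hy) (norm_nonneg e)
  linarith

theorem LH.sum {α : ℝ} {ι : Type*} (s : Finset ι) {f : ι → E → ℝ} (h : ∀ i, LH α (f i)) :
    LH α (fun x => ∑ i ∈ s, f i x) := by
  classical
  induction s using Finset.induction_on with
  | empty => simpa using LH.const (0:ℝ)
  | insert i s hi ih =>
    simp_rw [Finset.sum_insert hi]
    exact (h i).add ih

theorem C1_fderiv {χ : E → ℝ} (hχ : ContDiff ℝ 2 χ) : ContDiff ℝ 1 (fderiv ℝ χ) :=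
  hχ.fderiv_right (by norm_num)

theorem C1_hs {χ : E → ℝ} (hχ : ContDiff ℝ 3 χ) : ContDiff ℝ 1 (fun x => btr (hs χ x)) := by
  have h1 : ContDiff ℝ 2 (fderiv ℝ χ) := hχ.fderiv_right (by norm_num)
  have h2 : ContDiff ℝ 1 (hs χ) := h1.fderiv_right (by norm_num)
  exact btrL.contDiff.comp h2

theorem cutf_LH {α : ℝ} (hα0 : 0 < α) (hα1 : α < 1) {χ v h : E → ℝ} {p : E → E →L[ℝ] ℝ} (hχ : ContDiff ℝ 3 χ)
    (hv : LH α v) (hh : LH α h) (hp : LH α p) : LH α (cutf χ v h p) := by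
  have hχ2 : ContDiff ℝ 2 χ := hχ.of_le (by norm_num)
  have c1 : LH α χ := LH.of_C1 hα0 hα1 (hχ.of_le (by norm_num))
  have c2 : LH α (fun x => btr (hs χ x)) := LH.of_C1 hα0 hα1 (C1_hs hχ)
  have c3 : LH α (fderiv ℝ χ) := LH.of_C1 hα0 hα1 (C1_fderiv hχ2)
  exact (c1.mul hα0 hv).sub (((c1.mul hα0 hh).add (hv.mul hα0 c2)).add
    ((LH.const 2).mul hα0 (LH.sum _ fun i => (c3.ev _).mul hα0 (hp.ev _))))

theorem cut_repr {α : ℝ} (hα0 : 0 < α) (hα1 : α < 1) {χ v : E → ℝ} (hχ : ContDiff ℝ 3 χ)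
    {R : ℝ} (h0 : ∀ x, R ≤ ‖x‖ → χ x = 0) (hv : ContDiff ℝ 2 v) (hh : LH α (fun x => btr (hs v x))) :
    (fun x => χ x * v x) = Rs 1 (cutf χ v (fun x => btr (hs v x)) (fderiv ℝ v)) := by
  have hχ2 : ContDiff ℝ 2 χ := hχ.of_le (by norm_num)
  have hL := cutf_LH hα0 hα1 hχ (LH.of_C1 hα0 hα1 (hv.of_le (by norm_num))) hh (LH.of_C1 hα0 hα1 (C1_fderiv hv))
  obtain ⟨M, H, hM, hH⟩ := hL.compact hα0 (R := R) (fun x hx => cutf_supp h0 _ _ _ x hx)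
  obtain ⟨A, -, hA⟩ := cont_bdd (f := fun x => χ x * v x) (by have := hχ.continuous; have := hv.continuous; fun_prop) R
  have hA' : ∀ x, |χ x * v x| ≤ max A 0 := by
    intro x
    rcases le_or_gt ‖x‖ R with h | h
    · exact (hA x (mem_closedBall_zero_iff.2 h)).trans (le_max_left _ _)
    · rw [h0 x h.le]; simp
  refine rs_repr one_pos (hL.continuous hα0) hM hα0 hα1 hH one_pos (hχ2.mul hv) hA' fun x => ?_
  rw [btr_hs_mul hχ2 hv]
  unfold cutf
  ring

theorem cutf_bound (χ : E → ℝ) (hχ : ContDiff ℝ 3 χ) {R : ℝ} (h0 : ∀ x, R ≤ ‖x‖ → χ x = 0) :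
    ∃ B, 0 ≤ B ∧ ∀ (v h : E → ℝ) (p : E → E →L[ℝ] ℝ) A, 0 ≤ A → (∀ x ∈ Metric.closedBall (0:E) R, |v x| ≤ A ∧ |h x| ≤ A ∧ ‖p x‖ ≤ A) →
      ∀ x, |cutf χ v h p x| ≤ B * A := by
  have hχ2 : ContDiff ℝ 2 χ := hχ.of_le (by norm_num)
  obtain ⟨b1, hb1, h1⟩ := cont_bdd hχ.continuous R
  obtain ⟨b2, hb2, h2⟩ := cont_bdd (C1_hs hχ).continuous R
  obtain ⟨b3, hb3, h3⟩ := cont_bdd (C1_fderiv hχ2).continuous R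
  refine ⟨b1 + (b1 + b2 + 2 * (Module.finrank ℝ E * b3)), by positivity, ?_⟩
  intro v h p A hA hvhp x
  rcases le_or_gt ‖x‖ R with hx | hx
  · have hx := mem_closedBall_zero_iff.2 hx
    obtain ⟨k1, k2, k3⟩ := hvhp x hx
    have s1 : |χ x * v x| ≤ b1 * A := by
      rw [abs_mul]; exact mul_le_mul (h1 x hx) k1 (abs_nonneg _) hb1
    have s2 : |χ x * h x| ≤ b1 * A := by
      rw [abs_mul]; exact mul_le_mul (h1 x hx) k2 (abs_nonneg _) hb1
    have s3 : |v x * btr (hs χ x)| ≤ b2 * A := by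
      rw [abs_mul, mul_comm]; exact mul_le_mul (h2 x hx) k1 (abs_nonneg _) hb2
    have s4 : |∑ i, fderiv ℝ χ x (stdOrthonormalBasis ℝ E i) * p x (stdOrthonormalBasis ℝ E i)| ≤ Module.finrank ℝ E * b3 * A := by
      refine (Finset.abs_sum_le_sum_abs _ _).trans ?_
      have : ∀ i ∈ Finset.univ, |fderiv ℝ χ x (stdOrthonormalBasis ℝ E i) * p x (stdOrthonormalBasis ℝ E i)| ≤ b3 * A := by
        intro i _
        rw [abs_mul]
        have n1 : ‖stdOrthonormalBasis ℝ E i‖ = 1 := by simp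
        have m1 := (fderiv ℝ χ x).le_opNorm (stdOrthonormalBasis ℝ E i)
        have m2 := (p x).le_opNorm (stdOrthonormalBasis ℝ E i)
        rw [n1, mul_one] at m1 m2
        exact mul_le_mul (m1.trans (h3 x hx)) (m2.trans k3) (abs_nonneg _) hb3
      refine (Finset.sum_le_card_nsmul _ _ _ this).trans ?_
      rw [nsmul_eq_mul]; simp [mul_assoc]
    unfold cutf
    rw [abs_le] at *
    constructor <;> nlinarith
  · rw [cutf_supp h0 _ _ _ x hx, abs_zero]; positivity

theorem loc_eq {χ v : E → ℝ} {R : ℝ} (h1 : ∀ x, ‖x‖ ≤ R → χ x = 1) (x : E) (hx : ‖x‖ < R) :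
    (fun x => χ x * v x) =ᶠ[nhds x] v := by
  filter_upwards [(isOpen_lt continuous_norm continuous_const).mem_nhds hx] with z hz
  rw [h1 z (le_of_lt hz), one_mul]

theorem hs_congr {u v : E → ℝ} {x : E} (h : u =ᶠ[nhds x] v) : hs u x = hs v x := by
  unfold hs; exact h.fderiv.fderiv_eq

theorem grad_holder_unif {α : ℝ} (hα0 : 0 < α) (hα1 : α < 1) {R : ℝ} (hR : 0 < R) {A : ℝ} (hA : 0 ≤ A) :
    ∃ C, 0 ≤ C ∧ ∀ v : E → ℝ, ContDiff ℝ 2 v → LH α (fun x => btr (hs v x)) →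
      (∀ x ∈ Metric.closedBall (0:E) (R+2), |v x| ≤ A ∧ |btr (hs v x)| ≤ A ∧ ‖fderiv ℝ v x‖ ≤ A) →
      ∀ x ∈ Metric.closedBall (0:E) R, ∀ y ∈ Metric.closedBall (0:E) R,
        ‖fderiv ℝ v x - fderiv ℝ v y‖ ≤ C * ‖x - y‖ ^ α := by
  obtain ⟨χ, hχ, -, -, hχ1, hχ0⟩ := exists_cutoff E (R := R + 1) (by linarith)
  obtain ⟨B, hB0, hB⟩ := cutf_bound χ hχ hχ0
  refine ⟨B * A * (2 * ((2 * (∫ z, ‖gau1 E z‖) + ∫ z, ‖gau2 E z‖) * gI 1 (-α))), ?_, ?_⟩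
  · have := gI_nonneg 1 (-α); positivity
  intro v hv hh hb x hx y hy
  have hrep := cut_repr hα0 hα1 hχ hχ0 hv hh
  have hL := cutf_LH hα0 hα1 hχ (LH.of_C1 hα0 hα1 (hv.of_le (by norm_num))) hh (LH.of_C1 hα0 hα1 (C1_fderiv hv))
  have hM := hB v (fun x => btr (hs v x)) (fderiv ℝ v) A hA (by
    have e : R + 2 = R + 1 + 1 := by ring
    rw [e] at hb; exact hb)
  have hD : ∀ x ∈ Metric.closedBall (0:E) R, fderiv ℝ v x = Rs1 1 (cutf χ v (fun x => btr (hs v x)) (fderiv ℝ v)) x := by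
    intro x hx
    rw [mem_closedBall_zero_iff] at hx
    rw [← (loc_eq (v := v) hχ1 x (by linarith)).fderiv_eq, hrep]
    exact (Rs_hasFDerivAt one_pos (hL.continuous hα0) hM x).fderiv
  rw [hD x hx, hD y hy]
  exact Rs1_holder one_pos (hL.continuous hα0) hM hα0 hα1 x y

theorem hs_LH {α : ℝ} (hα0 : 0 < α) (hα1 : α < 1) {v : E → ℝ} (hv : ContDiff ℝ 2 v) (hh : LH α (fun x => btr (hs v x))) :
    LH α (hs v) := by
  intro R
  obtain ⟨χ, hχ, -, -, hχ1, hχ0⟩ := exists_cutoff E (R := |R| + 1) (by positivity)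
  have hrep := cut_repr hα0 hα1 hχ hχ0 hv hh
  have hL := cutf_LH hα0 hα1 hχ (LH.of_C1 hα0 hα1 (hv.of_le (by norm_num))) hh (LH.of_C1 hα0 hα1 (C1_fderiv hv))
  obtain ⟨M, H, hM, hH⟩ := hL.compact hα0 (fun x hx => cutf_supp hχ0 _ _ _ x hx)
  have hD : ∀ x ∈ Metric.closedBall (0:E) R, hs v x = Rs2 1 (cutf χ v (fun x => btr (hs v x)) (fderiv ℝ v)) x := by
    intro x hx
    rw [mem_closedBall_zero_iff] at hx
    rw [← hs_congr (loc_eq (v := v) hχ1 x (by linarith [le_abs_self R])), hrep]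
    exact Rs_hs one_pos (hL.continuous hα0) hM hα0 hα1 hH x
  have hh2 := Rs2_holder one_pos (hL.continuous hα0) hM hα0 hα1 hH
  exact ⟨_, fun x hx y hy => by rw [hD x hx, hD y hy]; exact hh2 x y⟩

end PartJ

set_option linter.unusedSectionVars false
set_option maxSynthPendingDepth 6

section PartK
variable {E : Type*} [NormedAddCommGroup E] [InnerProductSpace ℝ E] [FiniteDimensional ℝ E]
variable [MeasurableSpace E] [BorelSpace E]

theorem exp_lip {A s t : ℝ} (hs : s ≤ A) (ht : t ≤ A) : |Real.exp s - Real.exp t| ≤ Real.exp A * |s - t| := by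
  wlog h : t ≤ s generalizing s t
  · rw [abs_sub_comm, abs_sub_comm s]; exact this ht hs (le_of_not_ge h)
  have h1 := Real.add_one_le_exp (t - s)
  have h2 : Real.exp t = Real.exp s * Real.exp (t - s) := by rw [← Real.exp_add]; ring_nf
  rw [abs_of_nonneg (sub_nonneg.2 (Real.exp_le_exp.2 h)), abs_of_nonneg (sub_nonneg.2 h)]
  have h3 := Real.exp_pos s
  have h4 := Real.exp_le_exp.2 hs
  nlinarith [sub_nonneg.2 h]

theorem LH.exp {α : ℝ} (hα : 0 < α) {f : E → ℝ} (hf : LH α f) : LH α (fun x => Real.exp (f x)) := by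
  intro R
  obtain ⟨C, hC⟩ := hf R
  obtain ⟨A, hA0, hA⟩ := cont_bdd (hf.continuous hα) R
  refine ⟨Real.exp A * C, fun x hx y hy => ?_⟩
  refine (exp_lip ((le_abs_self _).trans (hA x hx)) ((le_abs_self _).trans (hA y hy))).trans ?_
  rw [mul_assoc]
  exact mul_le_mul_of_nonneg_left (hC x hx y hy) (Real.exp_pos _).le

theorem Rs_close {f g : E → ℝ} (hf : Continuous f) (hg : Continuous g) {M N ε : ℝ} (hM : ∀ x, |f x| ≤ M) (hN : ∀ x, |g x| ≤ N)
    (h : ∀ x, |f x - g x| ≤ ε) (x : E) :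
    |Rs 1 f x - Rs 1 g x| ≤ ε * r0 E 1 ∧ ‖Rs1 1 f x - Rs1 1 g x‖ ≤ ε * r1 E 1 := by
  have hM' : ∀ x, |f x| ≤ max M N := fun x => (hM x).trans (le_max_left _ _)
  have hN' : ∀ x, |g x| ≤ max M N := fun x => (hN x).trans (le_max_right _ _)
  rw [← Rs_sub one_pos hf hM' hg hN', ← Rs1_sub one_pos hf hM' hg hN']
  exact ⟨Rs_bound one_pos (hf.sub hg) h x, Rs1_bound one_pos (hf.sub hg) h x⟩

theorem unif_lim {W : Type*} [NormedAddCommGroup W] {U : Filter ℕ} [U.NeBot] {w : ℕ → E → W} {ω : E → W}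
    {α C R : ℝ} (hα : 0 < α) (hH : ∀ᶠ n in U, ∀ x ∈ Metric.closedBall (0:E) R, ∀ y ∈ Metric.closedBall (0:E) R,
      ‖w n x - w n y‖ ≤ C * ‖x - y‖ ^ α) (hlim : ∀ x, Tendsto (fun n => w n x) U (nhds (ω x))) :
    (∀ x ∈ Metric.closedBall (0:E) R, ∀ y ∈ Metric.closedBall (0:E) R, ‖ω x - ω y‖ ≤ C * ‖x - y‖ ^ α) ∧
    ∀ ε, 0 < ε → ∀ᶠ n in U, ∀ x ∈ Metric.closedBall (0:E) R, ‖w n x - ω x‖ ≤ ε := by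
  have h1 : ∀ x ∈ Metric.closedBall (0:E) R, ∀ y ∈ Metric.closedBall (0:E) R, ‖ω x - ω y‖ ≤ C * ‖x - y‖ ^ α := by
    intro x hx y hy
    refine le_of_tendsto ((hlim x).sub (hlim y)).norm ?_
    filter_upwards [hH] with n hn
    exact hn x hx y hy
  refine ⟨h1, fun ε hε => ?_⟩
  have hC1 : 0 < |C| + 1 := by positivity
  set δ : ℝ := (ε / 3 / (|C| + 1)) ^ (1/α) with hδ
  have hδ0 : 0 < δ := by positivity
  have hδ1 : (|C| + 1) * δ ^ α = ε / 3 := by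
    rw [hδ, ← Real.rpow_mul (by positivity), one_div, inv_mul_cancel₀ hα.ne', Real.rpow_one]
    field_simp
  have hsmall : ∀ x t : E, dist x t < δ → C * ‖x - t‖ ^ α ≤ ε / 3 := by
    intro x t h
    rw [dist_eq_norm] at h
    have h2 : ‖x - t‖ ^ α ≤ δ ^ α := Real.rpow_le_rpow (norm_nonneg _) h.le hα.le
    have h3 : 0 ≤ ‖x - t‖ ^ α := by positivity
    calc _ ≤ (|C| + 1) * ‖x - t‖ ^ α := by gcongr; linarith [le_abs_self C]
      _ ≤ (|C| + 1) * δ ^ α := by gcongr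
      _ = _ := hδ1
  obtain ⟨t, htK, htf, hcov⟩ := (isCompact_closedBall (0:E) R).finite_cover_balls hδ0
  have hev : ∀ᶠ n in U, ∀ y ∈ t, ‖w n y - ω y‖ < ε / 3 := by
    rw [eventually_all_finite htf]
    intro y _
    have := tendsto_iff_norm_sub_tendsto_zero.1 (hlim y)
    exact this.eventually (gt_mem_nhds (by positivity))
  filter_upwards [hH, hev] with n hn hn2 x hx
  obtain ⟨y, hy, hxy⟩ := mem_iUnion₂.1 (hcov hx)
  have a1 := hn x hx y (htK hy)
  have a2 := h1 y (htK hy) x hx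
  have a3 := hsmall x y hxy
  have a4 := hsmall y x (by rw [dist_comm]; exact hxy)
  have a5 := hn2 y hy
  have e : w n x - ω x = (w n x - w n y) + ((w n y - ω y) + (ω y - ω x)) := by abel
  rw [e]
  refine (norm_add_le _ _).trans ?_
  have := norm_add_le (w n y - ω y) (ω y - ω x)
  linarith

theorem cutf_sub (χ v h v' h' : E → ℝ) (p p' : E → E →L[ℝ] ℝ) (x : E) :
    cutf χ v h p x - cutf χ v' h' p' x = cutf χ (fun x => v x - v' x) (fun x => h x - h' x) (fun x => p x - p' x) x := by
  unfold cutf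
  simp only [sub_apply, mul_sub, Finset.sum_sub_distrib]
  ring

theorem limit_thm {α : ℝ} (hα0 : 0 < α) (hα1 : α < 1) {a c : E → ℝ} (ha : LH α a) (hc : LH α c)
    (v : ℕ → E → ℝ) (hv : ∀ n, ContDiff ℝ 2 (v n)) (hLH : ∀ n, LH α (fun x => btr (hs (v n) x)))
    (hb : ∀ R, ∃ C, ∀ᶠ n : ℕ in atTop, ∀ x ∈ Metric.closedBall (0:E) R, |v n x| ≤ C ∧ ‖fderiv ℝ (v n) x‖ ≤ C ∧
      |btr (hs (v n) x) - ((1 - c x) * ‖fderiv ℝ (v n) x‖ ^ 2 + a x * Real.exp (v n x))| ≤ C / (n + 1)) :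
    ∃ V : E → ℝ, ContDiff ℝ 2 V ∧ LH α (fun x => btr (hs V x)) ∧
      (∀ x, btr (hs V x) = (1 - c x) * ‖fderiv ℝ V x‖ ^ 2 + a x * Real.exp (V x)) ∧
      ∃ U : Filter ℕ, U.NeBot ∧ U ≤ atTop ∧ ∀ x, Tendsto (fun n => v n x) U (nhds (V x)) := by
  have hac := ha.continuous hα0
  have hcc := hc.continuous hα0
  let U : Ultrafilter ℕ := hyperfilter ℕ
  have hU : (U : Filter ℕ) ≤ atTop := by
    rw [← Nat.cofinite_eq_atTop]; exact hyperfilter_le_cofinite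
  -- uniform bounds
  have hbd : ∀ R, ∃ A, 0 ≤ A ∧ ∀ᶠ n : ℕ in (U : Filter ℕ), ∀ x ∈ Metric.closedBall (0:E) R, |v n x| ≤ A ∧ |btr (hs (v n) x)| ≤ A ∧ ‖fderiv ℝ (v n) x‖ ≤ A := by
    intro R
    obtain ⟨C, hC⟩ := hb R
    obtain ⟨A1, hA1, h1⟩ := cont_bdd hac R
    obtain ⟨A2, hA2, h2⟩ := cont_bdd (continuous_const.sub hcc : Continuous fun x => 1 - c x) R
    refine ⟨|C| + (A2 * |C| ^ 2 + A1 * Real.exp |C|), by positivity, ?_⟩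
    filter_upwards [hC.filter_mono hU] with n hn x hx
    obtain ⟨k1, k2, k3⟩ := hn x hx
    have hC0 := le_abs_self C
    have hp : 0 ≤ A2 * |C| ^ 2 + A1 * Real.exp |C| := by positivity
    refine ⟨by linarith, ?_, by linarith⟩
    have k4 : C / (n + 1) ≤ |C| := by
      rw [div_le_iff₀ (by positivity)]
      have : (0:ℝ) ≤ n := Nat.cast_nonneg n
      nlinarith [abs_nonneg C]
    have k5 : |(1 - c x) * ‖fderiv ℝ (v n) x‖ ^ 2| ≤ A2 * |C| ^ 2 := by
      rw [abs_mul]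
      refine mul_le_mul (h2 x hx) ?_ (abs_nonneg _) hA2
      rw [abs_of_nonneg (by positivity)]
      exact pow_le_pow_left₀ (norm_nonneg _) (k2.trans hC0) 2
    have k6 : |a x * Real.exp (v n x)| ≤ A1 * Real.exp |C| := by
      rw [abs_mul]
      refine mul_le_mul (h1 x hx) ?_ (abs_nonneg _) hA1
      rw [abs_of_pos (Real.exp_pos _)]
      exact Real.exp_le_exp.2 ((le_abs_self _).trans (k1.trans hC0))
    rw [abs_le] at *
    constructor <;> linarith
  -- Hölder bounds
  have hgr : ∀ R, ∃ C, ∀ᶠ n in (U : Filter ℕ), ∀ x ∈ Metric.closedBall (0:E) R, ∀ y ∈ Metric.closedBall (0:E) R,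
      ‖fderiv ℝ (v n) x - fderiv ℝ (v n) y‖ ≤ C * ‖x - y‖ ^ α := by
    intro R
    obtain ⟨A, hA0, hA⟩ := hbd (|R| + 1 + 2)
    obtain ⟨C, hC0, hC⟩ := grad_holder_unif (E := E) hα0 hα1 (R := |R| + 1) (by positivity) hA0
    refine ⟨C, ?_⟩
    filter_upwards [hA] with n hn x hx y hy
    have hsub : Metric.closedBall (0:E) R ⊆ Metric.closedBall (0:E) (|R| + 1) :=
      Metric.closedBall_subset_closedBall (by linarith [le_abs_self R])
    exact hC (v n) (hv n) (hLH n) hn x (hsub hx) y (hsub hy)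
  have hvl : ∀ R, ∃ C, ∀ᶠ n in (U : Filter ℕ), ∀ x ∈ Metric.closedBall (0:E) R, ∀ y ∈ Metric.closedBall (0:E) R,
      ‖v n x - v n y‖ ≤ C * ‖x - y‖ ^ (1:ℝ) := by
    intro R
    obtain ⟨A, hA0, hA⟩ := hbd R
    refine ⟨A, ?_⟩
    filter_upwards [hA] with n hn x hx y hy
    rw [Real.rpow_one]
    exact Convex.norm_image_sub_le_of_norm_fderiv_le (fun x _ => ((hv n).differentiable (by norm_num)) x) (fun x hx => (hn x hx).2.2)
      (convex_closedBall _ _) hy hx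
  -- pointwise limits
  have hlimV : ∀ x, ∃ s, Tendsto (fun n => v n x) U (nhds s) := by
    intro x
    obtain ⟨A, hA0, hA⟩ := hbd ‖x‖
    have := (isCompact_closedBall (0:ℝ) A).ultrafilter_le_nhds (U.map fun n => v n x) (by
      rw [Ultrafilter.coe_map, le_principal_iff, mem_map]
      filter_upwards [hA] with n hn
      simpa using (hn x (by simp)).1)
    obtain ⟨s, -, hs⟩ := this
    exact ⟨s, hs⟩
  have hlimP : ∀ x, ∃ s, Tendsto (fun n => fderiv ℝ (v n) x) U (nhds s) := by
    intro x
    obtain ⟨A, hA0, hA⟩ := hbd ‖x‖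
    have := (isCompact_closedBall (0:E →L[ℝ] ℝ) A).ultrafilter_le_nhds (U.map fun n => fderiv ℝ (v n) x) (by
      rw [Ultrafilter.coe_map, le_principal_iff, mem_map]
      filter_upwards [hA] with n hn
      simpa using (hn x (by simp)).2.2)
    obtain ⟨s, -, hs⟩ := this
    exact ⟨s, hs⟩
  choose V hV using hlimV
  choose P hP using hlimP
  have hPL : LH α P := fun R => by
    obtain ⟨C, hC⟩ := hgr R
    exact ⟨C, (unif_lim hα0 hC hP).1⟩
  have hVlip : ∀ R, ∃ C, ∀ x ∈ Metric.closedBall (0:E) R, ∀ y ∈ Metric.closedBall (0:E) R, ‖V x - V y‖ ≤ C * ‖x - y‖ ^ (1:ℝ) := fun R => by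
    obtain ⟨C, hC⟩ := hvl R
    exact ⟨C, (unif_lim one_pos hC hV).1⟩
  have hVL : LH α V := by
    intro R
    obtain ⟨C, hC⟩ := hVlip R
    refine ⟨|C| * (2 * |R|) ^ (1 - α), fun x hx y hy => (hC x hx y hy).trans ?_⟩
    rw [mem_closedBall_zero_iff] at hx hy
    have hn : ‖x - y‖ ≤ 2 * |R| := (norm_sub_le _ _).trans (by linarith [le_abs_self R])
    have e : ‖x - y‖ ^ (1:ℝ) = ‖x - y‖ ^ (1 - α) * ‖x - y‖ ^ α := by
      rw [← Real.rpow_add_of_nonneg (norm_nonneg _) (by linarith) hα0.le]; ring_nf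
    rw [e, ← mul_assoc]
    have : ‖x - y‖ ^ (1 - α) ≤ (2 * |R|) ^ (1 - α) := Real.rpow_le_rpow (norm_nonneg _) hn (by linarith)
    have := le_abs_self C
    gcongr
  set h : E → ℝ := fun x => (1 - c x) * (‖P x‖ * ‖P x‖) + a x * Real.exp (V x) with hh
  have hhL : LH α h := (((LH.const 1).sub hc).mul hα0 (hPL.norm.mul hα0 hPL.norm)).add (ha.mul hα0 (hVL.exp hα0))
  -- uniform convergence
  have hunif : ∀ R ε, 0 < ε → ∀ᶠ n in (U : Filter ℕ), ∀ x ∈ Metric.closedBall (0:E) R,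
      |v n x - V x| ≤ ε ∧ |btr (hs (v n) x) - h x| ≤ ε ∧ ‖fderiv ℝ (v n) x - P x‖ ≤ ε := by
    intro R ε hε
    obtain ⟨A, hA0, hA⟩ := hbd R
    obtain ⟨C, hC⟩ := hb R
    obtain ⟨A1, hA1, h1⟩ := cont_bdd hac R
    obtain ⟨A2, hA2, h2⟩ := cont_bdd (continuous_const.sub hcc : Continuous fun x => 1 - c x) R
    obtain ⟨C1, hC1⟩ := hgr R
    obtain ⟨C2, hC2⟩ := hvl R
    set K := 1 + A2 * (2 * A) + A1 * Real.exp A with hK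
    have hK1 : 1 ≤ K := by
      have : 0 ≤ A2 * (2 * A) + A1 * Real.exp A := by positivity
      linarith
    have hεK : 0 < ε / K := by positivity
    have hεK' : ε / K ≤ ε := div_le_self hε.le hK1
    have hsm : Tendsto (fun n : ℕ => C / ((n:ℝ) + 1)) atTop (nhds 0) := by
      have := (tendsto_one_div_add_atTop_nhds_zero_nat (𝕜 := ℝ)).const_mul C
      rw [mul_zero] at this
      exact this.congr fun n => by ring
    have hsm' : ∀ᶠ n : ℕ in (U : Filter ℕ), C / ((n:ℝ) + 1) ≤ ε / K := (hsm.eventually (ge_mem_nhds hεK)).filter_mono hU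
    filter_upwards [hA, hC.filter_mono hU, (unif_lim hα0 hC1 hP).2 _ hεK, (unif_lim one_pos hC2 hV).2 _ hεK, hsm'] with n n1 n2 n3 n4 n5 x hx
    have k3 := n3 x hx
    have k4 := n4 x hx
    obtain ⟨m1, m2, m3⟩ := n1 x hx
    obtain ⟨-, -, m4⟩ := n2 x hx
    have hVA : V x ≤ A := le_of_tendsto (hV x) (by
      filter_upwards [hA] with n hn
      exact (le_abs_self _).trans (hn x hx).1)
    have hPA : ‖P x‖ ≤ A := le_of_tendsto (hP x).norm (by
      filter_upwards [hA] with n hn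
      exact (hn x hx).2.2)
    refine ⟨k4.trans hεK', ?_, k3.trans hεK'⟩
    have q1 : |(1 - c x) * ‖fderiv ℝ (v n) x‖ ^ 2 - (1 - c x) * (‖P x‖ * ‖P x‖)| ≤ A2 * (2 * A) * (ε / K) := by
      rw [← mul_sub, abs_mul, mul_assoc A2]
      refine mul_le_mul (h2 x hx) ?_ (abs_nonneg _) hA2
      have e : ‖fderiv ℝ (v n) x‖ ^ 2 - ‖P x‖ * ‖P x‖ = (‖fderiv ℝ (v n) x‖ + ‖P x‖) * (‖fderiv ℝ (v n) x‖ - ‖P x‖) := by ring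
      rw [e, abs_mul, abs_of_nonneg (by positivity)]
      exact mul_le_mul (by linarith) ((abs_norm_sub_norm_le _ _).trans k3) (abs_nonneg _) (by positivity)
    have q2 : |a x * Real.exp (v n x) - a x * Real.exp (V x)| ≤ A1 * Real.exp A * (ε / K) := by
      rw [← mul_sub, abs_mul, mul_assoc A1]
      refine mul_le_mul (h1 x hx) ?_ (abs_nonneg _) hA1
      refine (exp_lip ((le_abs_self _).trans m1) hVA).trans ?_
      exact mul_le_mul_of_nonneg_left k4 (Real.exp_pos _).le
    have q3 : K * (ε / K) = ε := by field_simp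
    rw [hK] at q3
    rw [hh]
    simp only
    have q4 := m4.trans n5
    rw [abs_le] at *
    constructor <;> nlinarith
  -- regularity
  have hreg : ∀ x0, ContDiffAt ℝ 2 V x0 ∧ fderiv ℝ V x0 = P x0 ∧ btr (hs V x0) = h x0 := by
    intro x0
    obtain ⟨χ, hχ, -, -, hχ1, hχ0⟩ := exists_cutoff E (R := ‖x0‖ + 1) (by positivity)
    obtain ⟨B, hB0, hB⟩ := cutf_bound χ hχ hχ0
    set f := cutf χ V h P with hf
    have hfL : LH α f := cutf_LH hα0 hα1 hχ hVL hhL hPL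
    obtain ⟨M, H, hM, hH⟩ := hfL.compact hα0 (fun x hx => cutf_supp hχ0 _ _ _ x hx)
    have hfc := hfL.continuous hα0
    have hconv : ∀ ε, 0 < ε → ∀ᶠ n in (U : Filter ℕ), ∀ x,
        |χ x * v n x - Rs 1 f x| ≤ B * ε * r0 E 1 ∧
        ‖fderiv ℝ (fun x => χ x * v n x) x - Rs1 1 f x‖ ≤ B * ε * r1 E 1 := by
      intro ε hε
      filter_upwards [hunif (‖x0‖ + 1 + 1) ε hε] with n hn x
      have hL := cutf_LH hα0 hα1 hχ (LH.of_C1 hα0 hα1 ((hv n).of_le (by norm_num))) (hLH n) (LH.of_C1 hα0 hα1 (C1_fderiv (hv n)))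
      obtain ⟨M', H', hM', hH'⟩ := hL.compact hα0 (fun x hx => cutf_supp hχ0 _ _ _ x hx)
      have hrep := cut_repr hα0 hα1 hχ hχ0 (hv n) (hLH n)
      have hd : ∀ x, |cutf χ (v n) (fun x => btr (hs (v n) x)) (fderiv ℝ (v n)) x - f x| ≤ B * ε := by
        intro x
        rw [hf, cutf_sub]
        exact hB _ _ _ ε hε.le hn x
      have := Rs_close (hL.continuous hα0) hfc hM' hM hd x
      have e1 := congrFun hrep x
      rw [hrep, (Rs_hasFDerivAt one_pos (hL.continuous hα0) hM' x).fderiv]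
      rw [e1]
      exact this
    have t0 : ∀ x, Tendsto (fun n => χ x * v n x) U (nhds (Rs 1 f x)) := by
      intro x
      rw [Metric.tendsto_nhds]
      intro ε hε
      have hr := r0_nonneg (E := E) 1
      filter_upwards [hconv (ε / (B * r0 E 1 + 1)) (by positivity)] with n hn
      rw [Real.dist_eq]
      refine (hn x).1.trans_lt ?_
      have : B * (ε / (B * r0 E 1 + 1)) * r0 E 1 = ε * ((B * r0 E 1) / (B * r0 E 1 + 1)) := by ring
      rw [this]
      have h3 : 0 ≤ B * r0 E 1 := by positivity
      have : (B * r0 E 1) / (B * r0 E 1 + 1) < 1 := by rw [div_lt_one (by positivity)]; linarith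
      nlinarith
    have t1 : ∀ x, Tendsto (fun n => fderiv ℝ (fun x => χ x * v n x) x) U (nhds (Rs1 1 f x)) := by
      intro x
      rw [Metric.tendsto_nhds]
      intro ε hε
      have hr := r1_nonneg (E := E) 1
      filter_upwards [hconv (ε / (B * r1 E 1 + 1)) (by positivity)] with n hn
      rw [dist_eq_norm]
      refine (hn x).2.trans_lt ?_
      have : B * (ε / (B * r1 E 1 + 1)) * r1 E 1 = ε * ((B * r1 E 1) / (B * r1 E 1 + 1)) := by ring
      rw [this]
      have h3 : 0 ≤ B * r1 E 1 := by positivity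
      have : (B * r1 E 1) / (B * r1 E 1 + 1) < 1 := by rw [div_lt_one (by positivity)]; linarith
      nlinarith
    have hχV : (fun x => χ x * V x) = Rs 1 f := by
      ext x
      exact tendsto_nhds_unique ((hV x).const_mul (χ x)) (t0 x)
    have hC2 := Rs_contDiff one_pos hfc hM hα0 hα1 hH
    have hloc := loc_eq (v := V) hχ1 x0 (by linarith)
    rw [hχV] at hloc
    have hDV : fderiv ℝ V x0 = P x0 := by
      rw [← hloc.fderiv_eq, (Rs_hasFDerivAt one_pos hfc hM x0).fderiv]
      refine tendsto_nhds_unique (t1 x0) ((hP x0).congr fun n => ?_)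
      rw [(loc_eq (v := v n) hχ1 x0 (by linarith)).fderiv_eq]
    refine ⟨hC2.contDiffAt.congr_of_eventuallyEq hloc.symm, hDV, ?_⟩
    have heq := Rs_eq one_pos hfc hM hα0 hα1 hH x0
    rw [hs_congr hloc, ← congrFun hχV x0] at heq
    have hχloc : χ =ᶠ[nhds x0] fun _ => 1 := by
      filter_upwards [(isOpen_lt continuous_norm continuous_const).mem_nhds (show ‖x0‖ < ‖x0‖ + 1 by linarith)] with z hz
      exact hχ1 z (le_of_lt hz)
    have z1 : fderiv ℝ χ x0 = 0 := by rw [hχloc.fderiv_eq]; simp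
    have z2 : hs χ x0 = 0 := by
      rw [hs_congr hχloc]; unfold hs
      simp
    rw [hf] at heq
    unfold cutf at heq
    rw [z1, z2, hχ1 x0 (by linarith)] at heq
    simp [btr] at heq
    unfold btr; linarith
  have hP' : fderiv ℝ V = P := funext fun x => (hreg x).2.1
  refine ⟨V, contDiff_iff_contDiffAt.2 fun x => (hreg x).1, ?_, ?_, U, inferInstance, hU, hV⟩
  · rw [show (fun x => btr (hs V x)) = h from funext fun x => (hreg x).2.2]
    exact hhL
  · intro x
    rw [(hreg x).2.2, hP', hh]
    ring
end PartK

set_option linter.unusedSectionVars false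
set_option maxSynthPendingDepth 6

section PartL
variable {E : Type*} [NormedAddCommGroup E] [InnerProductSpace ℝ E] [FiniteDimensional ℝ E]
variable [MeasurableSpace E] [BorelSpace E]

theorem fderiv_comp1 {f : ℝ → ℝ} {d : ℝ} {z : E → ℝ} {x : E} (hz : DifferentiableAt ℝ z x)
    (hf : HasDerivAt f d (z x)) : fderiv ℝ (fun y => f (z y)) x = d • fderiv ℝ z x :=
  (hf.comp_hasFDerivAt x hz.hasFDerivAt).fderiv

theorem hs_comp {f f1 : ℝ → ℝ} {d : ℝ} {z : E → ℝ} {x : E} (hz : ContDiffAt ℝ 2 z x)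
    (hf : ∀ᶠ y in nhds x, HasDerivAt f (f1 (z y)) (z y)) (hf1 : HasDerivAt f1 d (z x)) :
    hs (fun y => f (z y)) x
      = f1 (z x) • hs z x + d • (fderiv ℝ z x).smulRight (fderiv ℝ z x) := by
  have h1 : fderiv ℝ (fun y => f (z y)) =ᶠ[nhds x] fun y => f1 (z y) • fderiv ℝ z y := by
    filter_upwards [diff_ev hz, hf] with y h1 h2 using fderiv_comp1 h1 h2
  have h2 : HasFDerivAt (fun y => f1 (z y)) (d • fderiv ℝ z x) x :=
    hf1.comp_hasFDerivAt x (hz.differentiableAt (by simp)).hasFDerivAt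
  have h3 : HasFDerivAt (fun y => f1 (z y) • fderiv ℝ z y)
      (f1 (z x) • hs z x + (d • fderiv ℝ z x).smulRight (fderiv ℝ z x)) x :=
    h2.smul (fderiv_diff hz).hasFDerivAt
  rw [hs, h1.fderiv_eq, h3.fderiv]
  ext u w
  simp [mul_assoc]

theorem btr_hs_comp {f f1 : ℝ → ℝ} {d : ℝ} {z : E → ℝ} {x : E} (hz : ContDiffAt ℝ 2 z x)
    (hf : ∀ᶠ y in nhds x, HasDerivAt f (f1 (z y)) (z y)) (hf1 : HasDerivAt f1 d (z x)) :
    btr (hs (fun y => f (z y)) x)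
      = f1 (z x) * btr (hs z x) + d * ‖fderiv ℝ z x‖ ^ 2 := by
  rw [hs_comp hz hf hf1, btr_add, btr_smul, btr_smul, btr_smulRight, sum_sq_eq_norm_sq]

theorem hs_add' {v w : E → ℝ} {x : E} (hv : ContDiffAt ℝ 2 v x) (hw : ContDiffAt ℝ 2 w x) :
    hs (fun y => v y + w y) x = hs v x + hs w x := by
  have : fderiv ℝ (fun y => v y + w y) =ᶠ[nhds x] fun y => fderiv ℝ v y + fderiv ℝ w y := by
    filter_upwards [diff_ev hv, diff_ev hw] with y h1 h2 using fderiv_fun_add h1 h2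
  rw [hs, this.fderiv_eq, fderiv_fun_add (fderiv_diff hv) (fderiv_diff hw)]; rfl

/-- derivative data of `2 log q`. -/
theorem log_q {R : ℝ} {x : E} (hx : ‖x‖ < R) :
    ContDiffAt ℝ 2 (fun y : E => 2 * Real.log (R ^ 2 + (-1) * ‖y‖ ^ 2)) x ∧
    fderiv ℝ (fun y : E => 2 * Real.log (R ^ 2 + (-1) * ‖y‖ ^ 2)) x
      = (- (4 / (R ^ 2 - ‖x‖ ^ 2))) • ip x ∧
    btr (hs (fun y : E => 2 * Real.log (R ^ 2 + (-1) * ‖y‖ ^ 2)) x)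
      = - (4 * Module.finrank ℝ E / (R ^ 2 - ‖x‖ ^ 2)) - 8 * ‖x‖ ^ 2 / (R ^ 2 - ‖x‖ ^ 2) ^ 2 := by
  have hq : 0 < R ^ 2 - ‖x‖ ^ 2 := by nlinarith [norm_nonneg x]
  have hq' : 0 < R ^ 2 + (-1) * ‖x‖ ^ 2 := by linarith
  set z : E → ℝ := fun y => (-1) * ‖y‖ ^ 2 with hzd
  have hz : ContDiff ℝ 2 z := contDiff_const_mul_normsq (-1)
  have hzx : z x = -‖x‖ ^ 2 := by rw [hzd]; ring
  have hd1 : ∀ t : ℝ, R ^ 2 + t ≠ 0 → HasDerivAt (fun t => 2 * Real.log (R ^ 2 + t)) (2 / (R ^ 2 + t)) t := by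
    intro t ht
    exact ((((hasDerivAt_id t).const_add (R ^ 2)).log ht).const_mul 2).congr_deriv (by simp; ring)
  have hd2 : ∀ t : ℝ, R ^ 2 + t ≠ 0 → HasDerivAt (fun t => 2 / (R ^ 2 + t)) (- (2 / (R ^ 2 + t) ^ 2)) t := by
    intro t ht
    exact ((hasDerivAt_const t (2:ℝ)).div ((hasDerivAt_id t).const_add (R ^ 2)) ht).congr_deriv (by simp; ring)
  have hev : ∀ᶠ y in nhds x, HasDerivAt (fun t => 2 * Real.log (R ^ 2 + t)) (2 / (R ^ 2 + z y)) (z y) := by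
    have hc : Continuous fun y => R ^ 2 + z y := by
      have := hz.continuous
      fun_prop
    filter_upwards [hc.continuousAt.eventually_ne hq'.ne'] with y hy
    exact hd1 _ hy
  have e1 : fderiv ℝ z x = (2 * (-1:ℝ)) • ip x := fderiv_eps (-1) x
  have e2 : hs z x = (2 * (-1:ℝ)) • ip := hs_eps (-1) x
  have hqq : R ^ 2 + z x = R ^ 2 - ‖x‖ ^ 2 := by rw [hzx]; ring
  refine ⟨?_, ?_, ?_⟩
  · exact contDiffAt_const.mul ((contDiffAt_const.add hz.contDiffAt).log hq'.ne')
  · rw [fderiv_comp1 (z := z) (hz.differentiable (by simp) x) (hd1 (z x) hq'.ne'), e1, hqq, smul_smul]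
    congr 1; ring
  · rw [btr_hs_comp (z := z) (f := fun t => 2 * Real.log (R ^ 2 + t)) (f1 := fun t => 2 / (R ^ 2 + t)) hz.contDiffAt hev (hd2 (z x) hq'.ne'), e1, e2, btr_smul, btr_ip, hqq, norm_smul, norm_ip]
    norm_num
    ring

theorem upper_bound {R C0 a0 D0 : ℝ} (hR : 0 < R) (hC0 : 0 ≤ C0) (ha0 : 0 < a0) (hD0 : 0 ≤ D0) :
    ∃ C, 0 ≤ C ∧ ∀ v : E → ℝ, ContDiff ℝ 2 v →
      (∀ x ∈ Metric.closedBall (0:E) R,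
        a0 * Real.exp (v x) ≤ btr (hs v x) + C0 * ‖fderiv ℝ v x‖ ^ 2 + D0) →
      ∀ x ∈ Metric.closedBall (0:E) (R / 2), v x ≤ C := by
  set d : ℝ := ((Module.finrank ℝ E : ℕ) : ℝ) with hd
  have hd0 : 0 ≤ d := by rw [hd]; positivity
  set B : ℝ := (D0 * R ^ 4 + 16 * C0 * R ^ 2 + 4 * d * R ^ 2 + 8 * R ^ 2) / a0 with hB
  have hB0 : 0 ≤ B := by positivity
  refine ⟨B / (R ^ 2 / 2) ^ 2, by positivity, fun v hv hin => ?_⟩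
  set g : E → ℝ := fun x => Real.exp (v x) * (R ^ 2 - ‖x‖ ^ 2) ^ 2 with hg
  have hgc : Continuous g := by
    have := hv.continuous
    fun_prop
  obtain ⟨x0, hx0, hmax⟩ := (isCompact_closedBall (0:E) R).exists_isMaxOn ⟨0, by simp [hR.le]⟩ hgc.continuousOn
  have hkey : g x0 ≤ B := by
    rw [mem_closedBall_zero_iff] at hx0
    have hg0 : 0 < g 0 := by simp only [hg]; norm_num; positivity
    have hlt : ‖x0‖ < R := by
      refine lt_of_le_of_ne hx0 fun h => ?_
      have h1 : g x0 = 0 := by simp [hg, h]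
      have h2 : g 0 ≤ g x0 := hmax (by simp [hR.le])
      linarith
    have hq : 0 < R ^ 2 - ‖x0‖ ^ 2 := by nlinarith [norm_nonneg x0]
    obtain ⟨l1, l2, l3⟩ := log_q hlt
    have hlm : IsLocalMax (fun y => v y + 2 * Real.log (R ^ 2 + (-1) * ‖y‖ ^ 2)) x0 := by
      have hb : Metric.ball (0:E) R ∈ nhds x0 := Metric.isOpen_ball.mem_nhds (by simpa using hlt)
      filter_upwards [hb] with y hy
      have hy' : ‖y‖ < R := by simpa using hy
      have hqy : 0 < R ^ 2 - ‖y‖ ^ 2 := by nlinarith [norm_nonneg y]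
      have hle : g y ≤ g x0 := hmax (Metric.ball_subset_closedBall hy)
      have hlog := Real.log_le_log (by simp only [hg]; positivity) hle
      simp only [hg] at hlog
      rw [Real.log_mul (by positivity) (by positivity), Real.log_mul (by positivity) (by positivity), Real.log_exp, Real.log_exp, Real.log_pow, Real.log_pow] at hlog
      push_cast at hlog
      rw [show R ^ 2 + (-1) * ‖y‖ ^ 2 = R ^ 2 - ‖y‖ ^ 2 by ring, show R ^ 2 + (-1) * ‖x0‖ ^ 2 = R ^ 2 - ‖x0‖ ^ 2 by ring]
      exact hlog
    have h1 := btr_le_of_max (hv.contDiffAt.add l1) hlm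
    rw [hs_add' hv.contDiffAt l1, btr_add, l3] at h1
    have h2 := hlm.fderiv_eq_zero
    rw [fderiv_fun_add (hv.differentiable (by simp) x0) (l1.differentiableAt (by simp)), l2] at h2
    have h3 : fderiv ℝ v x0 = (4 / (R ^ 2 - ‖x0‖ ^ 2)) • ip x0 := by
      rw [neg_smul] at h2
      exact add_neg_eq_zero.1 h2
    have h4 : ‖fderiv ℝ v x0‖ = 4 / (R ^ 2 - ‖x0‖ ^ 2) * ‖x0‖ := by
      rw [h3, norm_smul, norm_ip, Real.norm_of_nonneg (by positivity)]
    have h5 := hin x0 (by simpa using hx0)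
    rw [h4] at h5
    rw [hB, le_div_iff₀ ha0]
    simp only [hg]
    set q := R ^ 2 - ‖x0‖ ^ 2 with hqd
    have hqR : q ≤ R ^ 2 := by nlinarith [sq_nonneg ‖x0‖]
    have hn : ‖x0‖ ^ 2 ≤ R ^ 2 := by nlinarith
    have h6 : a0 * Real.exp (v x0) ≤ 4 * d / q + 8 * ‖x0‖ ^ 2 / q ^ 2 + C0 * (4 / q * ‖x0‖) ^ 2 + D0 := by linarith
    have h7 := mul_le_mul_of_nonneg_right h6 (sq_nonneg q)
    have h8 : (4 * d / q + 8 * ‖x0‖ ^ 2 / q ^ 2 + C0 * (4 / q * ‖x0‖) ^ 2 + D0) * q ^ 2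
        = 4 * d * q + 8 * ‖x0‖ ^ 2 + 16 * C0 * ‖x0‖ ^ 2 + D0 * q ^ 2 := by
      field_simp; ring
    rw [h8] at h7
    have h9 : q ^ 2 ≤ R ^ 4 := by nlinarith
    have h10 := mul_le_mul_of_nonneg_left h9 hD0
    have h11 := mul_le_mul_of_nonneg_left hn hC0
    have h12 := mul_le_mul_of_nonneg_left hqR hd0
    nlinarith
  intro x hx
  have hxR : x ∈ Metric.closedBall (0:E) R := Metric.closedBall_subset_closedBall (by linarith) hx
  have h1 : g x ≤ B := (hmax hxR).trans hkey
  rw [mem_closedBall_zero_iff] at hx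
  have h2 : R ^ 2 / 2 ≤ R ^ 2 - ‖x‖ ^ 2 := by nlinarith [norm_nonneg x]
  have h3 : (R ^ 2 / 2) ^ 2 ≤ (R ^ 2 - ‖x‖ ^ 2) ^ 2 := by gcongr
  rw [le_div_iff₀ (by positivity)]
  have h4 := Real.add_one_le_exp (v x)
  have h5 : v x * (R ^ 2 / 2) ^ 2 ≤ Real.exp (v x) * (R ^ 2 / 2) ^ 2 := by gcongr; linarith
  have h6 : Real.exp (v x) * (R ^ 2 / 2) ^ 2 ≤ g x := mul_le_mul_of_nonneg_left h3 (Real.exp_pos _).le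
  linarith

end PartL

set_option linter.unusedSectionVars false
set_option maxSynthPendingDepth 6

section PartM
variable {E : Type*} [NormedAddCommGroup E] [InnerProductSpace ℝ E] [FiniteDimensional ℝ E]
variable [MeasurableSpace E] [BorelSpace E]

/-- The lower barrier. -/
theorem omega_props {w : E → ℝ} (hw : ContDiff ℝ 2 w) (hw0 : ∀ x, 0 < w x) {e : ℝ} (he : 0 < e) :
    ContDiff ℝ 2 (fun x => -Real.log (w x + e)) ∧
    ∀ x, btr (hs (fun x => -Real.log (w x + e)) x)
      = -(btr (hs w x)) / (w x + e) + ‖fderiv ℝ (fun x => -Real.log (w x + e)) x‖ ^ 2 := by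
  have hpos : ∀ x, w x + e ≠ 0 := fun x => by have := hw0 x; positivity
  refine ⟨((hw.add contDiff_const).log hpos).neg, fun x => ?_⟩
  have hd1 : ∀ t : ℝ, t + e ≠ 0 → HasDerivAt (fun t => -Real.log (t + e)) (-(1 / (t + e))) t := by
    intro t ht
    exact ((((hasDerivAt_id t).add_const e).log ht).neg).congr_deriv (by simp)
  have hd2 : ∀ t : ℝ, t + e ≠ 0 → HasDerivAt (fun t => -(1 / (t + e))) (1 / (t + e) ^ 2) t := by
    intro t ht
    exact (((hasDerivAt_const t (1:ℝ)).div ((hasDerivAt_id t).add_const e) ht).neg).congr_deriv (by simp; ring)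
  rw [btr_hs_comp (z := w) (f := fun t => -Real.log (t + e)) (f1 := fun t => -(1 / (t + e))) hw.contDiffAt
    (Eventually.of_forall fun y => hd1 _ (hpos y)) (hd2 _ (hpos x)),
    fderiv_comp1 (z := w) (f := fun t => -Real.log (t + e)) (hw.differentiable (by simp) x) (hd1 _ (hpos x)), norm_smul, mul_pow]
  simp
  ring

theorem min_sq_lip {k s t : ℝ} (hk : 0 ≤ k) (hs : 0 ≤ s) (ht : 0 ≤ t) :
    |(min s k) ^ 2 - (min t k) ^ 2| ≤ 2 * k * |s - t| := by
  have h1 : |min s k - min t k| ≤ |s - t| := by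
    have := abs_min_sub_min_le_max s k t k
    simpa using this
  rw [show (min s k) ^ 2 - (min t k) ^ 2 = (min s k + min t k) * (min s k - min t k) by ring, abs_mul,
    abs_of_nonneg (add_nonneg (le_min hs hk) (le_min ht hk))]
  exact mul_le_mul (by linarith [min_le_right s k, min_le_right t k]) h1 (abs_nonneg _) (by positivity)

theorem approx_one {α : ℝ} (hα0 : 0 < α) (hα1 : α < 1) {a c w : E → ℝ} (ha : LH α a) (hc : LH α c)
    (hap : ∀ x, 0 < a x) (hcp : ∀ x, 0 < c x) (hw : ContDiff ℝ 2 w) (hw0 : ∀ x, 0 < w x) {W : ℝ}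
    (hwW : ∀ x, w x ≤ W) (hwa : ∀ x, btr (hs w x) ≤ - a x) {k : ℝ} (hk : 0 < k) :
    ∃ v : E → ℝ, ContDiff ℝ 2 v ∧ LH α (fun x => btr (hs v x)) ∧ (∀ x, v x ≤ k) ∧
      (∀ x, -Real.log (w x + Real.exp (-k)) ≤ v x) ∧
      ∀ x, ‖x‖ ≤ k → btr (hs v x) = (1 / k ^ 2) * (v x - k) + (1 - c x) * (min ‖fderiv ℝ v x‖ k) ^ 2
        + a x * Real.exp (v x) := by
  obtain ⟨χ, hχ, hχ0, hχ1, hχR, hχs⟩ := exists_cutoff E (R := k) hk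
  have hχL : LH α χ := LH.of_C1 hα0 hα1 (hχ.of_le (by norm_num))
  set b : E → ℝ := fun x => χ x * (1 - c x) with hb
  set g : E → ℝ := fun x => χ x * a x with hg
  have hbL : LH α b := hχL.mul hα0 ((LH.const 1).sub hc)
  have hgL : LH α g := hχL.mul hα0 ha
  have hg0 : ∀ x, 0 ≤ g x := fun x => mul_nonneg (hχ0 x) (hap x).le
  have hga : ∀ x, g x ≤ a x := fun x => mul_le_of_le_one_left (hap x).le (hχ1 x)
  have hb1 : ∀ x, b x ≤ 1 := fun x => by
    have h1 := hχ0 x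
    have h2 := hχ1 x
    have h3 := hcp x
    simp only [hb]; nlinarith
  obtain ⟨Mb, Hb, hMb, hHb⟩ := hbL.compact hα0 (R := k + 1) (fun x hx => by simp [hb, hχs x hx.le])
  obtain ⟨Ma, Ha, hMa, hHa⟩ := hgL.compact hα0 (R := k + 1) (fun x hx => by simp [hg, hχs x hx.le])
  have hMb0 : 0 ≤ Mb := (abs_nonneg _).trans (hMb 0)
  have hMa0 : 0 ≤ Ma := (abs_nonneg _).trans (hMa 0)
  set lam : ℝ := 1 / k ^ 2 with hlam
  have hlam0 : 0 < lam := by positivity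
  set F : E → ℝ → (E →L[ℝ] ℝ) → ℝ := fun x s q =>
    b x * (min ‖q‖ k) ^ 2 + g x * Real.exp (min s k) - lam * k with hF
  have hbc := hbL.continuous hα0
  have hgc := hgL.continuous hα0
  have hFc : Continuous fun z : E × ℝ × (E →L[ℝ] ℝ) => F z.1 z.2.1 z.2.2 := by
    simp only [hF]
    fun_prop
  have hm2 : ∀ q : E →L[ℝ] ℝ, |(min ‖q‖ k) ^ 2| ≤ k ^ 2 := fun q => by
    rw [abs_of_nonneg (by positivity)]
    exact pow_le_pow_left₀ (le_min (norm_nonneg _) hk.le) (min_le_right _ _) 2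
  have hme : ∀ s : ℝ, |Real.exp (min s k)| ≤ Real.exp k := fun s => by
    rw [abs_of_pos (Real.exp_pos _)]
    exact Real.exp_le_exp.2 (min_le_right _ _)
  have hFK : ∀ x s p, |F x s p| ≤ Mb * k ^ 2 + Ma * Real.exp k + lam * k := by
    intro x s p
    simp only [hF]
    refine (abs_sub _ _).trans (add_le_add ((abs_add_le _ _).trans (add_le_add ?_ ?_)) ?_)
    · rw [abs_mul]; exact mul_le_mul (hMb x) (hm2 p) (abs_nonneg _) hMb0
    · rw [abs_mul]; exact mul_le_mul (hMa x) (hme s) (abs_nonneg _) hMa0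
    · rw [abs_of_pos (by positivity)]
  have hL : 0 ≤ Mb * (2 * k) + Ma * Real.exp k := by positivity
  have hlip : ∀ x s t p q, |F x s p - F x t q| ≤ (Mb * (2 * k) + Ma * Real.exp k) * (|s - t| + ‖p - q‖) := by
    intro x s t p q
    have e : F x s p - F x t q = b x * ((min ‖p‖ k) ^ 2 - (min ‖q‖ k) ^ 2)
        + g x * (Real.exp (min s k) - Real.exp (min t k)) := by simp only [hF]; ring
    rw [e]
    have h1 : |b x * ((min ‖p‖ k) ^ 2 - (min ‖q‖ k) ^ 2)| ≤ Mb * (2 * k * ‖p - q‖) := by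
      rw [abs_mul]
      refine mul_le_mul (hMb x) ((min_sq_lip hk.le (norm_nonneg _) (norm_nonneg _)).trans ?_) (abs_nonneg _) hMb0
      exact mul_le_mul_of_nonneg_left (abs_norm_sub_norm_le _ _) (by positivity)
    have h2 : |g x * (Real.exp (min s k) - Real.exp (min t k))| ≤ Ma * (Real.exp k * |s - t|) := by
      rw [abs_mul]
      refine mul_le_mul (hMa x) ((exp_lip (min_le_right _ _) (min_le_right _ _)).trans ?_) (abs_nonneg _) hMa0
      refine mul_le_mul_of_nonneg_left ?_ (Real.exp_pos _).le
      have := abs_min_sub_min_le_max s k t k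
      simpa using this
    refine (abs_add_le _ _).trans ((add_le_add h1 h2).trans ?_)
    have h3 : 0 ≤ Mb * (2 * k) * |s - t| := by positivity
    have h4 : 0 ≤ Ma * Real.exp k * ‖p - q‖ := by positivity
    nlinarith
  have hhol : ∀ x y s p, |F x s p - F y s p| ≤ (Hb * k ^ 2 + Ha * Real.exp k) * ‖x - y‖ ^ α := by
    intro x y s p
    have e : F x s p - F y s p = (b x - b y) * (min ‖p‖ k) ^ 2
        + (g x - g y) * Real.exp (min s k) := by simp only [hF]; ring
    rw [e]
    have h1 : |(b x - b y) * (min ‖p‖ k) ^ 2| ≤ Hb * ‖x - y‖ ^ α * k ^ 2 := by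
      rw [abs_mul]
      exact mul_le_mul (hHb x y) (hm2 p) (abs_nonneg _) ((abs_nonneg _).trans (hHb x y))
    have h2 : |(g x - g y) * Real.exp (min s k)| ≤ Ha * ‖x - y‖ ^ α * Real.exp k := by
      rw [abs_mul]
      exact mul_le_mul (hHa x y) (hme s) (abs_nonneg _) ((abs_nonneg _).trans (hHa x y))
    refine (abs_add_le _ _).trans ((add_le_add h1 h2).trans (le_of_eq (by ring)))
  have hmono : ∀ x s t q, s ≤ t → F x s q ≤ F x t q := by
    intro x s t q hst
    simp only [hF]
    have := mul_le_mul_of_nonneg_left (Real.exp_le_exp.2 (min_le_min_right k hst)) (hg0 x)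
    linarith
  obtain ⟨v, hv, ⟨A, hA⟩, heq⟩ := exists_sol hFc hFK hL hlip hα0 hα1 hhol hmono hlam0
  have hlip' : ∀ x s p q, |F x s p - F x s q| ≤ (Mb * (2 * k) + Ma * Real.exp k) * ‖p - q‖ := by
    intro x s p q
    simpa using hlip x s s p q
  have hvk : ∀ x, v x ≤ k := by
    intro x
    have hz : ∀ x : E, hs (fun _ : E => k) x = 0 := fun x => by
      have : fderiv ℝ (fun _ : E => k) = fun _ => 0 := by funext y; simp
      rw [hs, this]; simp
    have := comparison hL hmono hlip' hv (contDiff_const (c := k)) (M := max A k)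
      (fun x => (hA x).trans (le_max_left _ _)) (fun x => by rw [abs_of_pos hk]; exact le_max_right _ _) hlam0 le_rfl
      (fun x => by
        rw [heq x, hz]
        simp only [hF]
        have h1 : (0:ℝ) ≤ g x * Real.exp (min k k) := mul_nonneg (hg0 x) (Real.exp_pos _).le
        have h2 : btr (0 : E →L[ℝ] E →L[ℝ] ℝ) = 0 := by simp [btr]
        have h3 : min (0:ℝ) k = 0 := min_eq_left hk.le
        simp only [h2, fderiv_fun_const, Pi.zero_apply, norm_zero, h3]
        linarith) x
    simp at this
    linarith
  obtain ⟨hω, hωe⟩ := omega_props hw hw0 (Real.exp_pos (-k))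
  set ω : E → ℝ := fun x => -Real.log (w x + Real.exp (-k)) with hωd
  have hωk : ∀ x, ω x ≤ k := by
    intro x
    have := Real.log_le_log (Real.exp_pos (-k)) (show Real.exp (-k) ≤ w x + Real.exp (-k) by linarith [hw0 x])
    rw [Real.log_exp] at this
    simp only [hωd]; linarith
  have hωb : ∀ x, |ω x| ≤ max k |Real.log (W + Real.exp (-k))| := by
    intro x
    rw [abs_le]
    refine ⟨?_, (hωk x).trans (le_max_left _ _)⟩
    have := Real.log_le_log (by have := hw0 x; positivity) (show w x + Real.exp (-k) ≤ W + Real.exp (-k) by linarith [hwW x])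
    have h2 := le_abs_self (Real.log (W + Real.exp (-k)))
    have h3 := le_max_right k |Real.log (W + Real.exp (-k))|
    simp only [hωd]; linarith
  have hvω : ∀ x, ω x ≤ v x := by
    intro x
    have := comparison hL hmono hlip' hω hv (M := max A (max k |Real.log (W + Real.exp (-k))|))
      (fun x => (hωb x).trans (le_max_right _ _)) (fun x => (hA x).trans (le_max_left _ _)) hlam0 le_rfl
      (fun x => by
        rw [heq x, hωe x]
        simp only [hF]
        rw [min_eq_left (hωk x)]
        have hwp : 0 < w x + Real.exp (-k) := by have := hw0 x; positivity
        have h1 : Real.exp (ω x) = 1 / (w x + Real.exp (-k)) := by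
          simp only [hωd]; rw [Real.exp_neg, Real.exp_log hwp, one_div]
        have h2 : a x * Real.exp (ω x) ≤ -(btr (hs w x)) / (w x + Real.exp (-k)) := by
          rw [h1, mul_one_div]
          exact div_le_div_of_nonneg_right (by linarith [hwa x]) hwp.le
        have h3 : g x * Real.exp (ω x) ≤ a x * Real.exp (ω x) := mul_le_mul_of_nonneg_right (hga x) (Real.exp_pos _).le
        have h4 : b x * (min ‖fderiv ℝ ω x‖ k) ^ 2 ≤ ‖fderiv ℝ ω x‖ ^ 2 := by
          have h5 : (min ‖fderiv ℝ ω x‖ k) ^ 2 ≤ ‖fderiv ℝ ω x‖ ^ 2 :=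
            pow_le_pow_left₀ (le_min (norm_nonneg _) hk.le) (min_le_left _ _) 2
          have h6 := mul_le_mul_of_nonneg_right (hb1 x) (sq_nonneg (min ‖fderiv ℝ ω x‖ k))
          linarith
        have h7 := mul_le_mul_of_nonneg_left (hωk x) hlam0.le
        linarith) x
    simp at this
    linarith
  have hform : ∀ x, btr (hs v x) = lam * v x + (b x * ((min ‖fderiv ℝ v x‖ k) * (min ‖fderiv ℝ v x‖ k)) + g x * Real.exp (min (v x) k) - lam * k) := by
    intro x
    have := heq x
    simp only [hF] at this
    linarith
  have hvL : LH α v := LH.of_C1 hα0 hα1 (hv.of_le (by norm_num))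
  have hdL : LH α (fun x => min ‖fderiv ℝ v x‖ k) := (LH.of_C1 hα0 hα1 (C1_fderiv hv)).norm.min_const k
  refine ⟨v, hv, ?_, hvk, hvω, ?_⟩
  · rw [funext hform]
    exact ((LH.const lam).mul hα0 hvL).add (((hbL.mul hα0 (hdL.mul hα0 hdL)).add
      (hgL.mul hα0 ((hvL.min_const k).exp hα0))).sub (LH.const _))
  · intro x hx
    rw [hform x, min_eq_left (hvk x)]
    simp only [hb, hg, hχR x hx]
    ring

theorem approx {α : ℝ} (hα0 : 0 < α) (hα1 : α < 1) {a c w : E → ℝ} (ha : LH α a) (hc : LH α c)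
    (hap : ∀ x, 0 < a x) (hcp : ∀ x, 0 < c x) (hw : ContDiff ℝ 2 w) (hw0 : ∀ x, 0 < w x) {W : ℝ}
    (hwW : ∀ x, w x ≤ W) (hwa : ∀ x, btr (hs w x) ≤ - a x) :
    ∃ v : ℕ → E → ℝ, (∀ n, ContDiff ℝ 2 (v n)) ∧ (∀ n, LH α (fun x => btr (hs (v n) x))) ∧
      (∀ (n : ℕ) x, -Real.log (w x + Real.exp (-((n:ℝ) + 1))) ≤ v n x) ∧
      (∀ R, ∃ C, ∀ᶠ n : ℕ in atTop, ∀ x ∈ Metric.closedBall (0:E) R, |v n x| ≤ C ∧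
        ‖fderiv ℝ (v n) x‖ ≤ C ∧
        |btr (hs (v n) x) - ((1 - c x) * ‖fderiv ℝ (v n) x‖ ^ 2 + a x * Real.exp (v n x))| ≤ C / ((n:ℝ) + 1)) := by
  have hex := fun n : ℕ => approx_one hα0 hα1 ha hc hap hcp hw hw0 hwW hwa (k := (n:ℝ) + 1) (by positivity)
  choose v hv hvL hvk hvω hveq using hex
  refine ⟨v, hv, hvL, hvω, fun R' => ?_⟩
  set R := max R' 0 with hR
  have hR0 : 0 ≤ R := le_max_right _ _
  set D := |Real.log (W + 1)| with hD
  have hD0 : 0 ≤ D := abs_nonneg _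
  have hlow : ∀ n x, -D ≤ v n x := by
    intro n x
    refine le_trans ?_ (hvω n x)
    have h1 : Real.exp (-((n:ℝ) + 1)) ≤ 1 := Real.exp_le_one_iff.2 (by linarith [n.cast_nonneg (α := ℝ)])
    have := Real.log_le_log (by have := hw0 x; positivity) (show w x + Real.exp (-((n:ℝ) + 1)) ≤ W + 1 by linarith [hwW x])
    have h2 := le_abs_self (Real.log (W + 1))
    linarith
  have herr : ∀ (n : ℕ) x, |(1 / ((n:ℝ) + 1) ^ 2) * (v n x - ((n:ℝ) + 1))| ≤ (D + 1) / ((n:ℝ) + 1) := by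
    intro n x
    have hk : (1:ℝ) ≤ (n:ℝ) + 1 := by linarith [n.cast_nonneg (α := ℝ)]
    have hk0 : (0:ℝ) < (n:ℝ) + 1 := by linarith
    rw [abs_mul, abs_of_pos (by positivity), one_div_mul_eq_div, div_le_div_iff₀ (by positivity) hk0,
      abs_of_nonpos (by linarith [hvk n x])]
    have h1 := hlow n x
    have h2 : -(v n x - ((n:ℝ) + 1)) ≤ (D + 1) * ((n:ℝ) + 1) := by nlinarith
    calc -(v n x - ((n:ℝ) + 1)) * ((n:ℝ) + 1) ≤ ((D + 1) * ((n:ℝ) + 1)) * ((n:ℝ) + 1) := by gcongr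
      _ = _ := by ring
  have herr' : ∀ (n : ℕ) x, |(1 / ((n:ℝ) + 1) ^ 2) * (v n x - ((n:ℝ) + 1))| ≤ D + 1 := fun n x =>
    (herr n x).trans (div_le_self (by positivity) (by linarith [n.cast_nonneg (α := ℝ)]))
  have hac := ha.continuous hα0
  have hcc := hc.continuous hα0
  obtain ⟨A, hA0, hA⟩ := cont_bdd hac (2 * (R + 2))
  obtain ⟨C0, hC00, hC0⟩ := cont_bdd (show Continuous fun x => 1 - c x by fun_prop) (2 * (R + 2))
  obtain ⟨xm, hxm, hmin⟩ := (isCompact_closedBall (0:E) (2 * (R + 2))).exists_isMinOn ⟨0, by simp; linarith⟩ hac.continuousOn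
  obtain ⟨C, hC, hup⟩ := upper_bound (E := E) (R := 2 * (R + 2)) (C0 := C0) (a0 := a xm) (D0 := D + 1)
    (by positivity) hC00 (hap xm) (by positivity)
  set M := C + D + 1 with hM
  set K := C0 + A * Real.exp M + D + 1 with hK
  obtain ⟨G, hG0, hG⟩ := grad_bound (E := E) K M 1 (by positivity) (by positivity) one_pos
  have hmsq : ∀ (n : ℕ) x, (min ‖fderiv ℝ (v n) x‖ ((n:ℝ) + 1)) ^ 2 ≤ ‖fderiv ℝ (v n) x‖ ^ 2 := fun n x =>
    pow_le_pow_left₀ (le_min (norm_nonneg _) (by positivity)) (min_le_left _ _) 2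
  refine ⟨M + G, ?_⟩
  filter_upwards [eventually_ge_atTop ⌈max (2 * (R + 2)) G⌉₊] with n hn
  have hn' : max (2 * (R + 2)) G ≤ (n:ℝ) + 1 := by
    have := (Nat.le_ceil (max (2 * (R + 2)) G)).trans (Nat.cast_le.2 hn)
    linarith
  have hn1 : 2 * (R + 2) ≤ (n:ℝ) + 1 := (le_max_left _ _).trans hn'
  have hn2 : G ≤ (n:ℝ) + 1 := (le_max_right _ _).trans hn'
  have heqb : ∀ x ∈ Metric.closedBall (0:E) (2 * (R + 2)), _ := fun x hx =>
    hveq n x ((mem_closedBall_zero_iff.1 hx).trans hn1)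
  have hC0m : ∀ x ∈ Metric.closedBall (0:E) (2 * (R + 2)),
      |(1 - c x) * (min ‖fderiv ℝ (v n) x‖ ((n:ℝ) + 1)) ^ 2| ≤ C0 * ‖fderiv ℝ (v n) x‖ ^ 2 := by
    intro x hx
    rw [abs_mul, abs_of_nonneg (sq_nonneg (min ‖fderiv ℝ (v n) x‖ ((n:ℝ) + 1)))]
    exact mul_le_mul (hC0 x hx) (hmsq n x) (sq_nonneg _) hC00
  have hvC : ∀ x ∈ Metric.closedBall (0:E) (R + 2), |v n x| ≤ M := by
    intro x hx
    rw [abs_le]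
    refine ⟨by linarith [hlow n x], ?_⟩
    have := hup (v n) (hv n) (fun x hx => by
      have h1 := heqb x hx
      have h2 := (abs_le.1 (herr' n x)).1
      have h3 := (abs_le.1 (hC0m x hx)).1
      have h4 : a xm * Real.exp (v n x) ≤ a x * Real.exp (v n x) :=
        mul_le_mul_of_nonneg_right (hmin hx) (Real.exp_pos _).le
      linarith) x (by simpa using hx)
    linarith
  have hball : ∀ x ∈ Metric.closedBall (0:E) R', ∀ y ∈ Metric.closedBall x (2 * 1), y ∈ Metric.closedBall (0:E) (R + 2) := by
    intro x hx y hy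
    rw [mem_closedBall_zero_iff] at *
    rw [mem_closedBall_iff_norm] at hy
    have h1 := norm_sub_norm_le y x
    have h2 : R' ≤ R := le_max_left _ _
    linarith
  have hbig : Metric.closedBall (0:E) (R + 2) ⊆ Metric.closedBall (0:E) (2 * (R + 2)) :=
    Metric.closedBall_subset_closedBall (by linarith)
  intro x hx
  have hgr : ‖fderiv ℝ (v n) x‖ ≤ G := by
    refine hG (v n) x (hv n) (fun y hy => hvC y (hball x hx y hy)) fun y hy => ?_
    have hy2 := hball x hx y hy
    have hy3 := hbig hy2
    rw [heqb y hy3]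
    have h1 := herr' n y
    have h2 := hC0m y hy3
    have h3 : |a y * Real.exp (v n y)| ≤ A * Real.exp M := by
      rw [abs_mul, abs_of_pos (Real.exp_pos _)]
      exact mul_le_mul (hA y hy3) (Real.exp_le_exp.2 ((le_abs_self _).trans (hvC y hy2))) (Real.exp_pos _).le hA0
    have h4 : 0 ≤ ‖fderiv ℝ (v n) y‖ ^ 2 := sq_nonneg _
    have h5 : 0 ≤ (A * Real.exp M + D + 1) * ‖fderiv ℝ (v n) y‖ ^ 2 := by positivity
    refine (abs_add_le _ _).trans ((add_le_add (abs_add_le _ _) le_rfl).trans ?_)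
    nlinarith
  have hxx := hball x hx x (by simp)
  refine ⟨(hvC x hxx).trans (by linarith), hgr.trans (by linarith [show 0 ≤ M by positivity]), ?_⟩
  rw [heqb x (hbig hxx), min_eq_left (hgr.trans hn2)]
  have e : ∀ p q r : ℝ, p + q + r - (q + r) = p := fun p q r => by ring
  rw [e]
  exact (herr n x).trans (div_le_div_of_nonneg_right (by linarith) (by positivity))

end PartM

set_option linter.unusedSectionVars false
set_option maxSynthPendingDepth 6

section PartN

theorem radial_ode {ψ : ℝ → ℝ} (hc : Continuous ψ) (hpos : ∀ s, 0 < ψ s) (h1 : ∀ s ≤ 1, ψ s = ψ 0)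
    (hi : IntegrableOn ψ (Ioi 0)) :
    ∃ H H1 : ℝ → ℝ, Continuous H1 ∧ (∀ s, HasDerivAt H (H1 s) s) ∧ (∀ s, 0 < H s) ∧
      IntegrableOn H (Ioi 0) ∧ ∀ s, 4 * s * H1 s + 6 * H s = ψ s := by
  set q : ℝ → ℝ := fun σ => (max σ 1) ^ (1/2:ℝ) * (ψ σ - ψ 0) with hq
  have hqc : Continuous q := by
    refine Continuous.mul ?_ (by fun_prop)
    exact (continuous_id.max continuous_const).rpow_const (fun x => Or.inr (by norm_num))
  set Q : ℝ → ℝ := fun s => ∫ σ in (1:ℝ)..s, q σ with hQ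
  have hQd : ∀ s, HasDerivAt Q (q s) s := fun s => (hqc.integral_hasStrictDerivAt 1 s).hasDerivAt
  have hQ0 : ∀ s ≤ 1, Q s = 0 := by
    intro s hs
    simp only [hQ]
    rw [intervalIntegral.integral_congr (g := fun _ => 0)]
    · simp
    · intro σ hσ
      rw [uIcc_of_ge hs] at hσ
      simp [hq, h1 σ hσ.2]
  set H : ℝ → ℝ := fun s => ψ 0 / 6 + 1/4 * (s ^ (-(3/2):ℝ) * Q s) with hH
  set H1 : ℝ → ℝ := fun s => (ψ s - 6 * H s) / (4 * s) with hH1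
  have hHc : ∀ s ≤ 1, H s = ψ 0 / 6 := fun s hs => by simp [hH, hQ0 s hs]
  have hH1c : ∀ s ≤ 1, H1 s = 0 := fun s hs => by simp only [hH1]; rw [hHc s hs, h1 s hs, show ψ 0 - 6 * (ψ 0 / 6) = 0 by ring, zero_div]
  have hHd : ∀ s, HasDerivAt H (H1 s) s := by
    intro s
    rcases lt_or_ge s 1 with hs | hs
    · rw [hH1c s hs.le]
      refine (hasDerivAt_const s (ψ 0 / 6)).congr_of_eventuallyEq ?_
      filter_upwards [eventually_lt_nhds hs] with t ht using hHc t ht.le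
    · have hs0 : 0 < s := by linarith
      have e1 : HasDerivAt (fun s : ℝ => s ^ (-(3/2):ℝ)) (1 * (-(3/2):ℝ) * s ^ ((-(3/2):ℝ) - 1)) s :=
        (hasDerivAt_id s).rpow_const (Or.inl hs0.ne')
      have e2 := (((e1.mul (hQd s)).const_mul (1/4:ℝ)).const_add (ψ 0 / 6))
      refine e2.congr_deriv ?_
      simp only [hH1, hH, hq]
      rw [max_eq_left hs, Real.rpow_sub_one hs0.ne', Real.rpow_neg hs0.le]
      have e3 : s ^ (3/2:ℝ) = s * s ^ (1/2:ℝ) := by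
        rw [show (3/2:ℝ) = 1 + 1/2 by norm_num, Real.rpow_add hs0, Real.rpow_one]
      rw [e3]
      have e4 : 0 < s ^ (1/2:ℝ) := by positivity
      field_simp
      ring
  have hHcont : Continuous H := continuous_iff_continuousAt.2 fun s => (hHd s).continuousAt
  have hH1cont : Continuous H1 := by
    refine continuous_iff_continuousAt.2 fun s => ?_
    rcases lt_or_ge s 1 with hs | hs
    · refine (continuousAt_const (y := (0:ℝ))).congr ?_
      filter_upwards [eventually_lt_nhds hs] with t ht using (hH1c t ht.le).symm
    · have hs0 : 4 * s ≠ 0 := by positivity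
      exact ContinuousAt.div (by fun_prop) (by fun_prop) hs0
  have hode : ∀ s, 4 * s * H1 s + 6 * H s = ψ s := by
    intro s
    rcases le_or_gt s 1 with hs | hs
    · rw [hH1c s hs, hHc s hs, h1 s hs]; ring
    · have hs0 : 4 * s ≠ 0 := by positivity
      simp only [hH1]
      field_simp
      ring
  have hHpos : ∀ s, 0 < H s := by
    intro s
    rcases le_or_gt s 1 with hs | hs
    · rw [hHc s hs]; have := hpos 0; positivity
    · have hd : ∀ t : ℝ, 1 ≤ t → HasDerivAt (fun t => t ^ (3/2:ℝ) * H t) (t ^ (1/2:ℝ) * ψ t / 4) t := by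
        intro t ht
        have ht0 : 0 < t := by linarith
        have e1 : HasDerivAt (fun s : ℝ => s ^ (3/2:ℝ)) (1 * (3/2:ℝ) * t ^ ((3/2:ℝ) - 1)) t :=
          (hasDerivAt_id t).rpow_const (Or.inl ht0.ne')
        refine (e1.mul (hHd t)).congr_deriv ?_
        rw [← hode t]
        have e3 : t ^ (3/2:ℝ) = t * t ^ (1/2:ℝ) := by
          rw [show (3/2:ℝ) = 1 + 1/2 by norm_num, Real.rpow_add ht0, Real.rpow_one]
        rw [e3, show (3/2:ℝ) - 1 = 1/2 by norm_num]
        ring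
      have hm : MonotoneOn (fun t => t ^ (3/2:ℝ) * H t) (Ici 1) := by
        refine monotoneOn_of_deriv_nonneg (convex_Ici 1) (fun t ht => (hd t ht).continuousAt.continuousWithinAt)
          (fun t ht => ?_) (fun t ht => ?_)
        · rw [interior_Ici] at ht
          exact (hd t (le_of_lt ht)).differentiableAt.differentiableWithinAt
        · rw [interior_Ici] at ht
          have ht0 : (0:ℝ) < t := lt_trans one_pos ht
          rw [(hd t (le_of_lt ht)).deriv]
          have := hpos t
          positivity
      have h2 := hm (show (1:ℝ) ∈ Ici 1 by simp) (show s ∈ Ici 1 from hs.le) hs.le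
      simp only [Real.one_rpow, one_mul] at h2
      rw [hHc 1 le_rfl] at h2
      have h3 : 0 < s ^ (3/2:ℝ) * H s := lt_of_lt_of_le (by have := hpos 0; positivity) h2
      have hs0 : 0 < s := by linarith
      exact pos_of_mul_pos_right h3 (by positivity)
  refine ⟨H, H1, hH1cont, hHd, hHpos, ?_, hode⟩
  -- integrability
  refine integrableOn_Ioi_of_intervalIntegral_norm_bounded (l := atTop) (b := fun n : ℝ => n)
    ((∫ s in Ioi 0, ψ s) / 2) 0 (fun n => (hHcont.integrableOn_Icc).mono_set Ioc_subset_Icc_self) tendsto_id ?_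
  filter_upwards [eventually_ge_atTop (0:ℝ)] with S hS
  have e1 : ∫ s in (0:ℝ)..S, ‖H s‖ = ∫ s in (0:ℝ)..S, H s := by
    refine intervalIntegral.integral_congr fun s _ => ?_
    exact Real.norm_of_nonneg (hHpos s).le
  have e2 : ∫ s in (0:ℝ)..S, (H s + s * H1 s) = S * H S - 0 * H 0 := by
    refine intervalIntegral.integral_eq_sub_of_hasDerivAt (f := fun s => s * H s) (fun s _ => ?_) ?_
    · exact ((hasDerivAt_id s).mul (hHd s)).congr_deriv (by simp)
    · exact Continuous.intervalIntegrable (by fun_prop) _ _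
  have e3 : ∫ s in (0:ℝ)..S, (H s + s * H1 s) = ∫ s in (0:ℝ)..S, ((1/4) * ψ s - (1/2) * H s) := by
    refine intervalIntegral.integral_congr fun s _ => ?_
    have := hode s
    linarith
  rw [intervalIntegral.integral_sub (Continuous.intervalIntegrable (by fun_prop) _ _) (Continuous.intervalIntegrable (by fun_prop) _ _),
    intervalIntegral.integral_const_mul, intervalIntegral.integral_const_mul] at e3
  have e4 : ∫ s in (0:ℝ)..S, ψ s ≤ ∫ s in Ioi 0, ψ s := by
    rw [intervalIntegral.integral_of_le hS]
    exact setIntegral_mono_set hi (ae_of_all _ fun s => (hpos s).le) (LE.le.eventuallyLE Ioc_subset_Ioi_self)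
  have e5 : 0 ≤ S * H S := mul_nonneg hS (hHpos S).le
  rw [e1]
  linarith

theorem radial_J {H H1 : ℝ → ℝ} (hH1 : Continuous H1) (hHd : ∀ s, HasDerivAt H (H1 s) s) (hp : ∀ s, 0 < H s)
    (hi : IntegrableOn H (Ioi 0)) :
    ∃ J : ℝ → ℝ, ContDiff ℝ 2 J ∧ (∀ s, HasDerivAt J (- H s) s) ∧ (∀ s, 0 < J s) ∧
      (∀ s, 0 ≤ s → J s ≤ J 0) ∧ Tendsto J atTop (nhds 0) := by
  have hHc : Continuous H := continuous_iff_continuousAt.2 fun s => (hHd s).continuousAt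
  set J : ℝ → ℝ := fun t => (∫ s in Ioi 0, H s) - ∫ s in (0:ℝ)..t, H s with hJ
  have hd : ∀ s, HasDerivAt J (- H s) s := fun s => (hHc.integral_hasStrictDerivAt 0 s).hasDerivAt.const_sub _
  have ht : Tendsto J atTop (nhds 0) := by
    have := (intervalIntegral_tendsto_integral_Ioi 0 hi tendsto_id).const_sub (∫ s in Ioi 0, H s)
    simpa using this
  have hanti : StrictAnti J := strictAnti_of_deriv_neg fun s => by rw [(hd s).deriv]; linarith [hp s]
  refine ⟨J, ?_, hd, fun s => ?_, fun s hs => hanti.antitone hs, ht⟩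
  · have hdJ : deriv J = fun s => - H s := funext fun s => (hd s).deriv
    have hdH : deriv H = H1 := funext fun s => (hHd s).deriv
    rw [show (2 : WithTop ℕ∞) = 1 + 1 by norm_num, contDiff_succ_iff_deriv]
    refine ⟨fun s => (hd s).differentiableAt, by simp, ?_⟩
    rw [hdJ]
    refine ContDiff.neg (contDiff_one_iff_deriv.2 ⟨fun s => (hHd s).differentiableAt, ?_⟩)
    rw [hdH]; exact hH1
  · have h1 := hanti.antitone.le_of_tendsto ht (s + 1)
    have h2 := hanti (show s < s + 1 by linarith)
    linarith

variable {E : Type*} [NormedAddCommGroup E] [InnerProductSpace ℝ E] [FiniteDimensional ℝ E]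
variable [MeasurableSpace E] [BorelSpace E]

theorem radial_maj {a : E → ℝ} (hac : Continuous a) (hap : ∀ x, 0 < a x) {φ : ℝ → ℝ}
    (hφ : ∀ r : ℝ, 0 ≤ r → IsGreatest (a '' Metric.sphere (0 : E) r) (φ r))
    (hint : IntegrableOn (fun r : ℝ => r * φ r) (Ioi 0)) :
    ∃ ψ : ℝ → ℝ, Continuous ψ ∧ (∀ s, 0 < ψ s) ∧ (∀ s ≤ 1, ψ s = ψ 0) ∧ IntegrableOn ψ (Ioi 0) ∧
      ∀ x, a x ≤ ψ (‖x‖ ^ 2) := by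
  set f : ℝ → ℝ := fun r => sSup ((fun e : E => a (r • e)) '' Metric.sphere (0:E) 1) with hf
  have hfc : Continuous f := (isCompact_sphere (0:E) 1).continuous_sSup (f := fun (r : ℝ) (e : E) => a (r • e))
    (by
      show Continuous fun z : ℝ × E => a (z.1 • z.2)
      fun_prop)
  have hfφ : ∀ r, 0 < r → f r = φ r := by
    intro r hr
    rw [← (hφ r hr.le).csSup_eq]
    simp only [hf]
    congr 1
    ext y
    constructor
    · rintro ⟨e, he, rfl⟩
      refine ⟨r • e, ?_, rfl⟩
      rw [mem_sphere_zero_iff_norm] at he ⊢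
      rw [norm_smul, he, Real.norm_of_nonneg hr.le, mul_one]
    · rintro ⟨x, hx, rfl⟩
      refine ⟨r⁻¹ • x, ?_, ?_⟩
      · rw [mem_sphere_zero_iff_norm] at hx ⊢
        rw [norm_smul, hx, norm_inv, Real.norm_of_nonneg hr.le, inv_mul_cancel₀ hr.ne']
      · simp only
        rw [smul_smul, mul_inv_cancel₀ hr.ne', one_smul]
  have hφpos : ∀ r, 0 < r → 0 < f r := by
    intro r hr
    rw [hfφ r hr]
    obtain ⟨x, -, hx⟩ := (hφ r hr.le).1
    rw [← hx]; exact hap x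
  obtain ⟨K, hK0, hK⟩ := cont_bdd hac 1
  set g : ℝ → ℝ := fun s => K * max 0 (min 1 (2 - √s)) with hg
  have hgc : Continuous g := by
    simp only [hg]
    fun_prop
  have hg0 : ∀ s, 0 ≤ g s := fun s => mul_nonneg hK0 (le_max_left _ _)
  set ψ : ℝ → ℝ := fun s => f (max (√s) 1) + g s with hψ
  have hψc : Continuous ψ := by
    simp only [hψ]
    fun_prop
  refine ⟨ψ, hψc, fun s => ?_, fun s hs => ?_, ?_, fun x => ?_⟩
  · have := hφpos (max (√s) 1) (lt_max_of_lt_right one_pos)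
    have := hg0 s
    simp only [hψ]; linarith
  · have h1 : √s ≤ 1 := by rw [← Real.sqrt_one]; exact Real.sqrt_le_sqrt hs
    simp only [hψ, hg]
    rw [max_eq_right h1, min_eq_left (by linarith)]
    norm_num
  · rw [← Ioc_union_Ioi_eq_Ioi (show (0:ℝ) ≤ 5 by norm_num)]
    refine IntegrableOn.union (hψc.integrableOn_Icc.mono_set Ioc_subset_Icc_self) ?_
    have h1 : IntegrableOn (fun s => φ (√s)) (Ioi 0) := by
      rw [← integrableOn_Ioi_comp_rpow_iff' (fun s => φ (√s)) (p := 2) (by norm_num)]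
      refine hint.congr_fun (fun r hr => ?_) measurableSet_Ioi
      have hr' : (0:ℝ) < r := hr
      simp only
      rw [show (2:ℝ) - 1 = 1 by norm_num, Real.rpow_one, Real.rpow_two, Real.sqrt_sq hr'.le, smul_eq_mul]
    refine (h1.mono_set (Ioi_subset_Ioi (by norm_num))).congr_fun (fun s hs => ?_) measurableSet_Ioi
    have hs' : (5:ℝ) < s := hs
    have h2 : 2 ≤ √s := by
      rw [Real.le_sqrt (by norm_num) (by linarith)]; linarith
    simp only [hψ, hg]
    rw [max_eq_left (show 1 ≤ √s by linarith), hfφ _ (by linarith), min_eq_right (by linarith), max_eq_left (by linarith)]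
    ring
  · simp only [hψ]
    rw [Real.sqrt_sq (norm_nonneg x)]
    have h0 := hg0 (‖x‖ ^ 2)
    rcases le_or_gt ‖x‖ 1 with h | h
    · have h1 := hK x (by simpa using h)
      have h2 : g (‖x‖ ^ 2) = K := by
        simp only [hg]
        rw [Real.sqrt_sq (norm_nonneg x), min_eq_left (by linarith)]
        norm_num
      have := hφpos (max ‖x‖ 1) (lt_max_of_lt_right one_pos)
      have h3 := le_abs_self (a x)
      rw [Real.norm_eq_abs] at h1
      linarith
    · rw [max_eq_left h.le, hfφ _ (by linarith)]
      have := (hφ ‖x‖ (norm_nonneg x)).2 ⟨x, by simp, rfl⟩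
      linarith

theorem supersol {a : E → ℝ} (hac : Continuous a) (hap : ∀ x, 0 < a x) {φ : ℝ → ℝ}
    (hφ : ∀ r : ℝ, 0 ≤ r → IsGreatest (a '' Metric.sphere (0 : E) r) (φ r))
    (hint : IntegrableOn (fun r : ℝ => r * φ r) (Ioi 0)) (hdim : 3 ≤ Module.finrank ℝ E) :
    ∃ (w : E → ℝ) (W : ℝ), ContDiff ℝ 2 w ∧ (∀ x, 0 < w x) ∧ (∀ x, w x ≤ W) ∧
      (∀ x, btr (hs w x) ≤ - a x) ∧ Tendsto w (cocompact E) (nhds 0) := by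
  obtain ⟨ψ, hψc, hψp, hψ1, hψi, hψa⟩ := radial_maj hac hap hφ hint
  obtain ⟨H, H1, hH1, hHd, hHp, hHi, hode⟩ := radial_ode hψc hψp hψ1 hψi
  obtain ⟨J, hJ, hJd, hJp, hJ0, hJt⟩ := radial_J hH1 hHd hHp hHi
  have hz : ContDiff ℝ 2 (fun y : E => 1 * ‖y‖ ^ 2) := contDiff_const_mul_normsq 1
  refine ⟨fun x => J (1 * ‖x‖ ^ 2), J 0, hJ.comp hz, fun x => hJp _, fun x => hJ0 _ (by positivity), fun x => ?_, ?_⟩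
  · rw [btr_hs_comp (f := J) (f1 := fun s => - H s) (z := fun y : E => 1 * ‖y‖ ^ 2) hz.contDiffAt
      (Eventually.of_forall fun y => hJd _) (hHd _).neg, fderiv_eps, hs_eps, btr_smul, btr_ip, norm_smul, norm_ip]
    have h1 := hode (‖x‖ ^ 2)
    have h2 := hψa x
    have h3 : (3:ℝ) ≤ (Module.finrank ℝ E : ℝ) := by exact_mod_cast hdim
    have h4 := mul_le_mul_of_nonneg_left h3 (hHp (‖x‖ ^ 2)).le
    norm_num
    nlinarith
  · have h1 : Tendsto (fun x : E => 1 * ‖x‖ ^ 2) (cocompact E) atTop := by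
      have := (tendsto_pow_atTop (α := ℝ) (n := 2) (by norm_num)).comp (tendsto_norm_cocompact_atTop (E := E))
      simpa [Function.comp_def] using this
    exact hJt.comp h1

end PartN

set_option linter.unusedSectionVars false
set_option maxSynthPendingDepth 6

section PartO
variable {E : Type*} [NormedAddCommGroup E] [InnerProductSpace ℝ E] [FiniteDimensional ℝ E]
variable [MeasurableSpace E] [BorelSpace E]

theorem main_E {α : ℝ} (hα0 : 0 < α) (hα1 : α < 1) {a c : E → ℝ} (ha : LH α a) (hc : LH α c)
    (hap : ∀ x, 0 < a x) (hcp : ∀ x, 0 < c x) {φ : ℝ → ℝ}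
    (hφ : ∀ r : ℝ, 0 ≤ r → IsGreatest (a '' Metric.sphere (0 : E) r) (φ r))
    (hint : IntegrableOn (fun r : ℝ => r * φ r) (Ioi 0)) (hdim : 3 ≤ Module.finrank ℝ E) :
    ∃ u : E → ℝ, ContDiff ℝ 2 u ∧ LH α (hs u) ∧ (∀ x, 0 < u x) ∧ Tendsto u (cocompact E) (nhds 0) ∧
      ∀ x, - btr (hs u x) + c x * (u x)⁻¹ * ‖fderiv ℝ u x‖ ^ 2 = a x := by
  obtain ⟨w, W, hw, hw0, hwW, hwa, hwt⟩ := supersol (ha.continuous hα0) hap hφ hint hdim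
  obtain ⟨v, hv, hvL, hvω, hb⟩ := approx hα0 hα1 ha hc hap hcp hw hw0 hwW hwa
  obtain ⟨V, hV, hVL, hVe, U, hU1, hU2, hUt⟩ := limit_thm hα0 hα1 ha hc v hv hvL hb
  have hVw : ∀ x, -Real.log (w x) ≤ V x := by
    intro x
    have h1 : Tendsto (fun n : ℕ => Real.exp (-((n:ℝ) + 1))) atTop (nhds 0) := by
      refine Real.tendsto_exp_atBot.comp (tendsto_neg_atTop_atBot.comp ?_)
      exact tendsto_atTop_add_const_right _ _ tendsto_natCast_atTop_atTop
    have h2 : Tendsto (fun n : ℕ => -Real.log (w x + Real.exp (-((n:ℝ) + 1)))) atTop (nhds (-Real.log (w x))) := by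
      have h3 := h1.const_add (w x)
      rw [add_zero] at h3
      exact ((Real.continuousAt_log (hw0 x).ne').tendsto.comp h3).neg
    exact le_of_tendsto_of_tendsto' (h2.mono_left hU2) (hUt x) (fun n => hvω n x)
  set u : E → ℝ := fun x => Real.exp (-(V x)) with hu
  have hu2 : ContDiff ℝ 2 u := hV.neg.exp
  have hup : ∀ x, 0 < u x := fun x => Real.exp_pos _
  have hd1 : ∀ t : ℝ, HasDerivAt (fun t => Real.exp (-t)) (-Real.exp (-t)) t := fun t =>
    ((hasDerivAt_id t).neg.exp).congr_deriv (by simp)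
  have hd2 : ∀ t : ℝ, HasDerivAt (fun t => -Real.exp (-t)) (Real.exp (-t)) t := fun t =>
    (hd1 t).neg.congr_deriv (by simp)
  have hlapu : ∀ x, btr (hs u x) = u x * (‖fderiv ℝ V x‖ * ‖fderiv ℝ V x‖ - btr (hs V x)) := by
    intro x
    rw [hu, btr_hs_comp (f := fun t => Real.exp (-t)) (f1 := fun t => -Real.exp (-t)) hV.contDiffAt
      (Eventually.of_forall fun y => hd1 _) (hd2 _)]
    ring
  have hdu : ∀ x, ‖fderiv ℝ u x‖ = u x * ‖fderiv ℝ V x‖ := by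
    intro x
    rw [hu, fderiv_comp1 (f := fun t => Real.exp (-t)) (hV.differentiable (by simp) x) (hd1 _), norm_smul, norm_neg,
      Real.norm_of_nonneg (Real.exp_pos _).le]
  refine ⟨u, hu2, ?_, hup, ?_, fun x => ?_⟩
  · refine hs_LH hα0 hα1 hu2 ?_
    rw [funext hlapu]
    have h1 : LH α u := LH.of_C1 hα0 hα1 (hu2.of_le (by norm_num))
    have h2 : LH α (fun x => ‖fderiv ℝ V x‖) := (LH.of_C1 hα0 hα1 (C1_fderiv hV)).norm
    exact h1.mul hα0 ((h2.mul hα0 h2).sub hVL)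
  · refine squeeze_zero (fun x => (hup x).le) (fun x => ?_) hwt
    rw [← Real.exp_log (hw0 x)]
    exact Real.exp_le_exp.2 (by linarith [hVw x])
  · rw [hlapu, hdu, hVe x]
    have h1 : u x * Real.exp (V x) = 1 := by
      simp only [hu]; rw [← Real.exp_add]; simp
    have h2 := (hup x).ne'
    have h3 : c x * (u x)⁻¹ * (u x * ‖fderiv ℝ V x‖) ^ 2 = c x * u x * ‖fderiv ℝ V x‖ ^ 2 := by
      field_simp
    rw [h3]
    linear_combination (a x) * h1

end PartO

section PartQ
variable {N : ℕ}

theorem locHolder_iff_LH {F : Type*} [NormedAddCommGroup F] {α : NNReal} (hα0 : 0 < α)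
    {f : EuclideanSpace ℝ (Fin N) → F} : LocHolder α f ↔ LH (α : ℝ) f := by
  constructor
  · intro h R
    obtain ⟨C, hC⟩ := h _ (isCompact_closedBall 0 R)
    refine ⟨C, fun x hx y hy => ?_⟩
    have := hC.dist_le hx hy
    rwa [dist_eq_norm, dist_eq_norm] at this
  · intro h K hK
    obtain ⟨R, hR⟩ := hK.isBounded.subset_closedBall 0
    obtain ⟨C, hC⟩ := h R
    refine ⟨C.toNNReal, fun x hx y hy => ?_⟩
    have h1 := hC x (hR hx) y (hR hy)
    have h2 : ‖f x - f y‖ ≤ (C.toNNReal : ℝ) * ‖x - y‖ ^ (α : ℝ) := by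
      refine h1.trans (mul_le_mul_of_nonneg_right (Real.le_coe_toNNReal C) (by positivity))
    rw [edist_eq_enorm_sub, edist_eq_enorm_sub, ← ofReal_norm, ← ofReal_norm,
      ENNReal.ofReal_rpow_of_nonneg (norm_nonneg _) (by positivity),
      ← ENNReal.ofReal_coe_nnreal, ← ENNReal.ofReal_mul (by positivity)]
    exact ENNReal.ofReal_le_ofReal h2

theorem iter_hs {u : EuclideanSpace ℝ (Fin N) → ℝ} (x y : EuclideanSpace ℝ (Fin N)) :
    ‖iteratedFDeriv ℝ 2 u x - iteratedFDeriv ℝ 2 u y‖ ≤ ‖hs u x - hs u y‖ := by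
  refine ContinuousMultilinearMap.opNorm_le_bound (norm_nonneg _) fun m => ?_
  rw [sub_apply, iteratedFDeriv_two_apply, iteratedFDeriv_two_apply, Fin.prod_univ_two]
  have := (hs u x - hs u y).le_opNorm₂ (m 0) (m 1)
  rw [← mul_assoc]
  exact this

theorem lap_eq {u : EuclideanSpace ℝ (Fin N) → ℝ} (hu : ContDiff ℝ 2 u) (x : EuclideanSpace ℝ (Fin N)) :
    lap u x = btr (hs u x) := by
  rw [btr_eq_basis (EuclideanSpace.basisFun (Fin N) ℝ), lap]
  refine Finset.sum_congr rfl fun i _ => ?_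
  rw [fderiv_clm_apply (fderiv_diff hu.contDiffAt) (by fun_prop)]
  simp [hs]

theorem norm_grad (u : EuclideanSpace ℝ (Fin N) → ℝ) (x : EuclideanSpace ℝ (Fin N)) :
    ‖gradient u x‖ = ‖fderiv ℝ u x‖ := by
  rw [gradient, LinearIsometryEquiv.norm_map]

end PartQ

/-- **Theorem 2 (existence on ℝ^N).** Let `N > 2`, `a, c` locally α-Hölder on `ℝ^N`
(`α ∈ (0,1)`), `a > 0`, `c > 0` everywhere, `φ(r) = max_{|x| = r} a(x)` and
`∫₀^∞ r φ(r) dr < ∞`. Then the problem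
`-Δu + c(x) u⁻¹ |∇u|² = a(x)` in `ℝ^N`, `u > 0`, `u(x) → 0` as `|x| → ∞`
has a positive solution of class `C^{2,α}_loc(ℝ^N)` vanishing at infinity. -/
theorem singular_elliptic_existence_whole_space
    {N : ℕ} (hN : 2 < N) (α : NNReal) (hα0 : 0 < α) (hα1 : α < 1)
    (a c : EuclideanSpace ℝ (Fin N) → ℝ)
    (ha : LocHolder α a) (hc : LocHolder α c)
    (hapos : ∀ x, 0 < a x) (hcpos : ∀ x, 0 < c x)
    (φ : ℝ → ℝ)
    (hφ : ∀ r : ℝ, 0 ≤ r →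
      IsGreatest (a '' Metric.sphere (0 : EuclideanSpace ℝ (Fin N)) r) (φ r))
    (hint : IntegrableOn (fun r : ℝ => r * φ r) (Set.Ioi 0)) :
    ∃ u : EuclideanSpace ℝ (Fin N) → ℝ,
      ContDiff ℝ 2 u ∧
      LocHolder α (iteratedFDeriv ℝ 2 u) ∧
      (∀ x, 0 < u x) ∧
      Tendsto u (cocompact (EuclideanSpace ℝ (Fin N))) (nhds 0) ∧
      (∀ x, -lap u x + c x * (u x)⁻¹ * ‖gradient u x‖ ^ 2 = a x) := by
  have hα0' : (0:ℝ) < (α:ℝ) := by exact_mod_cast hα0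
  have hα1' : (α:ℝ) < 1 := by exact_mod_cast hα1
  obtain ⟨u, hu, huL, hup, hut, hue⟩ := main_E hα0' hα1' ((locHolder_iff_LH hα0).1 ha)
    ((locHolder_iff_LH hα0).1 hc) hapos hcpos hφ hint (by rw [finrank_euclideanSpace_fin]; omega)
  refine ⟨u, hu, (locHolder_iff_LH hα0).2 fun R => ?_, hup, hut, fun x => ?_⟩
  · obtain ⟨C, hC⟩ := huL R
    exact ⟨C, fun x hx y hy => (iter_hs x y).trans (hC x hx y hy)⟩
  · rw [lap_eq hu, norm_grad]
    exact hue x
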